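/- Let a, q ≥ 1 be fixed integers with gcd(a,q) = 1 and 1 ≤ a ≤ q, and set α = a/q. Then, unconditionally, ∫_T^{2T} |ζ(1/2+it, α)|⁴ dt = (q²/φ(q)⁴) · Σ_χ ∫_T^{2T} |L(1/2+it, χ)|⁴ dt + E(T), where the sum runs over all Dirichlet characters χ modulo q, φ is Euler's totient function, and E(T)/(T (log T)⁴) → 0 as T → ∞. -/

import Mathlib

open Complex Filter MeasureTheory Finset HurwitzZeta
open scoped ArithmeticFunction Real Classical

noncomputable section

/-- The finite set of primes `p ≤ X`. -/
def primesUpTo (X : ℝ) : Finset ℕ :=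
  (Finset.range (Nat.floor X + 1)).filter (fun p => p.Prime ∧ (p : ℝ) ≤ X)

/-- The finite set of naturals `n ≤ X`. -/
def natsUpTo (X : ℝ) : Finset ℕ :=
  (Finset.range (Nat.floor X + 1)).filter (fun n => (n : ℝ) ≤ X)

/-- Truncated Euler product `P_X(s,χ)`, defined via the primitive character `χ*` inducing `χ`:
`P_X(s,χ) = ∏_{p ∣ q} (1 - χ*(p) p^{-s}) · exp(∑_{n ≤ X} χ*(n) Λ(n) / (n^s log n))`. -/
def PX {q : ℕ} (X : ℝ) (χ : DirichletCharacter ℂ q) (s : ℂ) : ℂ :=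
  (∏ p ∈ q.primeFactors, (1 - χ.primitiveCharacter ((p : ℕ) : ZMod χ.conductor) * (p : ℂ) ^ (-s))) *
    Complex.exp (∑ n ∈ natsUpTo X,
      χ.primitiveCharacter ((n : ℕ) : ZMod χ.conductor) * (Λ n : ℂ) / ((n : ℂ) ^ s * (Real.log n : ℂ)))

/-- `𝓟_X^ℓ(s) = ∏_χ P_X(s,χ)^{ℓ_χ}`. -/
def PXl {q : ℕ} (X : ℝ) (ℓ : DirichletCharacter ℂ q → ℕ) (s : ℂ) : ℂ :=
  ∏ χ : DirichletCharacter ℂ q, (PX X χ s) ^ (ℓ χ)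

/-- A Dirichlet character as an arithmetic function. -/
def chiArith {q : ℕ} (χ : DirichletCharacter ℂ q) : ArithmeticFunction ℂ :=
  ⟨fun n => if n = 0 then 0 else χ ((n : ℕ) : ZMod q), by simp⟩

/-- `d_ℓ`, the coefficients of the Dirichlet series of `𝓛^ℓ(s) = ∏_χ L(s,χ)^{ℓ_χ}`,
i.e. the Dirichlet convolution product `∏_χ χ^{*ℓ_χ}`. -/
def dcoef {q : ℕ} (ℓ : DirichletCharacter ℂ q → ℕ) : ArithmeticFunction ℂ :=
  ∏ χ : DirichletCharacter ℂ q, (chiArith χ) ^ (ℓ χ)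

/-- `P*_X(s,χ) = ∏_{p ≤ X}(1 − χ(p)p^{−s})^{−1} · ∏_{√X < p ≤ X}(1 + χ(p)²/(2p^{2s}))^{−1}`. -/
def PstarX {q : ℕ} (X : ℝ) (χ : DirichletCharacter ℂ q) (s : ℂ) : ℂ :=
  ((primesUpTo X).prod (fun p : ℕ => (1 - χ ((p : ℕ) : ZMod q) * (p : ℂ) ^ (-s))⁻¹)) *
    ((primesUpTo X).filter (fun p : ℕ => Real.sqrt X < (p : ℝ))).prod
      (fun p : ℕ => (1 + χ ((p : ℕ) : ZMod q) ^ 2 / (2 * (p : ℂ) ^ (2 * s)))⁻¹)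

/-- `𝓟*_X^ℓ(s) = ∏_χ P*_X(s,χ)^{ℓ_χ}`. -/
def PstarXl {q : ℕ} (X : ℝ) (ℓ : DirichletCharacter ℂ q → ℕ) (s : ℂ) : ℂ :=
  ∏ χ : DirichletCharacter ℂ q, (PstarX X χ s) ^ (ℓ χ)

/-- `Q_X(s,χ) = ∏_{p ≤ √X}(1 − χ(p)p^{−s}) · ∏_{√X < p ≤ X}(1 − χ(p)p^{−s} + χ(p)²/(2p^{2s}))`. -/
def QX {q : ℕ} (X : ℝ) (χ : DirichletCharacter ℂ q) (s : ℂ) : ℂ :=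
  (((primesUpTo X).filter (fun p : ℕ => (p : ℝ) ≤ Real.sqrt X)).prod
      (fun p : ℕ => 1 - χ ((p : ℕ) : ZMod q) * (p : ℂ) ^ (-s))) *
    ((primesUpTo X).filter (fun p : ℕ => Real.sqrt X < (p : ℝ))).prod
      (fun p : ℕ => 1 - χ ((p : ℕ) : ZMod q) * (p : ℂ) ^ (-s)
        + χ ((p : ℕ) : ZMod q) ^ 2 / (2 * (p : ℂ) ^ (2 * s)))

/-- `𝓠_X^ℓ(s) = ∏_χ Q_X(s,χ)^{ℓ_χ}`. -/
def QXl {q : ℕ} (X : ℝ) (ℓ : DirichletCharacter ℂ q → ℕ) (s : ℂ) : ℂ :=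
  ∏ χ : DirichletCharacter ℂ q, (QX X χ s) ^ (ℓ χ)

/-- `𝓛^ℓ(s) = ∏_χ L(s,χ)^{ℓ_χ}`. -/
def Ll {q : ℕ} [NeZero q] (ℓ : DirichletCharacter ℂ q → ℕ) (s : ℂ) : ℂ :=
  ∏ χ : DirichletCharacter ℂ q, (DirichletCharacter.LFunction χ s) ^ (ℓ χ)

/-- GRH for the Dirichlet L-functions modulo `q`: every zero `ρ` of `L(s,χ)` with
`0 < Re ρ < 1` satisfies `Re ρ = 1/2`. -/
def GRHmod (q : ℕ) [NeZero q] : Prop :=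
  ∀ χ : DirichletCharacter ℂ q, ∀ ρ : ℂ,
    DirichletCharacter.LFunction χ ρ = 0 → 0 < ρ.re → ρ.re < 1 → ρ.re = 1 / 2

end

namespace HurwitzFourthMoment

lemma exp_neg_sq_div_four_le (y : ℝ) : Real.exp (-y ^ 2 / 4) ≤ Real.exp 1 * Real.exp y := by
  rw [← Real.exp_add]
  exact Real.exp_le_exp.mpr (by nlinarith [sq_nonneg (y + 2)])

lemma gaussian_log_le_rpow {x : ℝ} (hx : 0 < x) (T : ℝ) :
    Real.exp (-(T * Real.log x) ^ 2 / 4) ≤ Real.exp 1 * x ^ T := by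
  rw [Real.rpow_def_of_pos hx, mul_comm (Real.log x)]
  exact exp_neg_sq_div_four_le _

lemma gaussian_log_le_rpow_neg {x : ℝ} (hx : 0 < x) (T : ℝ) :
    Real.exp (-(T * Real.log x) ^ 2 / 4) ≤ Real.exp 1 * x ^ (-T) := by
  simpa using gaussian_log_le_rpow hx (-T)

lemma sum_gaussian_log_below_le {T : ℝ} (hT : 2 ≤ T) {n : ℕ} (hn : 1 ≤ n) :
    ∑ m ∈ Ico 1 n, Real.exp (-(T * Real.log ((m : ℝ) / n)) ^ 2 / 4) ≤ Real.exp 1 * (n / T) := by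
  have hn0 : (0 : ℝ) < n := by exact_mod_cast hn
  have hmono : MonotoneOn (fun x : ℝ => x ^ T) (Set.Icc ((1 : ℕ) : ℝ) n) := by
    intro x hx y _ hxy
    have : (0 : ℝ) ≤ x := le_trans (by norm_num) hx.1
    exact Real.rpow_le_rpow this hxy (by linarith)
  have h1 := MonotoneOn.sum_le_integral_Ico hn hmono
  rw [integral_rpow (Or.inl (by linarith))] at h1
  have h2 : ((n : ℝ) ^ (T + 1) - ((1 : ℕ) : ℝ) ^ (T + 1)) / (T + 1) ≤ (n : ℝ) ^ (T + 1) / T := by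
    have : (0 : ℝ) < (n : ℝ) ^ (T + 1) := Real.rpow_pos_of_pos hn0 _
    simp only [Nat.cast_one, Real.one_rpow]
    gcongr <;> linarith
  calc ∑ m ∈ Ico 1 n, Real.exp (-(T * Real.log ((m : ℝ) / n)) ^ 2 / 4)
      ≤ ∑ m ∈ Ico 1 n, Real.exp 1 * ((m : ℝ) ^ T * (n : ℝ) ^ (-T)) := by
        refine sum_le_sum fun m hm => ?_
        have hm0 : (0 : ℝ) < m := by exact_mod_cast (mem_Ico.mp hm).1
        refine (gaussian_log_le_rpow (div_pos hm0 hn0) T).trans_eq ?_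
        rw [Real.div_rpow hm0.le hn0.le, Real.rpow_neg hn0.le, div_eq_mul_inv]
    _ = Real.exp 1 * ((∑ m ∈ Ico 1 n, (m : ℝ) ^ T) * (n : ℝ) ^ (-T)) := by
        rw [← mul_sum, ← sum_mul]
    _ ≤ Real.exp 1 * ((n : ℝ) ^ (T + 1) / T * (n : ℝ) ^ (-T)) := by
        gcongr; exact h1.trans h2
    _ = Real.exp 1 * (n / T) := by
        rw [div_mul_eq_mul_div, ← Real.rpow_add hn0]; simp

lemma sum_gaussian_log_above_le {T : ℝ} (hT : 2 ≤ T) {n : ℕ} (hn : 1 ≤ n) (M : ℕ) :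
    ∑ m ∈ Ico n (n + M), Real.exp (-(T * Real.log (((m + 1 : ℕ) : ℝ) / n)) ^ 2 / 4)
      ≤ Real.exp 1 * (2 * n / T) := by
  have hn0 : (0 : ℝ) < n := by exact_mod_cast hn
  have hanti : AntitoneOn (fun x : ℝ => x ^ (-T)) (Set.Icc (n : ℝ) ((n + M : ℕ) : ℝ)) := by
    intro x hx y _ hxy
    exact Real.rpow_le_rpow_of_nonpos (hn0.trans_le hx.1) hxy (by linarith)
  have hM : n ≤ n + M := Nat.le_add_right _ _
  have hM' : (0 : ℝ) < ((n + M : ℕ) : ℝ) := by exact_mod_cast hn.trans hM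
  have h1 := AntitoneOn.sum_le_integral_Ico hM hanti
  rw [integral_rpow (Or.inr ⟨by linarith, by
    rw [Set.uIcc_of_le (by exact_mod_cast hM)]
    exact fun h => absurd h.1 (not_le.mpr hn0)⟩)] at h1
  have h2 : (((n + M : ℕ) : ℝ) ^ (-T + 1) - (n : ℝ) ^ (-T + 1)) / (-T + 1)
      ≤ 2 * (n : ℝ) ^ (-T + 1) / T := by
    have a1 : (0 : ℝ) < ((n + M : ℕ) : ℝ) ^ (-T + 1) := Real.rpow_pos_of_pos hM' _
    have a2 : (0 : ℝ) < (n : ℝ) ^ (-T + 1) := Real.rpow_pos_of_pos hn0 _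
    rw [← neg_div_neg_eq, div_le_div_iff₀ (by linarith) (by linarith)]
    nlinarith
  calc ∑ m ∈ Ico n (n + M), Real.exp (-(T * Real.log (((m + 1 : ℕ) : ℝ) / n)) ^ 2 / 4)
      ≤ ∑ m ∈ Ico n (n + M), Real.exp 1 * (((m + 1 : ℕ) : ℝ) ^ (-T) * (n : ℝ) ^ T) := by
        refine sum_le_sum fun m _ => ?_
        have hm0 : (0 : ℝ) < ((m + 1 : ℕ) : ℝ) := by exact_mod_cast Nat.succ_pos m
        refine (gaussian_log_le_rpow_neg (div_pos hm0 hn0) T).trans_eq ?_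
        rw [Real.div_rpow hm0.le hn0.le, Real.rpow_neg hn0.le, div_inv_eq_mul]
    _ = Real.exp 1 * ((∑ m ∈ Ico n (n + M), ((m + 1 : ℕ) : ℝ) ^ (-T)) * (n : ℝ) ^ T) := by
        rw [← mul_sum, ← sum_mul]
    _ ≤ Real.exp 1 * ((2 * (n : ℝ) ^ (-T + 1) / T) * (n : ℝ) ^ T) := by
        gcongr; exact h1.trans h2
    _ = Real.exp 1 * (2 * n / T) := by
        rw [div_mul_eq_mul_div, mul_assoc, ← Real.rpow_add hn0]; simp

lemma sum_gaussian_log_le {T : ℝ} (hT : 2 ≤ T) {n : ℕ} (hn : 1 ≤ n) (M : ℕ) :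
    ∑ m ∈ Icc 1 M, Real.exp (-(T * Real.log ((m : ℝ) / n)) ^ 2 / 4) ≤ 1 + 9 * n / T := by
  have hn0 : (0 : ℝ) < n := by exact_mod_cast hn
  have hsub : Icc 1 M ⊆ Ico 1 n ∪ ({n} ∪ (Ico n (n + M)).image (· + 1)) := by
    intro m hm
    simp only [mem_union, mem_Ico, mem_singleton, mem_image, mem_Icc] at hm ⊢
    rcases lt_trichotomy m n with h | h | h
    · exact Or.inl ⟨hm.1, h⟩
    · exact Or.inr (Or.inl h)
    · exact Or.inr (Or.inr ⟨m - 1, by omega, by omega⟩)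
  have hpos : ∀ m : ℕ, 0 ≤ Real.exp (-(T * Real.log ((m : ℝ) / n)) ^ 2 / 4) :=
    fun _ => (Real.exp_pos _).le
  have hU : ∀ s t : Finset ℕ, ∑ m ∈ s ∪ t, Real.exp (-(T * Real.log ((m : ℝ) / n)) ^ 2 / 4) ≤
      ∑ m ∈ s, Real.exp (-(T * Real.log ((m : ℝ) / n)) ^ 2 / 4) +
      ∑ m ∈ t, Real.exp (-(T * Real.log ((m : ℝ) / n)) ^ 2 / 4) := by
    intro s t
    rw [← sum_union_inter]
    exact le_add_of_nonneg_right (sum_nonneg fun m _ => hpos m)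
  have h1 := sum_gaussian_log_below_le hT hn
  have h2 := sum_gaussian_log_above_le hT hn M
  have h3 : ∑ m ∈ ((Ico n (n + M)).image (· + 1) : Finset ℕ),
      Real.exp (-(T * Real.log ((m : ℝ) / n)) ^ 2 / 4)
      ≤ Real.exp 1 * (2 * n / T) := by
    rw [sum_image (add_left_injective 1).injOn]
    exact h2
  have h4 : ∑ m ∈ ({n} : Finset ℕ), Real.exp (-(T * Real.log ((m : ℝ) / n)) ^ 2 / 4) = 1 := by
    simp [hn0.ne']
  have h5 := (sum_le_sum_of_subset_of_nonneg hsub fun m _ _ => hpos m).trans (hU _ _)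
  have h6 := hU {n} ((Ico n (n + M)).image (· + 1))
  have he : Real.exp 1 * (3 * n / T) ≤ 3 * (3 * n / T) := by
    gcongr
    exact Real.exp_one_lt_three.le
  have e1 : Real.exp 1 * (n / T) + Real.exp 1 * (2 * n / T) = Real.exp 1 * (3 * n / T) := by ring
  have e2 : 3 * (3 * (n : ℝ) / T) = 9 * n / T := by ring
  linarith

/-- Schur's test for the Gaussian kernel in `log (m / n)`. -/
lemma sum_sum_gaussian_log_le {T : ℝ} (hT : 2 ≤ T) (M : ℕ) (b : ℕ → ℝ) :
    ∑ m ∈ Icc 1 M, ∑ n ∈ Icc 1 M, b m * b n * Real.exp (-(T * Real.log ((m : ℝ) / n)) ^ 2 / 4)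
      ≤ ∑ n ∈ Icc 1 M, b n ^ 2 * (1 + 9 * n / T) := by
  set k : ℕ → ℕ → ℝ := fun m n => Real.exp (-(T * Real.log ((m : ℝ) / n)) ^ 2 / 4) with hk
  have hsymm : ∀ m n, k m n = k n m := by
    intro m n
    have : Real.log ((m : ℝ) / n) = -Real.log ((n : ℝ) / m) := by rw [← Real.log_inv, inv_div]
    simp only [hk]
    rw [this]
    ring_nf
  have hpos : ∀ m n, 0 < k m n := fun _ _ => Real.exp_pos _
  have h1 : ∑ m ∈ Icc 1 M, ∑ n ∈ Icc 1 M, b m * b n * k m n ≤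
      ∑ m ∈ Icc 1 M, ∑ n ∈ Icc 1 M, (b m ^ 2 * k m n / 2 + b n ^ 2 * k m n / 2) := by
    refine sum_le_sum fun m _ => sum_le_sum fun n _ => ?_
    nlinarith [mul_nonneg (hpos m n).le (sq_nonneg (b m - b n))]
  have h2 : ∑ m ∈ Icc 1 M, ∑ n ∈ Icc 1 M, (b m ^ 2 * k m n / 2 + b n ^ 2 * k m n / 2) =
      ∑ n ∈ Icc 1 M, b n ^ 2 * ∑ m ∈ Icc 1 M, k m n := by
    simp_rw [sum_add_distrib]
    rw [sum_comm (f := fun m n => b n ^ 2 * k m n / 2), ← sum_add_distrib]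
    refine sum_congr rfl fun n _ => ?_
    rw [← sum_add_distrib, mul_sum]
    refine sum_congr rfl fun m _ => ?_
    rw [hsymm n m]; ring
  rw [h2] at h1
  refine h1.trans (sum_le_sum fun n hn => ?_)
  exact mul_le_mul_of_nonneg_left (sum_gaussian_log_le hT (mem_Icc.mp hn).1 M) (sq_nonneg _)

lemma integral_gaussian_mul_phase {T : ℝ} (hT : 0 < T) (y : ℝ) :
    ∫ t : ℝ, cexp (I * y * t) * cexp (-((1 / T ^ 2 : ℝ) : ℂ) * t ^ 2)
      = (Real.sqrt π * T * Real.exp (-(T * y) ^ 2 / 4) : ℝ) := by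
  have hb : 0 < (1 / T ^ 2 : ℝ) := by positivity
  rw [fourierIntegral_gaussian (by rw [ofReal_re]; exact hb)]
  have h1 : ((π : ℂ) / ((1 / T ^ 2 : ℝ) : ℂ)) ^ (1 / 2 : ℂ) = ((Real.sqrt π * T : ℝ) : ℂ) := by
    rw [← ofReal_div, show (1 / 2 : ℂ) = ((1 / 2 : ℝ) : ℂ) by norm_num,
      ← ofReal_cpow (by positivity), ← Real.sqrt_eq_rpow]
    congr 1
    rw [div_div_eq_mul_div, div_one, Real.sqrt_mul Real.pi_pos.le, Real.sqrt_sq hT.le]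
  rw [h1]
  push_cast
  congr 2
  have : (T : ℂ) ≠ 0 := by exact_mod_cast hT.ne'
  field_simp

lemma integrable_gaussian_mul_phase {T : ℝ} (hT : 0 < T) (y : ℝ) :
    Integrable fun t : ℝ => cexp (I * y * t) * cexp (-((1 / T ^ 2 : ℝ) : ℂ) * t ^ 2) := by
  have hb : 0 < (1 / T ^ 2 : ℝ) := by positivity
  have h : Integrable fun t : ℝ => ((Real.exp (-(1 / T ^ 2) * t ^ 2) : ℝ) : ℂ) :=
    (integrable_exp_neg_mul_sq hb).ofReal
  have hc : Continuous fun t : ℝ => cexp (I * y * t) := by fun_prop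
  refine (h.bdd_mul (c := 1) hc.aestronglyMeasurable (ae_of_all _ fun t => ?_)).congr
    (ae_of_all _ fun t => ?_)
  · rw [show I * y * t = ((y * t : ℝ) : ℂ) * I by push_cast; ring, norm_exp_ofReal_mul_I]
  · push_cast; rfl

lemma normSq_sum_phase (M : ℕ) (a : ℕ → ℂ) (t : ℝ) :
    ((‖∑ n ∈ Icc 1 M, a n * cexp (-(I * Real.log n * t))‖ ^ 2 : ℝ) : ℂ) =
      ∑ m ∈ Icc 1 M, ∑ n ∈ Icc 1 M,
        a m * (starRingEnd ℂ) (a n) * cexp (I * (Real.log n - Real.log m : ℝ) * t) := by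
  rw [ofReal_pow, ← mul_conj', map_sum, sum_mul_sum]
  refine sum_congr rfl fun m _ => sum_congr rfl fun n _ => ?_
  rw [map_mul, ← Complex.exp_conj]
  simp only [map_neg, map_mul, conj_I, conj_ofReal]
  rw [show a m * cexp (-(I * Real.log m * t)) * ((starRingEnd ℂ) (a n) *
    cexp (-(-I * Real.log n * t))) = a m * (starRingEnd ℂ) (a n) *
    (cexp (-(I * Real.log m * t)) * cexp (-(-I * Real.log n * t))) by ring, ← Complex.exp_add]
  congr 2
  rw [ofReal_sub]
  ring

lemma integral_gaussian_normSq_sum_le {T : ℝ} (hT : 2 ≤ T) (M : ℕ) (a : ℕ → ℂ) :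
    Integrable (fun t : ℝ => ‖∑ n ∈ Icc 1 M, a n * cexp (-(I * Real.log n * t))‖ ^ 2 *
      Real.exp (-(1 / T ^ 2) * t ^ 2)) ∧
    ∫ t : ℝ, ‖∑ n ∈ Icc 1 M, a n * cexp (-(I * Real.log n * t))‖ ^ 2 *
      Real.exp (-(1 / T ^ 2) * t ^ 2) ≤ 18 * ∑ n ∈ Icc 1 M, ‖a n‖ ^ 2 * (T + n) := by
  have hT0 : 0 < T := by linarith
  set F : ℝ → ℝ := fun t => ‖∑ n ∈ Icc 1 M, a n * cexp (-(I * Real.log n * t))‖ ^ 2 *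
      Real.exp (-(1 / T ^ 2) * t ^ 2) with hF
  have hFc : ∀ t, ((F t : ℝ) : ℂ) = ∑ m ∈ Icc 1 M, ∑ n ∈ Icc 1 M,
      a m * (starRingEnd ℂ) (a n) * (cexp (I * (Real.log n - Real.log m : ℝ) * t) *
        cexp (-((1 / T ^ 2 : ℝ) : ℂ) * t ^ 2)) := by
    intro t
    simp only [hF]
    rw [ofReal_mul, normSq_sum_phase, sum_mul]
    refine sum_congr rfl fun m _ => ?_
    rw [sum_mul]
    refine sum_congr rfl fun n _ => ?_
    push_cast
    ring
  have hint : Integrable fun t => ((F t : ℝ) : ℂ) := by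
    simp_rw [hFc]
    exact integrable_finsetSum _ fun m _ => integrable_finsetSum _ fun n _ =>
      (integrable_gaussian_mul_phase hT0 _).const_mul _
  have hintR : Integrable F := by simpa using hint.re
  refine ⟨hintR, ?_⟩
  have hval : ((∫ t, F t : ℝ) : ℂ) = ∑ m ∈ Icc 1 M, ∑ n ∈ Icc 1 M,
      a m * (starRingEnd ℂ) (a n) *
        (Real.sqrt π * T * Real.exp (-(T * (Real.log n - Real.log m)) ^ 2 / 4) : ℝ) := by
    rw [← integral_complex_ofReal]
    simp_rw [hFc]
    rw [integral_finsetSum _ fun m _ => integrable_finsetSum _ fun n _ =>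
      (integrable_gaussian_mul_phase hT0 _).const_mul _]
    refine sum_congr rfl fun m _ => ?_
    rw [integral_finsetSum _ fun n _ => (integrable_gaussian_mul_phase hT0 _).const_mul _]
    refine sum_congr rfl fun n _ => ?_
    rw [integral_const_mul, integral_gaussian_mul_phase hT0]
  have hsq : Real.sqrt π ≤ 2 := by
    rw [Real.sqrt_le_left (by norm_num)]; linarith [Real.pi_lt_four]
  have h1 : ∫ t, F t ≤ ‖((∫ t, F t : ℝ) : ℂ)‖ := by
    rw [norm_real]; exact le_abs_self _
  have h2 : ‖((∫ t, F t : ℝ) : ℂ)‖ ≤ Real.sqrt π * T * ∑ m ∈ Icc 1 M, ∑ n ∈ Icc 1 M,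
      ‖a m‖ * ‖a n‖ * Real.exp (-(T * Real.log ((m : ℝ) / n)) ^ 2 / 4) := by
    rw [hval, mul_sum]
    refine (norm_sum_le _ _).trans (sum_le_sum fun m hm => ?_)
    rw [mul_sum]
    refine (norm_sum_le _ _).trans (sum_le_sum fun n hn => ?_)
    have hm0 : (m : ℝ) ≠ 0 := by exact_mod_cast (Nat.one_le_iff_ne_zero.mp (mem_Icc.mp hm).1)
    have hn0 : (n : ℝ) ≠ 0 := by exact_mod_cast (Nat.one_le_iff_ne_zero.mp (mem_Icc.mp hn).1)
    rw [norm_mul, norm_mul, RCLike.norm_conj, norm_real, Real.norm_of_nonneg (by positivity),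
      Real.log_div hm0 hn0,
      show (T * (Real.log n - Real.log m)) ^ 2 = (T * (Real.log m - Real.log n)) ^ 2 by ring]
    apply le_of_eq
    ring
  refine h1.trans (h2.trans ?_)
  calc _ ≤ Real.sqrt π * T * ∑ n ∈ Icc 1 M, ‖a n‖ ^ 2 * (1 + 9 * n / T) := by
        exact mul_le_mul_of_nonneg_left (sum_sum_gaussian_log_le hT M fun n => ‖a n‖)
          (by positivity)
    _ ≤ 2 * T * ∑ n ∈ Icc 1 M, ‖a n‖ ^ 2 * (1 + 9 * n / T) := by
        gcongr
    _ = ∑ n ∈ Icc 1 M, ‖a n‖ ^ 2 * (2 * T + 18 * n) := by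
        rw [mul_sum]
        refine sum_congr rfl fun n _ => ?_
        field_simp
        ring
    _ ≤ 18 * ∑ n ∈ Icc 1 M, ‖a n‖ ^ 2 * (T + n) := by
        rw [mul_sum]
        refine sum_le_sum fun n _ => ?_
        nlinarith [mul_nonneg (sq_nonneg ‖a n‖) hT0.le]

/-- Mean value theorem for Dirichlet polynomials. -/
lemma integral_normSq_dirichletPolynomial_le {T : ℝ} (hT : 2 ≤ T) (u : ℝ) (M : ℕ) (a : ℕ → ℂ) :
    ∫ t in u..(u + T), ‖∑ n ∈ Icc 1 M, a n * cexp (-(I * Real.log n * t))‖ ^ 2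
      ≤ 54 * ∑ n ∈ Icc 1 M, ‖a n‖ ^ 2 * (T + n) := by
  have hT0 : 0 < T := by linarith
  set b : ℕ → ℂ := fun n => a n * cexp (-(I * Real.log n * u)) with hb
  have hbn : ∀ n, ‖b n‖ = ‖a n‖ := by
    intro n
    rw [hb]
    simp only [norm_mul]
    rw [show -(I * (Real.log n : ℂ) * (u : ℂ)) = ((-(Real.log n * u) : ℝ) : ℂ) * I by
      push_cast; ring, norm_exp_ofReal_mul_I, mul_one]
  have hshift : ∫ t in u..(u + T), ‖∑ n ∈ Icc 1 M, a n * cexp (-(I * Real.log n * t))‖ ^ 2 =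
      ∫ t in (0 : ℝ)..T, ‖∑ n ∈ Icc 1 M, b n * cexp (-(I * Real.log n * t))‖ ^ 2 := by
    have := intervalIntegral.integral_comp_add_right (a := 0) (b := T)
      (fun t : ℝ => ‖∑ n ∈ Icc 1 M, a n * cexp (-(I * Real.log n * t))‖ ^ 2) u
    rw [zero_add, add_comm T u] at this
    rw [← this]
    congr 1
    ext t
    congr 2
    refine sum_congr rfl fun n _ => ?_
    simp only [hb]
    rw [mul_assoc (a n), ← Complex.exp_add]
    congr 2
    rw [ofReal_add]
    ring
  rw [hshift]
  obtain ⟨hi, hle⟩ := integral_gaussian_normSq_sum_le hT M b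
  simp only [hbn] at hle
  have hcont : Continuous fun t : ℝ => ‖∑ n ∈ Icc 1 M, b n * cexp (-(I * Real.log n * t))‖ ^ 2 := by
    fun_prop
  have h1 : ∫ t in (0 : ℝ)..T, ‖∑ n ∈ Icc 1 M, b n * cexp (-(I * Real.log n * t))‖ ^ 2 ≤
      ∫ t in (0 : ℝ)..T, 3 * (‖∑ n ∈ Icc 1 M, b n * cexp (-(I * Real.log n * t))‖ ^ 2 *
        Real.exp (-(1 / T ^ 2) * t ^ 2)) := by
    refine intervalIntegral.integral_mono_on hT0.le (hcont.intervalIntegrable _ _)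
      (Continuous.intervalIntegrable (by fun_prop) _ _) fun t ht => ?_
    have hexp : 1 ≤ 3 * Real.exp (-(1 / T ^ 2) * t ^ 2) := by
      have h2 : Real.exp (-1) ≤ Real.exp (-(1 / T ^ 2) * t ^ 2) := by
        refine Real.exp_le_exp.mpr ?_
        rw [neg_mul, neg_le_neg_iff, one_div_mul_eq_div, div_le_one (by positivity)]
        exact pow_le_pow_left₀ ht.1 ht.2 2
      have h3 : 1 ≤ 3 * Real.exp (-1) := by
        rw [Real.exp_neg, ← div_eq_mul_inv, one_le_div (Real.exp_pos 1)]
        exact Real.exp_one_lt_three.le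
      linarith
    nlinarith [sq_nonneg ‖∑ n ∈ Icc 1 M, b n * cexp (-(I * Real.log n * t))‖]
  refine h1.trans ?_
  rw [intervalIntegral.integral_const_mul, intervalIntegral.integral_of_le hT0.le]
  have h4 : ∫ t in Set.Ioc 0 T, ‖∑ n ∈ Icc 1 M, b n * cexp (-(I * Real.log n * t))‖ ^ 2 *
        Real.exp (-(1 / T ^ 2) * t ^ 2) ≤
            ∫ t : ℝ, ‖∑ n ∈ Icc 1 M, b n * cexp (-(I * Real.log n * t))‖ ^ 2 *
        Real.exp (-(1 / T ^ 2) * t ^ 2) :=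
    setIntegral_le_integral hi (ae_of_all _ fun t => by positivity)
  linarith

lemma term_add_mul_I (f : ℕ → ℂ) (σ t : ℝ) {n : ℕ} (hn : n ≠ 0) :
    LSeries.term f (σ + t * I) n = f n * ((n : ℝ) ^ (-σ) : ℝ) * cexp (-(I * Real.log n * t)) := by
  have hn0 : (n : ℂ) ≠ 0 := by exact_mod_cast hn
  rw [LSeries.term_of_ne_zero hn, div_eq_mul_inv, ← cpow_neg, neg_add, cpow_add _ _ hn0, mul_assoc]
  congr 2
  · rw [ofReal_cpow (Nat.cast_nonneg n)]
    simp
  · rw [cpow_def_of_ne_zero hn0, natCast_log]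
    congr 1
    ring

lemma integral_normSq_sum_term_le {T : ℝ} (hT : 2 ≤ T) (u σ : ℝ) (M : ℕ) (f : ℕ → ℂ) :
    ∫ t in u..(u + T), ‖∑ n ∈ Icc 1 M, LSeries.term f (σ + t * I) n‖ ^ 2
      ≤ 54 * ∑ n ∈ Icc 1 M, ‖f n‖ ^ 2 * (n : ℝ) ^ (-2 * σ) * (T + n) := by
  have h := integral_normSq_dirichletPolynomial_le hT u M fun n => f n * ((n : ℝ) ^ (-σ) : ℝ)
  have h1 : ∀ t : ℝ, ∑ n ∈ Icc 1 M, LSeries.term f (σ + t * I) n =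
      ∑ n ∈ Icc 1 M, f n * ((n : ℝ) ^ (-σ) : ℝ) * cexp (-(I * Real.log n * t)) := fun t =>
    sum_congr rfl fun n hn => term_add_mul_I f σ t (Nat.one_le_iff_ne_zero.mp (mem_Icc.mp hn).1)
  simp_rw [h1]
  refine h.trans_eq ?_
  congr 1
  refine sum_congr rfl fun n _ => ?_
  rw [norm_mul, norm_real, mul_pow, Real.norm_of_nonneg (by positivity),
    ← Real.rpow_natCast ((n : ℝ) ^ (-σ)), ← Real.rpow_mul (Nat.cast_nonneg n)]
  congr 3
  push_cast
  ring

lemma continuous_sum_term (σ : ℝ) (M : ℕ) (f : ℕ → ℂ) :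
    Continuous fun t : ℝ => ∑ n ∈ Icc 1 M, LSeries.term f (σ + t * I) n := by
  have h1 : (fun t : ℝ => ∑ n ∈ Icc 1 M, LSeries.term f (σ + t * I) n) =
      fun t : ℝ => ∑ n ∈ Icc 1 M, f n * ((n : ℝ) ^ (-σ) : ℝ) * cexp (-(I * Real.log n * t)) :=
    funext fun t =>
      sum_congr rfl fun n hn => term_add_mul_I f σ t (Nat.one_le_iff_ne_zero.mp (mem_Icc.mp hn).1)
  rw [h1]
  fun_prop

lemma norm_term_add_mul_I (f : ℕ → ℂ) (σ t : ℝ) (n : ℕ) :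
    ‖LSeries.term f (σ + t * I) n‖ = ‖LSeries.term f σ n‖ := by
  simp [LSeries.norm_term_eq]

lemma tendsto_sum_Icc_term {f : ℕ → ℂ} {s : ℂ} (hf : LSeriesSummable f s) :
    Tendsto (fun M => ∑ n ∈ Icc 1 M, LSeries.term f s n) atTop (nhds (LSeries f s)) := by
  have h := (Summable.hasSum hf).tendsto_sum_nat.comp (tendsto_add_atTop_nat 1)
  refine h.congr fun M => ?_
  simp only [Function.comp]
  rw [range_eq_Ico, sum_eq_sum_Ico_succ_bot (Nat.succ_pos M), LSeries.term_zero, zero_add]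
  rfl

lemma integral_normSq_LSeries_le {T : ℝ} (hT : 2 ≤ T) (u : ℝ) {σ : ℝ} {f : ℕ → ℂ}
    (hf : LSeriesSummable f σ) {B : ℝ}
    (hB : ∀ M, ∑ n ∈ Icc 1 M, ‖f n‖ ^ 2 * (n : ℝ) ^ (-2 * σ) * (T + n) ≤ B) :
    ∫ t in u..(u + T), ‖LSeries f (σ + t * I)‖ ^ 2 ≤ 54 * B := by
  have hlim : Tendsto (fun M => ∫ t in u..(u + T),
      ‖∑ n ∈ Icc 1 M, LSeries.term f (σ + t * I) n‖ ^ 2)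
      atTop (nhds (∫ t in u..(u + T), ‖LSeries f (σ + t * I)‖ ^ 2)) := by
    refine intervalIntegral.tendsto_integral_filter_of_dominated_convergence
      (fun _ => (∑' n, ‖LSeries.term f σ n‖) ^ 2) ?_ ?_ intervalIntegrable_const ?_
    · exact Eventually.of_forall fun M =>
        ((continuous_sum_term σ M f).norm.pow 2).aestronglyMeasurable
    · refine Eventually.of_forall fun M => ae_of_all _ fun t _ => ?_
      rw [norm_pow, norm_norm]
      gcongr
      refine (norm_sum_le _ _).trans ?_
      simp_rw [norm_term_add_mul_I]
      exact Summable.sum_le_tsum _ (fun _ _ => norm_nonneg _) hf.norm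
    · refine ae_of_all _ fun t _ => ?_
      refine ((tendsto_sum_Icc_term ?_).norm.pow 2)
      refine (summable_norm_iff.mp ?_)
      simp_rw [norm_term_add_mul_I]
      exact hf.norm
  refine le_of_tendsto hlim (Eventually.of_forall fun M => ?_)
  exact (integral_normSq_sum_term_le hT u σ M f).trans (by gcongr; exact hB M)

lemma integral_comp_neg_add (F : ℝ → ℝ) (u T : ℝ) :
    ∫ t in u..(u + T), F (-t) = ∫ t in (-(u + T))..(-(u + T) + T), F t := by
  rw [intervalIntegral.integral_comp_neg]
  congr 1
  ring

lemma integral_normSq_sum_term_neg_le {T : ℝ} (hT : 2 ≤ T) (u σ : ℝ) (M : ℕ) (f : ℕ → ℂ) :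
    ∫ t in u..(u + T), ‖∑ n ∈ Icc 1 M, LSeries.term f (σ - t * I) n‖ ^ 2
      ≤ 54 * ∑ n ∈ Icc 1 M, ‖f n‖ ^ 2 * (n : ℝ) ^ (-2 * σ) * (T + n) := by
  refine le_trans (le_of_eq ?_) (integral_normSq_sum_term_le hT (-(u + T)) σ M f)
  rw [← integral_comp_neg_add]
  simp [sub_eq_add_neg]

lemma integral_normSq_LSeries_neg_le {T : ℝ} (hT : 2 ≤ T) (u : ℝ) {σ : ℝ} {f : ℕ → ℂ}
    (hf : LSeriesSummable f σ) {B : ℝ}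
    (hB : ∀ M, ∑ n ∈ Icc 1 M, ‖f n‖ ^ 2 * (n : ℝ) ^ (-2 * σ) * (T + n) ≤ B) :
    ∫ t in u..(u + T), ‖LSeries f (σ - t * I)‖ ^ 2 ≤ 54 * B := by
  refine le_trans (le_of_eq ?_) (integral_normSq_LSeries_le hT (-(u + T)) hf hB)
  rw [← integral_comp_neg_add]
  simp [sub_eq_add_neg]

lemma norm_integral_mul_le_sqrt_mul_sqrt {f h : ℝ → ℂ} (hf : Continuous f) (hh : Continuous h)
    {A B : ℝ} (hAB : A ≤ B) :
    ‖∫ t in A..B, f t * h t‖ ≤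
      Real.sqrt (∫ t in A..B, ‖f t‖ ^ 2) * Real.sqrt (∫ t in A..B, ‖h t‖ ^ 2) := by
  have hmem : ∀ {k : ℝ → ℂ}, Continuous k →
      MemLp k (ENNReal.ofReal 2) (volume.restrict (Set.Ioc A B)) := by
    intro k hk
    obtain ⟨K, hK⟩ := (isCompact_Icc (a := A) (b := B)).exists_bound_of_continuousOn hk.continuousOn
    refine MemLp.of_bound hk.aestronglyMeasurable K ?_
    filter_upwards [ae_restrict_mem measurableSet_Ioc] with t ht
    exact hK t (Set.Ioc_subset_Icc_self ht)
  have h1 := integral_mul_norm_le_Lp_mul_Lq Real.HolderConjugate.two_two (hmem hf) (hmem hh)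
  simp only [Real.rpow_two, ← Real.sqrt_eq_rpow] at h1
  rw [intervalIntegral.integral_of_le hAB, intervalIntegral.integral_of_le hAB,
    intervalIntegral.integral_of_le hAB]
  refine (norm_integral_le_integral_norm _).trans ?_
  simpa only [norm_mul] using h1

lemma isOpen_re_lt_two : IsOpen {z : ℂ | z.re < 2} := isOpen_lt continuous_re continuous_const

lemma continuous_comp_vertical {H : ℂ → ℂ} (hH : ContinuousOn H {z : ℂ | z.re < 2}) {w : ℂ}
    (hw : w.re < 2) : Continuous fun t : ℝ => H (w + t * I) :=
  hH.comp_continuous (by fun_prop) fun t => by simpa using hw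

lemma differentiableAt_integral_vertical {H : ℂ → ℂ} (hH : DifferentiableOn ℂ H {z : ℂ | z.re < 2})
    {h : ℝ → ℂ} (hh : Continuous h) (A B : ℝ) {w : ℂ} (hw : w.re < 2) :
    DifferentiableAt ℂ (fun w => ∫ t in A..B, H (w + t * I) * h t) w := by
  set ε : ℝ := (2 - w.re) / 2 with hε
  have hε0 : 0 < ε := by rw [hε]; linarith
  have hball : ∀ x ∈ Metric.closedBall w ε, x.re < 2 := by
    intro x hx
    have h1 : |(x - w).re| ≤ ε := (abs_re_le_norm _).trans (by simpa [dist_eq_norm] using hx)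
    have := (abs_le.mp h1).2
    rw [sub_re] at this
    linarith
  have hH' : DifferentiableOn ℂ (deriv H) {z : ℂ | z.re < 2} := hH.deriv isOpen_re_lt_two
  have hcont : ContinuousOn (fun p : ℂ × ℝ => deriv H (p.1 + p.2 * I) * h p.2)
      (Metric.closedBall w ε ×ˢ Set.uIcc A B) := by
    refine ContinuousOn.mul (hH'.continuousOn.comp (by fun_prop) ?_) (by fun_prop)
    intro p hp
    simpa using hball p.1 hp.1
  obtain ⟨K, hK⟩ := ((isCompact_closedBall w ε).prod isCompact_uIcc).exists_bound_of_continuousOn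
    hcont
  refine (intervalIntegral.hasDerivAt_integral_of_dominated_loc_of_deriv_le
    (F := fun w (t : ℝ) => H (w + t * I) * h t) (F' := fun w (t : ℝ) => deriv H (w + t * I) * h t)
    (bound := fun _ => K) (Metric.closedBall_mem_nhds w hε0) ?_ ?_ ?_ ?_ ?_ ?_).2.differentiableAt
  · filter_upwards [Metric.closedBall_mem_nhds w hε0] with x hx
    exact ((continuous_comp_vertical hH.continuousOn (hball x hx)).mul hh).aestronglyMeasurable
  · exact ((continuous_comp_vertical hH.continuousOn hw).mul hh).intervalIntegrable _ _
  · exact ((continuous_comp_vertical hH'.continuousOn hw).mul hh).aestronglyMeasurable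
  · exact ae_of_all _ fun t ht x hx => hK (x, t) ⟨hx, Set.uIoc_subset_uIcc ht⟩
  · exact intervalIntegrable_const
  · refine ae_of_all _ fun t _ x hx => ?_
    have h1 : HasDerivAt H (deriv H (x + t * I)) (x + t * I) :=
      (hH.differentiableAt (isOpen_re_lt_two.mem_nhds (by simpa using hball x hx))).hasDerivAt
    exact (h1.comp_add_const x (t * I)).mul_const (h t)

/-- Convexity of mean squares of a holomorphic function on vertical lines. -/
lemma integral_normSq_interpolation {H : ℂ → ℂ} (hH : DifferentiableOn ℂ H {z : ℂ | z.re < 2})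
    {C c : ℝ} (hexp : ∀ z : ℂ, -1 / 2 ≤ z.re → z.re ≤ 3 / 2 → ‖H z‖ ≤ C * Real.exp (c * |z.im|))
    {A B : ℝ} (hAB : A ≤ B) {P Q : ℝ}
    (hP : ∀ v : ℝ, ∫ t in A..B, ‖H ((3 / 2 : ℝ) + (t + v : ℝ) * I)‖ ^ 2 ≤ P * Real.exp (2 * v ^ 2))
    (hQ : ∀ v : ℝ, ∫ t in A..B, ‖H ((-1 / 2 : ℝ) + (t + v : ℝ) * I)‖ ^ 2 ≤
        Q * Real.exp (2 * v ^ 2)) :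
    ∫ t in A..B, ‖H ((1 / 2 : ℝ) + t * I)‖ ^ 2 ≤ Real.exp 2 * Real.sqrt (P * Q) := by
  have hint0 : ∀ F : ℝ → ℝ, (∀ t, 0 ≤ F t) → 0 ≤ ∫ t in A..B, F t := fun F hF =>
    intervalIntegral.integral_nonneg hAB fun t _ => hF t
  have hP0 : 0 ≤ P := by
    have := (hint0 _ fun t => by positivity).trans (hP 0)
    simpa using this
  have hQ0 : 0 ≤ Q := by
    have := (hint0 _ fun t => by positivity).trans (hQ 0)
    simpa using this
  have hC0 : 0 ≤ C := by
    have := (norm_nonneg _).trans (hexp 0 (by norm_num) (by norm_num))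
    simpa using this
  set M := ∫ t in A..B, ‖H ((1 / 2 : ℝ) + t * I)‖ ^ 2 with hM
  have hM0 : 0 ≤ M := hint0 _ fun t => by positivity
  set h : ℝ → ℂ := fun t => (starRingEnd ℂ) (H ((1 / 2 : ℝ) + t * I)) with hh
  have hhn : ∀ t, ‖h t‖ = ‖H ((1 / 2 : ℝ) + t * I)‖ := fun t => RCLike.norm_conj _
  have hhc : Continuous h := continuous_conj.comp
    (continuous_comp_vertical hH.continuousOn (by rw [ofReal_re]; norm_num))
  set Ψ : ℂ → ℂ := fun w => cexp (w ^ 2) * ∫ t in A..B, H (((1 / 2 : ℝ) + w) + t * I) * h t with hΨ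
  have hre : ∀ w : ℂ, w.re ≤ 1 → (((1 / 2 : ℝ) : ℂ) + w).re < 2 := by
    intro w hw
    rw [add_re, ofReal_re]
    linarith
  have hexpn : ∀ w : ℂ, w.re ^ 2 ≤ 1 → ‖cexp (w ^ 2)‖ ≤ Real.exp (1 - w.im ^ 2) := by
    intro w hw
    rw [norm_exp, sq w, mul_re]
    exact Real.exp_le_exp.mpr (by nlinarith)
  have hdiff : ∀ w : ℂ, w.re ≤ 1 → DifferentiableAt ℂ Ψ w := by
    intro w hw
    have h1 := differentiableAt_integral_vertical hH hhc A B (hre w hw)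
    have h2 : DifferentiableAt ℂ (fun w : ℂ => ((1 / 2 : ℝ) : ℂ) + w) w := by fun_prop
    exact DifferentiableAt.mul (by fun_prop) (h1.comp w h2)
  have hsub : Complex.HadamardThreeLines.verticalClosedStrip (-1) 1 ⊆ {z : ℂ | z.re ≤ 1} :=
    fun z hz => hz.2
  have hclos : closure (Complex.HadamardThreeLines.verticalStrip (-1) 1) ⊆ {z : ℂ | z.re ≤ 1} :=
    closure_minimal (fun z hz => le_of_lt hz.2) (isClosed_le continuous_re continuous_const)
  have hdc : DiffContOnCl ℂ Ψ (Complex.HadamardThreeLines.verticalStrip (-1) 1) :=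
    ⟨fun z hz => (hdiff z (le_of_lt hz.2)).differentiableWithinAt,
      fun z hz => (hdiff z (hclos hz)).continuousAt.continuousWithinAt⟩
  have hedge : ∀ (σ : ℝ) (R : ℝ), 0 ≤ R → σ ^ 2 = 1 → σ ≤ 1 →
      (∀ v : ℝ, ∫ t in A..B, ‖H ((1 / 2 + σ : ℝ) + (t + v : ℝ) * I)‖ ^ 2 ≤
          R * Real.exp (2 * v ^ 2)) →
      ∀ z ∈ re ⁻¹' {σ}, ‖Ψ z‖ ≤ Real.exp 1 * (Real.sqrt R * Real.sqrt M) := by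
    intro σ R hR0 hσ hσ1 hR z hz
    have hz : z.re = σ := hz
    have h1 := norm_integral_mul_le_sqrt_mul_sqrt
      (continuous_comp_vertical hH.continuousOn (hre z (hz.trans_le hσ1))) hhc hAB
    simp_rw [hhn] at h1
    have h2 : ∫ t in A..B, ‖H (((1 / 2 : ℝ) + z) + t * I)‖ ^ 2 ≤ R * Real.exp (2 * z.im ^ 2) := by
      refine le_trans (le_of_eq ?_) (hR z.im)
      congr 1
      ext t
      congr 3
      apply Complex.ext
      · simp [hz]
      · simp
        ring
    have h3 : Real.sqrt (R * Real.exp (2 * z.im ^ 2)) = Real.sqrt R * Real.exp (z.im ^ 2) := by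
      rw [Real.sqrt_mul hR0, two_mul, Real.exp_add, Real.sqrt_mul_self (Real.exp_pos _).le]
    calc ‖Ψ z‖ = ‖cexp (z ^ 2)‖ * ‖∫ t in A..B, H (((1 / 2 : ℝ) + z) + t * I) * h t‖ := norm_mul _ _
      _ ≤ Real.exp (1 - z.im ^ 2) * (Real.sqrt R * Real.exp (z.im ^ 2) * Real.sqrt M) := by
          refine mul_le_mul (hexpn z (by rw [hz, hσ])) (h1.trans ?_) (norm_nonneg _) (by positivity)
          rw [← h3]
          gcongr
      _ = Real.exp (1 - z.im ^ 2) * Real.exp (z.im ^ 2) * (Real.sqrt R * Real.sqrt M) := by ring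
      _ = Real.exp 1 * (Real.sqrt R * Real.sqrt M) := by
          rw [← Real.exp_add, sub_add_cancel]
  have hbdd : BddAbove ((norm ∘ Ψ) '' Complex.HadamardThreeLines.verticalClosedStrip (-1) 1) := by
    obtain ⟨D, hD⟩ := (isCompact_Icc (a := A) (b := B)).exists_bound_of_continuousOn
      hhc.continuousOn
    set L := |A| + |B| with hL
    refine ⟨Real.exp 1 * (C * Real.exp (|c| * L) * Real.exp (c ^ 2 / 4) * |D| * |B - A|), ?_⟩
    rintro _ ⟨z, hz, rfl⟩
    have hz1 : -1 ≤ z.re := hz.1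
    have hz2 : z.re ≤ 1 := hz.2
    have h1 : ‖∫ t in A..B, H (((1 / 2 : ℝ) + z) + t * I) * h t‖ ≤
        (C * Real.exp (|c| * (|z.im| + L)) * |D|) * |B - A| := by
      refine intervalIntegral.norm_integral_le_of_norm_le_const fun t ht => ?_
      rw [Set.uIoc_of_le hAB] at ht
      have ht' : |t| ≤ L := by
        rw [hL, abs_le]
        constructor
        · linarith [neg_abs_le A, abs_nonneg B, ht.1]
        · linarith [le_abs_self B, abs_nonneg A, ht.2]
      rw [norm_mul]
      refine mul_le_mul ?_ ((hD t (Set.Ioc_subset_Icc_self ht)).trans (le_abs_self D))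
        (norm_nonneg _) (by positivity)
      refine (hexp _ ?_ ?_).trans ?_
      · simp; linarith
      · simp; linarith
      · gcongr C * Real.exp ?_
        have : ((((1 / 2 : ℝ) : ℂ) + z) + t * I).im = z.im + t := by simp
        rw [this]
        refine (mul_le_mul_of_nonneg_right (le_abs_self c) (abs_nonneg _)).trans ?_
        gcongr
        exact (abs_add_le _ _).trans (by linarith)
    have h2 : Real.exp (1 - z.im ^ 2) * Real.exp (|c| * (|z.im| + L)) ≤
        Real.exp 1 * (Real.exp (|c| * L) * Real.exp (c ^ 2 / 4)) := by
      rw [← Real.exp_add, ← Real.exp_add, ← Real.exp_add]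
      refine Real.exp_le_exp.mpr ?_
      rw [← sq_abs c, ← sq_abs z.im]
      nlinarith [sq_nonneg (|c| / 2 - |z.im|)]
    calc ‖Ψ z‖ = ‖cexp (z ^ 2)‖ * ‖∫ t in A..B, H (((1 / 2 : ℝ) + z) + t * I) * h t‖ := norm_mul _ _
      _ ≤ Real.exp (1 - z.im ^ 2) * ((C * Real.exp (|c| * (|z.im| + L)) * |D|) * |B - A|) :=
          mul_le_mul (hexpn z (by nlinarith)) h1 (norm_nonneg _) (by positivity)
      _ = (Real.exp (1 - z.im ^ 2) * Real.exp (|c| * (|z.im| + L))) * (C * |D| * |B - A|) := by ring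
      _ ≤ (Real.exp 1 * (Real.exp (|c| * L) * Real.exp (c ^ 2 / 4))) * (C * |D| * |B - A|) := by
          gcongr
      _ = _ := by ring
  have hmain := Complex.HadamardThreeLines.norm_le_interp_of_mem_verticalClosedStrip'
    (z := 0) (by norm_num) ⟨by simp, by simp⟩ hdc hbdd
    (hedge (-1) Q hQ0 (by norm_num) (by norm_num) (by
      rw [show (1 / 2 + -1 : ℝ) = -1 / 2 by norm_num]; exact hQ))
    (hedge 1 P hP0 (by norm_num) (by norm_num) (by
      rw [show (1 / 2 + 1 : ℝ) = 3 / 2 by norm_num]; exact hP))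
  have hΨ0 : Ψ 0 = (M : ℂ) := by
    simp only [hΨ, hM, hh]
    rw [← intervalIntegral.integral_ofReal]
    simp only [mul_conj', add_zero, ofReal_pow]
    simp
  rw [hΨ0, norm_real, Real.norm_of_nonneg hM0, zero_re,
    show (1 - (0 - -1) / (1 - -1) : ℝ) = 1 / 2 by norm_num,
    show ((0 - -1) / (1 - -1) : ℝ) = 1 / 2 by norm_num, ← Real.sqrt_eq_rpow, ← Real.sqrt_eq_rpow,
    ← Real.sqrt_mul (by positivity)] at hmain
  have h4 : M ^ 2 ≤ Real.exp 2 * Real.sqrt (P * Q) * M := by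
    have h5 := pow_le_pow_left₀ hM0 hmain 2
    rw [Real.sq_sqrt (by positivity)] at h5
    refine h5.trans_eq ?_
    rw [Real.sqrt_mul hP0, show (2 : ℝ) = 1 + 1 by norm_num, Real.exp_add]
    have := Real.mul_self_sqrt hM0
    linear_combination (Real.exp 1 * Real.exp 1 * Real.sqrt P * Real.sqrt Q) * this
  rcases hM0.eq_or_lt with h0 | h0
  · rw [← h0]; positivity
  · exact le_of_mul_le_mul_right (by rwa [← sq]) h0

/-- Mean-square bounds for the coefficients of a Dirichlet series, below and above `T`. -/
structure MeanSquareBound (f : ℕ → ℂ) (T V W : ℝ) : Prop where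
  sum_le : ∑ n ∈ Icc 1 ⌊T⌋₊, ‖f n‖ ^ 2 ≤ T * V
  sum_div_le : ∑ n ∈ Icc 1 ⌊T⌋₊, ‖f n‖ ^ 2 / n ≤ W
  tail_le : ∀ M, ∑ n ∈ Ioc ⌊T⌋₊ M, ‖f n‖ ^ 2 / (n : ℝ) ^ 2 ≤ V / T

/-- The Dirichlet polynomial `∑_{n ≤ N} f(n) n^{-s}`. -/
noncomputable def dirichletPoly (f : ℕ → ℂ) (N : ℕ) (s : ℂ) : ℂ :=
  ∑ n ∈ Icc 1 N, LSeries.term f s n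

/-- The coefficients `f(n)` for `n > N`. -/
def tailCoeff (f : ℕ → ℂ) (N n : ℕ) : ℂ := if n ≤ N then 0 else f n

lemma differentiable_dirichletPoly (f : ℕ → ℂ) (N : ℕ) : Differentiable ℂ (dirichletPoly f N) := by
  unfold dirichletPoly
  refine Differentiable.fun_sum fun n hn => ?_
  have hn0 : n ≠ 0 := Nat.one_le_iff_ne_zero.mp (mem_Icc.mp hn).1
  have hn1 : (n : ℂ) ≠ 0 := by exact_mod_cast hn0
  have h1 : (fun s => LSeries.term f s n) = fun s => f n * (n : ℂ) ^ (-s) := by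
    ext s
    rw [LSeries.term_of_ne_zero hn0, div_eq_mul_inv, cpow_neg]
  rw [h1]
  exact fun s => DifferentiableAt.const_mul
    (DifferentiableAt.const_cpow (by fun_prop) (Or.inl hn1)) _

lemma norm_dirichletPoly_le (f : ℕ → ℂ) (N : ℕ) {s : ℂ} (hs : -1 / 2 ≤ s.re) :
    ‖dirichletPoly f N s‖ ≤ ∑ n ∈ Icc 1 N, ‖LSeries.term f (-1 / 2) n‖ := by
  refine (norm_sum_le _ _).trans (sum_le_sum fun n _ => ?_)
  refine LSeries.norm_term_le_of_re_le_re f ?_ n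
  norm_num at hs ⊢
  exact hs

lemma term_tailCoeff (f : ℕ → ℂ) (N : ℕ) (s : ℂ) (n : ℕ) :
    LSeries.term (tailCoeff f N) s n = if n ≤ N then 0 else LSeries.term f s n := by
  rcases eq_or_ne n 0 with rfl | hn
  · simp
  · rw [LSeries.term_of_ne_zero hn, LSeries.term_of_ne_zero hn, tailCoeff]
    split_ifs <;> simp

lemma lseriesSummable_tailCoeff {f : ℕ → ℂ} {s : ℂ} (hf : LSeriesSummable f s) (N : ℕ) :
    LSeriesSummable (tailCoeff f N) s := by
  refine Summable.of_norm_bounded hf.norm fun n => ?_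
  rw [term_tailCoeff]
  split_ifs <;> simp

lemma lseries_eq_dirichletPoly_add {f : ℕ → ℂ} {s : ℂ} (hf : LSeriesSummable f s) (N : ℕ) :
    LSeries f s = dirichletPoly f N s + LSeries (tailCoeff f N) s := by
  have h1 : HasSum (fun n => if n ∈ Icc 1 N then LSeries.term f s n else 0)
      (dirichletPoly f N s) := by
    have := hasSum_sum_of_ne_finset_zero (s := Icc 1 N) (L := SummationFilter.unconditional ℕ)
      (f := fun n => if n ∈ Icc 1 N then LSeries.term f s n else 0)
      fun n hn => by simp only [if_neg hn]
    rwa [sum_congr rfl fun n hn => if_pos hn] at this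
  have h2 := h1.add (Summable.hasSum (lseriesSummable_tailCoeff hf N))
  refine HasSum.tsum_eq ?_
  change HasSum _ (_ + ∑' n, LSeries.term (tailCoeff f N) s n)
  convert h2 using 1
  ext n
  rw [term_tailCoeff]
  rcases eq_or_ne n 0 with rfl | hn
  · simp
  · by_cases h : n ≤ N
    · simp [h, Nat.one_le_iff_ne_zero.mpr hn]
    · simp [h]

namespace MeanSquareBound

variable {f : ℕ → ℂ} {T V W : ℝ}

lemma sum_mul_le (h : MeanSquareBound f T V W) (hT : 2 ≤ T) :
    ∑ n ∈ Icc 1 ⌊T⌋₊, ‖f n‖ ^ 2 * (n : ℝ) ^ (-2 * (-1 / 2 : ℝ)) * (T + n) ≤ 2 * T ^ 3 * V := by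
  have h1 : ∑ n ∈ Icc 1 ⌊T⌋₊, ‖f n‖ ^ 2 * (n : ℝ) ^ (-2 * (-1 / 2 : ℝ)) * (T + n) ≤
      ∑ n ∈ Icc 1 ⌊T⌋₊, ‖f n‖ ^ 2 * (2 * T ^ 2) := by
    refine sum_le_sum fun n hn => ?_
    have hnT : (n : ℝ) ≤ T := (Nat.le_floor_iff (by linarith)).mp (mem_Icc.mp hn).2
    rw [show (-2 * (-1 / 2 : ℝ)) = 1 by norm_num, Real.rpow_one, mul_assoc]
    have hn0 : (0 : ℝ) ≤ n := Nat.cast_nonneg n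
    exact mul_le_mul_of_nonneg_left (by nlinarith) (sq_nonneg _)
  rw [← sum_mul] at h1
  nlinarith [mul_le_mul_of_nonneg_right h.sum_le (by positivity : 0 ≤ 2 * T ^ 2)]

lemma sum_inv_mul_le (h : MeanSquareBound f T V W) (hT : 2 ≤ T) :
    ∑ n ∈ Icc 1 ⌊T⌋₊, ‖f n‖ ^ 2 * (n : ℝ) ^ (-2 * (1 / 2 : ℝ)) * (T + n) ≤ 2 * T * W := by
  have h1 : ∑ n ∈ Icc 1 ⌊T⌋₊, ‖f n‖ ^ 2 * (n : ℝ) ^ (-2 * (1 / 2 : ℝ)) * (T + n) ≤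
      ∑ n ∈ Icc 1 ⌊T⌋₊, ‖f n‖ ^ 2 / n * (2 * T) := by
    refine sum_le_sum fun n hn => ?_
    have hnT : (n : ℝ) ≤ T := (Nat.le_floor_iff (by linarith)).mp (mem_Icc.mp hn).2
    rw [show (-2 * (1 / 2 : ℝ)) = -1 by norm_num, Real.rpow_neg_one, ← div_eq_mul_inv]
    gcongr
    linarith
  rw [← sum_mul] at h1
  nlinarith [mul_le_mul_of_nonneg_right h.sum_div_le (by positivity : 0 ≤ 2 * T)]

lemma sum_tail_le (h : MeanSquareBound f T V W) (hT : 2 ≤ T) (M : ℕ) :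
    ∑ n ∈ Icc 1 M, ‖tailCoeff f ⌊T⌋₊ n‖ ^ 2 * (n : ℝ) ^ (-2 * (3 / 2 : ℝ)) * (T + n)
      ≤ 2 * (V / T) := by
  have h1 : ∑ n ∈ Icc 1 M, ‖tailCoeff f ⌊T⌋₊ n‖ ^ 2 * (n : ℝ) ^ (-2 * (3 / 2 : ℝ)) * (T + n) =
      ∑ n ∈ Ioc ⌊T⌋₊ M, ‖tailCoeff f ⌊T⌋₊ n‖ ^ 2 * (n : ℝ) ^ (-2 * (3 / 2 : ℝ)) * (T + n) := by
    symm
    refine sum_subset (fun n hn => ?_) fun n hn hn' => ?_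
    · rw [mem_Ioc] at hn
      rw [mem_Icc]
      omega
    · rw [mem_Ioc, not_and'] at hn'
      have := hn' (mem_Icc.mp hn).2
      simp [tailCoeff, not_lt.mp this]
  have h2 : ∑ n ∈ Ioc ⌊T⌋₊ M, ‖tailCoeff f ⌊T⌋₊ n‖ ^ 2 * (n : ℝ) ^ (-2 * (3 / 2 : ℝ)) * (T + n) ≤
      ∑ n ∈ Ioc ⌊T⌋₊ M, 2 * (‖f n‖ ^ 2 / (n : ℝ) ^ 2) := by
    refine sum_le_sum fun n hn => ?_
    have hn' := (mem_Ioc.mp hn).1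
    have hTn : T < n := (Nat.floor_lt (by linarith)).mp hn'
    have hn0 : (0 : ℝ) < n := by linarith
    rw [tailCoeff, if_neg (not_le.mpr hn'), show (-2 * (3 / 2 : ℝ)) = -((3 : ℕ) : ℝ) by norm_num,
      Real.rpow_neg hn0.le, Real.rpow_natCast]
    have hk : ((n : ℝ) ^ 3)⁻¹ * (T + n) ≤ 2 * ((n : ℝ) ^ 2)⁻¹ := by
      rw [inv_mul_le_iff₀ (by positivity)]
      field_simp
      linarith
    calc ‖f n‖ ^ 2 * ((n : ℝ) ^ 3)⁻¹ * (T + n) = ‖f n‖ ^ 2 * (((n : ℝ) ^ 3)⁻¹ * (T + n)) := by ring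
      _ ≤ ‖f n‖ ^ 2 * (2 * ((n : ℝ) ^ 2)⁻¹) := mul_le_mul_of_nonneg_left hk (sq_nonneg _)
      _ = 2 * (‖f n‖ ^ 2 / (n : ℝ) ^ 2) := by ring
  rw [h1]
  refine h2.trans ?_
  rw [← mul_sum]
  have := h.tail_le M
  linarith

end MeanSquareBound

lemma integral_normSq_le_of_norm_le {h r s : ℝ → ℂ} (hh : Continuous h) (hr : Continuous r)
    (hs : Continuous s) {A B : ℝ} {k l m : ℕ} (hk : k ≤ m) (hl : l ≤ m)
    (hb : ∀ x, ‖h x‖ ≤ A * (1 + |x|) ^ k * ‖r x‖ + B * (1 + |x|) ^ l * ‖s x‖) {T : ℝ} (hT : 2 ≤ T)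
    {a b : ℝ} (ha : ∀ u, ∫ t in u..(u + T), ‖r t‖ ^ 2 ≤ a)
    (hb' : ∀ u, ∫ t in u..(u + T), ‖s t‖ ^ 2 ≤ b) (v : ℝ) :
    ∫ t in T..(2 * T), ‖h (t + v)‖ ^ 2 ≤
      2 * (A ^ 2 * (3 * T) ^ (2 * k) * a + B ^ 2 * (3 * T) ^ (2 * l) * b) *
        (1 + |v|) ^ (2 * m) := by
  set q := 1 + |v| with hq
  have hq1 : 1 ≤ q := by rw [hq]; linarith [abs_nonneg v]
  have hshift : ∀ F : ℝ → ℝ, ∫ t in T..(2 * T), F (t + v) = ∫ t in (T + v)..(T + v + T), F t := by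
    intro F
    rw [intervalIntegral.integral_comp_add_right]
    congr 1
    ring
  have hpow : ∀ x ∈ Set.Icc (T + v) (T + v + T), ∀ j ≤ m,
      ((1 + |x|) ^ j) ^ 2 ≤ (3 * T) ^ (2 * j) * q ^ (2 * m) := by
    intro x hx j hj
    have h1 : 1 + |x| ≤ 3 * T * q := by
      have : |x| ≤ 2 * T + |v| := by
        rw [abs_le]
        constructor
        · linarith [hx.1, neg_abs_le v]
        · linarith [hx.2, le_abs_self v]
      rw [hq]
      nlinarith [abs_nonneg v]
    calc ((1 + |x|) ^ j) ^ 2 = (1 + |x|) ^ (2 * j) := by rw [← pow_mul, mul_comm]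
      _ ≤ (3 * T * q) ^ (2 * j) := by gcongr
      _ = (3 * T) ^ (2 * j) * q ^ (2 * j) := mul_pow _ _ _
      _ ≤ (3 * T) ^ (2 * j) * q ^ (2 * m) := by gcongr
  rw [hshift fun x => ‖h x‖ ^ 2]
  have h1 : ∫ t in (T + v)..(T + v + T), ‖h t‖ ^ 2 ≤ ∫ t in (T + v)..(T + v + T),
      ((2 * A ^ 2 * ((3 * T) ^ (2 * k) * q ^ (2 * m))) * ‖r t‖ ^ 2 +
        (2 * B ^ 2 * ((3 * T) ^ (2 * l) * q ^ (2 * m))) * ‖s t‖ ^ 2) := by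
    refine intervalIntegral.integral_mono_on (by linarith)
      (Continuous.intervalIntegrable (by fun_prop) _ _)
      (Continuous.intervalIntegrable (by fun_prop) _ _) fun x hx => ?_
    have e1 := mul_le_mul_of_nonneg_left (hpow x hx k hk)
      (by positivity : 0 ≤ 2 * A ^ 2 * ‖r x‖ ^ 2)
    have e2 := mul_le_mul_of_nonneg_left (hpow x hx l hl)
      (by positivity : 0 ≤ 2 * B ^ 2 * ‖s x‖ ^ 2)
    have e3 := pow_le_pow_left₀ (norm_nonneg _) (hb x) 2
    have e4 := add_sq_le (a := A * (1 + |x|) ^ k * ‖r x‖) (b := B * (1 + |x|) ^ l * ‖s x‖)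
    have e5 : 2 * ((A * (1 + |x|) ^ k * ‖r x‖) ^ 2 + (B * (1 + |x|) ^ l * ‖s x‖) ^ 2) =
      2 * A ^ 2 * ‖r x‖ ^ 2 * ((1 + |x|) ^ k) ^ 2 +
        2 * B ^ 2 * ‖s x‖ ^ 2 * ((1 + |x|) ^ l) ^ 2 := by
      ring
    linarith
  refine h1.trans ?_
  rw [intervalIntegral.integral_add (Continuous.intervalIntegrable (by fun_prop) _ _)
    (Continuous.intervalIntegrable (by fun_prop) _ _), intervalIntegral.integral_const_mul,
    intervalIntegral.integral_const_mul]
  have e1 := mul_le_mul_of_nonneg_left (ha (T + v))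
    (by positivity : 0 ≤ 2 * A ^ 2 * ((3 * T) ^ (2 * k) * q ^ (2 * m)))
  have e2 := mul_le_mul_of_nonneg_left (hb' (T + v))
    (by positivity : 0 ≤ 2 * B ^ 2 * ((3 * T) ^ (2 * l) * q ^ (2 * m)))
  linarith

lemma continuous_LSeries_vertical {f : ℕ → ℂ} {σ : ℝ} (hf : LSeriesSummable f σ) :
    Continuous fun t : ℝ => LSeries f (σ + t * I) := by
  refine continuous_tsum (fun n => ?_) hf.norm fun n t => (norm_term_add_mul_I f σ t n).le
  rcases eq_or_ne n 0 with rfl | hn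
  · simp [continuous_const]
  · simp_rw [term_add_mul_I f σ _ hn]
    fun_prop

lemma one_add_abs_pow_eight_le (v : ℝ) :
    (1 + |v|) ^ (2 * 4) ≤ Real.exp 8 * Real.exp (2 * v ^ 2) := by
  calc (1 + |v|) ^ (2 * 4) ≤ Real.exp |v| ^ (2 * 4) := by
        gcongr
        rw [add_comm]
        exact Real.add_one_le_exp _
    _ = Real.exp (8 * |v|) := by
        rw [← Real.exp_nat_mul]
        norm_num
    _ ≤ Real.exp (8 + 2 * v ^ 2) := by
        refine Real.exp_le_exp.mpr ?_
        rw [← sq_abs v]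
        nlinarith [sq_nonneg (|v| - 2)]
    _ = _ := Real.exp_add _ _

/-- An entire function `G` which is `(z - 1) ^ 2` times a Dirichlet series on `Re z = 3 / 2` and
`Y(z)` times a reflected Dirichlet series on `Re z = -1 / 2`, with moderate growth. -/
structure ReflectionData (G Y : ℂ → ℂ) (f g : ℕ → ℂ) (C c : ℝ) : Prop where
  differentiable : Differentiable ℂ G
  differentiableOn : DifferentiableOn ℂ Y {z : ℂ | z.re < 2}
  norm_le_exp : ∀ z : ℂ, -1 / 2 ≤ z.re → z.re ≤ 3 / 2 → ‖G z‖ ≤ C * Real.exp (c * |z.im|)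
  norm_factor_le_exp : ∀ z : ℂ, -1 / 2 ≤ z.re → z.re ≤ 3 / 2 → ‖Y z‖ ≤ C * Real.exp (c * |z.im|)
  eq_right : ∀ z : ℂ, z.re = 3 / 2 → G z = (z - 1) ^ 2 * LSeries f z
  eq_left : ∀ z : ℂ, z.re = -1 / 2 → G z = Y z * LSeries g (1 - z)
  norm_right : ∀ z : ℂ, z.re = 3 / 2 → ‖Y z‖ ≤ C
  norm_middle : ∀ z : ℂ, z.re = 1 / 2 → ‖Y z‖ ≤ C * (1 + |z.im|) ^ 2
  norm_left : ∀ z : ℂ, z.re = -1 / 2 → ‖Y z‖ ≤ C * (1 + |z.im|) ^ 4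
  summable_f : LSeriesSummable f (3 / 2 : ℝ)
  summable_g : LSeriesSummable g (3 / 2 : ℝ)

namespace ReflectionData

variable {G Y : ℂ → ℂ} {f g : ℕ → ℂ} {C c : ℝ}

/-- `G` minus the two main terms of an approximate functional equation of length `N`. -/
noncomputable def remainder (G Y : ℂ → ℂ) (f g : ℕ → ℂ) (N : ℕ) (z : ℂ) : ℂ :=
  G z - (z - 1) ^ 2 * dirichletPoly f N z - Y z * dirichletPoly g N (1 - z)

lemma nonneg (h : ReflectionData G Y f g C c) : 0 ≤ C := by
  have := (norm_nonneg _).trans (h.norm_le_exp 0 (by norm_num) (by norm_num))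
  simpa using this

lemma differentiableOn_remainder (h : ReflectionData G Y f g C c) (N : ℕ) :
    DifferentiableOn ℂ (remainder G Y f g N) {z : ℂ | z.re < 2} := by
  have h1 : Differentiable ℂ fun z => (z - 1) ^ 2 * dirichletPoly f N z :=
    Differentiable.mul (by fun_prop) (differentiable_dirichletPoly f N)
  have h2 : Differentiable ℂ fun z => dirichletPoly g N (1 - z) :=
    (differentiable_dirichletPoly g N).comp (by fun_prop)
  exact (h.differentiable.differentiableOn.sub h1.differentiableOn).sub
    (h.differentiableOn.mul h2.differentiableOn)

lemma norm_sub_one_le (z : ℂ) : ‖z - 1‖ ≤ |z.re - 1| + |z.im| := by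
  simpa using norm_le_abs_re_add_abs_im (z - 1)

lemma norm_remainder_le_exp (h : ReflectionData G Y f g C c) (N : ℕ) :
    ∃ C' c' : ℝ, ∀ z : ℂ, -1 / 2 ≤ z.re → z.re ≤ 3 / 2 →
      ‖remainder G Y f g N z‖ ≤ C' * Real.exp (c' * |z.im|) := by
  set D := ∑ n ∈ Icc 1 N, ‖LSeries.term f (-1 / 2) n‖ with hD
  set E := ∑ n ∈ Icc 1 N, ‖LSeries.term g (-1 / 2) n‖ with hE
  have hD0 : 0 ≤ D := sum_nonneg fun _ _ => norm_nonneg _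
  have hE0 : 0 ≤ E := sum_nonneg fun _ _ => norm_nonneg _
  have hC := h.nonneg
  refine ⟨C + 4 * D + C * E, |c| + 2, fun z hz1 hz2 => ?_⟩
  have e1 : Real.exp (c * |z.im|) ≤ Real.exp ((|c| + 2) * |z.im|) := by
    refine Real.exp_le_exp.mpr (mul_le_mul_of_nonneg_right ?_ (abs_nonneg _))
    linarith [le_abs_self c]
  have e2 : ‖z - 1‖ ^ 2 ≤ 4 * Real.exp ((|c| + 2) * |z.im|) := by
    have h1 : ‖z - 1‖ ≤ 2 * Real.exp |z.im| := by
      have := norm_sub_one_le z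
      have h2 : |z.re - 1| ≤ 3 / 2 := by rw [abs_le]; constructor <;> linarith
      linarith [Real.add_one_le_exp |z.im|, abs_nonneg z.im]
    calc ‖z - 1‖ ^ 2 ≤ (2 * Real.exp |z.im|) ^ 2 := by gcongr
      _ = 4 * Real.exp (2 * |z.im|) := by
          rw [mul_pow, ← Real.exp_nat_mul]
          norm_num
      _ ≤ _ := by
          gcongr
          linarith [abs_nonneg c]
  have n1 := h.norm_le_exp z hz1 hz2
  have n2 := h.norm_factor_le_exp z hz1 hz2
  have n3 := norm_dirichletPoly_le f N hz1
  have n4 := norm_dirichletPoly_le g N (s := 1 - z) (by rw [sub_re, one_re]; linarith)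
  calc ‖remainder G Y f g N z‖ ≤ ‖G z‖ + ‖z - 1‖ ^ 2 * ‖dirichletPoly f N z‖ +
        ‖Y z‖ * ‖dirichletPoly g N (1 - z)‖ := by
        unfold remainder
        refine (norm_sub_le _ _).trans ?_
        rw [norm_mul]
        gcongr
        refine (norm_sub_le _ _).trans ?_
        rw [norm_mul, norm_pow]
    _ ≤ C * Real.exp ((|c| + 2) * |z.im|) + 4 * Real.exp ((|c| + 2) * |z.im|) * D +
        C * Real.exp ((|c| + 2) * |z.im|) * E := by
        gcongr
        · exact n1.trans (by gcongr)
        · exact n2.trans (by gcongr)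
    _ = _ := by ring

lemma remainder_right (h : ReflectionData G Y f g C c) (N : ℕ) {z : ℂ} (hz : z.re = 3 / 2) :
    remainder G Y f g N z =
      (z - 1) ^ 2 * LSeries (tailCoeff f N) z - Y z * dirichletPoly g N (1 - z) := by
  have hs : LSeriesSummable f z :=
    (LSeriesSummable_iff_of_re_eq_re (by rw [hz, ofReal_re])).mpr h.summable_f
  rw [remainder, h.eq_right z hz, lseries_eq_dirichletPoly_add hs N]
  ring

lemma remainder_left (h : ReflectionData G Y f g C c) (N : ℕ) {z : ℂ} (hz : z.re = -1 / 2) :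
    remainder G Y f g N z =
      Y z * LSeries (tailCoeff g N) (1 - z) - (z - 1) ^ 2 * dirichletPoly f N z := by
  have hs : LSeriesSummable g (1 - z) :=
    (LSeriesSummable_iff_of_re_eq_re (by
      rw [ofReal_re, sub_re, hz, one_re]; norm_num)).mpr h.summable_g
  rw [remainder, h.eq_left z hz, lseries_eq_dirichletPoly_add hs N]
  ring


theorem integral_normSq_le (h : ReflectionData G Y f g C c) :
    ∃ K : ℝ, ∀ T V W : ℝ, 2 ≤ T → 0 ≤ V → 0 ≤ W → MeanSquareBound f T V W →
      MeanSquareBound g T V W →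
      ∫ t in T..(2 * T), ‖G ((1 / 2 : ℝ) + t * I)‖ ^ 2 ≤ K * T ^ 5 * (V + W) := by
  have hC := h.nonneg
  set K₁ := 2 * Real.exp 8 * 108 * (81 + C ^ 2) with hK₁
  set K₂ := 2 * Real.exp 8 * 108 * (6561 * C ^ 2 + 16 * 81) with hK₂
  set K₃ := 4 * 81 * 108 * (1 + C ^ 2) with hK₃
  refine ⟨2 * (Real.exp 2 * Real.sqrt (K₁ * K₂)) + K₃, fun T V W hT hV hW hf hg => ?_⟩
  have hT0 : 0 < T := by linarith
  set N := ⌊T⌋₊ with hN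
  have hHd := h.differentiableOn_remainder N
  obtain ⟨C', c', hexp⟩ := h.norm_remainder_le_exp N
  have hline : ∀ σ : ℝ, σ < 2 → Continuous fun t : ℝ => remainder G Y f g N (σ + t * I) :=
    fun σ hσ => continuous_comp_vertical hHd.continuousOn (by rwa [ofReal_re])
  have hPc : ∀ σ : ℝ, ∀ k : ℕ → ℂ, Continuous fun t : ℝ => dirichletPoly k N (σ + t * I) :=
    fun σ k => (differentiable_dirichletPoly k N).continuous.comp (by fun_prop)
  have hPc' : ∀ σ : ℝ, ∀ k : ℕ → ℂ, Continuous fun t : ℝ => dirichletPoly k N (σ - t * I) :=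
    fun σ k => (differentiable_dirichletPoly k N).continuous.comp (by fun_prop)
  have hre : ∀ σ t : ℝ, ((σ : ℂ) + t * I).re = σ := by simp
  have him : ∀ σ t : ℝ, ((σ : ℂ) + t * I).im = t := by simp
  have hsub : ∀ σ t : ℝ, -1 / 2 ≤ σ → σ ≤ 3 / 2 → ‖(σ : ℂ) + t * I - 1‖ ≤ 2 * (1 + |t|) := by
    intro σ t h1 h2
    have := norm_sub_one_le ((σ : ℂ) + t * I)
    rw [hre, him] at this
    have h3 : |σ - 1| ≤ 2 := by rw [abs_le]; constructor <;> linarith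
    linarith [abs_nonneg t]
  have hsub' : ∀ σ t : ℝ, 1 / 2 ≤ σ → σ ≤ 3 / 2 → ‖(σ : ℂ) + t * I - 1‖ ≤ 1 + |t| := by
    intro σ t h1 h2
    have := norm_sub_one_le ((σ : ℂ) + t * I)
    rw [hre, him] at this
    have h3 : |σ - 1| ≤ 1 := by rw [abs_le]; constructor <;> linarith
    linarith
  have hP : ∀ v : ℝ, ∫ t in T..(2 * T), ‖remainder G Y f g N ((3 / 2 : ℝ) + (t + v : ℝ) * I)‖ ^ 2 ≤
      (K₁ * T ^ 3 * V) * Real.exp (2 * v ^ 2) := by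
    intro v
    have hb : ∀ x : ℝ, ‖remainder G Y f g N ((3 / 2 : ℝ) + x * I)‖ ≤
        1 * (1 + |x|) ^ 2 * ‖LSeries (tailCoeff f N) ((3 / 2 : ℝ) + x * I)‖ +
          C * (1 + |x|) ^ 0 * ‖dirichletPoly g N ((-1 / 2 : ℝ) - x * I)‖ := by
      intro x
      rw [h.remainder_right N (hre _ _), show 1 - (((3 / 2 : ℝ) : ℂ) + x * I) =
        ((-1 / 2 : ℝ) : ℂ) - x * I by push_cast; ring]
      refine (norm_sub_le _ _).trans ?_
      rw [norm_mul, norm_mul, norm_pow, one_mul, pow_zero, mul_one]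
      gcongr
      · exact hsub' _ _ (by norm_num) le_rfl
      · exact h.norm_right _ (hre _ _)
    refine (integral_normSq_le_of_norm_le (hline (3 / 2) (by norm_num))
      (continuous_LSeries_vertical (lseriesSummable_tailCoeff h.summable_f N))
      (hPc' (-1 / 2) g) (m := 4) (by norm_num) (by norm_num) hb hT
      (fun u => integral_normSq_LSeries_le hT u (lseriesSummable_tailCoeff h.summable_f N)
        (hf.sum_tail_le hT))
      (fun u => (integral_normSq_sum_term_neg_le hT u (-1 / 2) N g).trans
        (mul_le_mul_of_nonneg_left (hg.sum_mul_le hT) (by norm_num))) v).trans ?_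
    calc _ ≤ 2 * (1 ^ 2 * (3 * T) ^ (2 * 2) * (54 * (2 * (V / T))) +
          C ^ 2 * (3 * T) ^ (2 * 0) * (54 * (2 * T ^ 3 * V))) *
          (Real.exp 8 * Real.exp (2 * v ^ 2)) := by
          gcongr
          exact one_add_abs_pow_eight_le v
      _ = _ := by
          rw [hK₁]
          field_simp
          ring
  have hQ : ∀ v : ℝ, ∫ t in T..(2 * T), ‖remainder G Y f g N ((-1 / 2 : ℝ) + (t + v : ℝ) * I)‖ ^ 2 ≤
      (K₂ * T ^ 7 * V) * Real.exp (2 * v ^ 2) := by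
    intro v
    have hb : ∀ x : ℝ, ‖remainder G Y f g N ((-1 / 2 : ℝ) + x * I)‖ ≤
        C * (1 + |x|) ^ 4 * ‖LSeries (tailCoeff g N) ((3 / 2 : ℝ) - x * I)‖ +
          4 * (1 + |x|) ^ 2 * ‖dirichletPoly f N ((-1 / 2 : ℝ) + x * I)‖ := by
      intro x
      rw [h.remainder_left N (hre _ _), show 1 - (((-1 / 2 : ℝ) : ℂ) + x * I) =
        ((3 / 2 : ℝ) : ℂ) - x * I by push_cast; ring]
      refine (norm_sub_le _ _).trans ?_
      rw [norm_mul, norm_mul, norm_pow]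
      have e1 := h.norm_left _ (hre (-1 / 2) x)
      rw [him] at e1
      have e2 := pow_le_pow_left₀ (norm_nonneg _) (hsub (-1 / 2) x le_rfl (by norm_num)) 2
      rw [mul_pow] at e2
      gcongr
      linarith
    have hcont : Continuous fun t : ℝ => LSeries (tailCoeff g N) ((3 / 2 : ℝ) - t * I) := by
      have := (continuous_LSeries_vertical (lseriesSummable_tailCoeff h.summable_g N)).comp
        continuous_neg
      simpa [Function.comp_def, sub_eq_add_neg] using this
    refine (integral_normSq_le_of_norm_le (hline (-1 / 2) (by norm_num)) hcont
      (hPc (-1 / 2) f) (m := 4) (by norm_num) (by norm_num) hb hT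
      (fun u => integral_normSq_LSeries_neg_le hT u (lseriesSummable_tailCoeff h.summable_g N)
        (hg.sum_tail_le hT))
      (fun u => (integral_normSq_sum_term_le hT u (-1 / 2) N f).trans
        (mul_le_mul_of_nonneg_left (hf.sum_mul_le hT) (by norm_num))) v).trans ?_
    calc _ ≤ 2 * (C ^ 2 * (3 * T) ^ (2 * 4) * (54 * (2 * (V / T))) +
          4 ^ 2 * (3 * T) ^ (2 * 2) * (54 * (2 * T ^ 3 * V))) *
          (Real.exp 8 * Real.exp (2 * v ^ 2)) := by
          gcongr
          exact one_add_abs_pow_eight_le v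
      _ = _ := by
          rw [hK₂]
          field_simp
          ring
  have hM := integral_normSq_interpolation hHd hexp (by linarith : T ≤ 2 * T) hP hQ
  have hsqrt : Real.sqrt ((K₁ * T ^ 3 * V) * (K₂ * T ^ 7 * V)) =
      Real.sqrt (K₁ * K₂) * (T ^ 5 * V) := by
    rw [show (K₁ * T ^ 3 * V) * (K₂ * T ^ 7 * V) = (K₁ * K₂) * (T ^ 5 * V) ^ 2 by ring,
      Real.sqrt_mul (by positivity), Real.sqrt_sq (by positivity)]
  rw [hsqrt] at hM
  set X : ℝ → ℂ := fun t => G ((1 / 2 : ℝ) + t * I) -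
    remainder G Y f g N ((1 / 2 : ℝ) + t * I) with hX
  have hGc : Continuous fun t : ℝ => G ((1 / 2 : ℝ) + t * I) :=
    h.differentiable.continuous.comp (by fun_prop)
  have hXc : Continuous X := hGc.sub (hline (1 / 2) (by norm_num))
  have hXb : ∀ x : ℝ, ‖X x‖ ≤ 1 * (1 + |x|) ^ 2 * ‖dirichletPoly f N ((1 / 2 : ℝ) + x * I)‖ +
      C * (1 + |x|) ^ 2 * ‖dirichletPoly g N ((1 / 2 : ℝ) - x * I)‖ := by
    intro x
    simp only [hX, remainder]
    rw [show 1 - (((1 / 2 : ℝ) : ℂ) + x * I) = ((1 / 2 : ℝ) : ℂ) - x * I by push_cast; ring,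
      sub_sub, sub_sub_cancel]
    refine (norm_add_le _ _).trans ?_
    rw [norm_mul, norm_mul, norm_pow, one_mul]
    have e1 := h.norm_middle _ (hre (1 / 2) x)
    rw [him] at e1
    gcongr
    exact hsub' _ _ le_rfl (by norm_num)
  have hXi := integral_normSq_le_of_norm_le hXc (hPc (1 / 2) f)
    (hPc' (1 / 2) g) le_rfl le_rfl hXb hT
    (fun u => (integral_normSq_sum_term_le hT u (1 / 2) N f).trans
      (mul_le_mul_of_nonneg_left (hf.sum_inv_mul_le hT) (by norm_num)))
    (fun u => (integral_normSq_sum_term_neg_le hT u (1 / 2) N g).trans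
      (mul_le_mul_of_nonneg_left (hg.sum_inv_mul_le hT) (by norm_num))) 0
  simp only [add_zero, abs_zero, one_pow, mul_one] at hXi
  have hsum : ∫ t in T..(2 * T), ‖G ((1 / 2 : ℝ) + t * I)‖ ^ 2 ≤ ∫ t in T..(2 * T),
      (2 * ‖remainder G Y f g N ((1 / 2 : ℝ) + t * I)‖ ^ 2 + 2 * ‖X t‖ ^ 2) := by
    have hRc := hline (1 / 2) (by norm_num)
    refine intervalIntegral.integral_mono_on (by linarith)
      ((hGc.norm.pow 2).intervalIntegrable _ _)
      (((continuous_const.mul (hRc.norm.pow 2)).add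
        (continuous_const.mul (hXc.norm.pow 2))).intervalIntegrable _ _) fun t _ => ?_
    have e1 : ‖G ((1 / 2 : ℝ) + t * I)‖ ≤ ‖remainder G Y f g N ((1 / 2 : ℝ) + t * I)‖ + ‖X t‖ := by
      have : G ((1 / 2 : ℝ) + t * I) = remainder G Y f g N ((1 / 2 : ℝ) + t * I) + X t := by
        simp only [hX]
        ring
      rw [this]
      exact norm_add_le _ _
    have e2 := pow_le_pow_left₀ (norm_nonneg _) e1 2
    have e3 := add_sq_le (a := ‖remainder G Y f g N ((1 / 2 : ℝ) + t * I)‖) (b := ‖X t‖)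
    linarith
  have hRc := hline (1 / 2) (by norm_num)
  have hRi : IntervalIntegrable (fun t : ℝ => 2 * ‖remainder G Y f g N ((1 / 2 : ℝ) + t * I)‖ ^ 2)
      volume T (2 * T) := (continuous_const.mul (hRc.norm.pow 2)).intervalIntegrable _ _
  have hXi' : IntervalIntegrable (fun t : ℝ => 2 * ‖X t‖ ^ 2) volume T (2 * T) :=
    (continuous_const.mul (hXc.norm.pow 2)).intervalIntegrable _ _
  rw [intervalIntegral.integral_add hRi hXi', intervalIntegral.integral_const_mul,
    intervalIntegral.integral_const_mul] at hsum
  have hfin : 2 * (Real.exp 2 * (Real.sqrt (K₁ * K₂) * (T ^ 5 * V))) + K₃ * T ^ 5 * W ≤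
      (2 * (Real.exp 2 * Real.sqrt (K₁ * K₂)) + K₃) * T ^ 5 * (V + W) := by
    have e1 : 0 ≤ 2 * (Real.exp 2 * Real.sqrt (K₁ * K₂)) * T ^ 5 * W := by positivity
    have e2 : 0 ≤ K₃ * T ^ 5 * V := by positivity
    linarith
  refine le_trans ?_ hfin
  have e3 : 2 * (2 * ((3 * T) ^ (2 * 2) * (54 * (2 * T * W)) +
      C ^ 2 * (3 * T) ^ (2 * 2) * (54 * (2 * T * W)))) = K₃ * T ^ 5 * W := by
    rw [hK₃]
    ring
  linarith

end ReflectionData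

section

lemma norm_mellin_le {f : ℝ → ℂ} {a b : ℝ} (ha : MellinConvergent f a) (hb : MellinConvergent f b)
    {s : ℂ} (has : a ≤ s.re) (hsb : s.re ≤ b) :
    ‖mellin f s‖ ≤ ∫ t in Set.Ioi (0 : ℝ),
      (‖(t : ℂ) ^ ((a : ℂ) - 1) • f t‖ + ‖(t : ℂ) ^ ((b : ℂ) - 1) • f t‖) := by
  refine norm_integral_le_of_norm_le (ha.norm.add hb.norm) ?_
  filter_upwards [ae_restrict_mem measurableSet_Ioi] with t ht
  have ht0 : 0 < t := ht
  rw [norm_smul, norm_smul, norm_smul, norm_cpow_eq_rpow_re_of_pos ht0,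
    norm_cpow_eq_rpow_re_of_pos ht0, norm_cpow_eq_rpow_re_of_pos ht0, ← add_mul]
  refine mul_le_mul_of_nonneg_right ?_ (norm_nonneg _)
  simp only [sub_re, one_re, ofReal_re]
  have h1 : 0 ≤ t ^ (a - 1) := by positivity
  have h2 : 0 ≤ t ^ (b - 1) := by positivity
  rcases le_total 1 t with h | h
  · linarith [Real.rpow_le_rpow_of_exponent_le h (show s.re - 1 ≤ b - 1 by linarith)]
  · linarith [Real.rpow_le_rpow_of_exponent_ge ht0 h (show a - 1 ≤ s.re - 1 by linarith)]

lemma exists_norm_Λ_le {P : WeakFEPair ℂ} (hP : IsStrongFEPair P) (a b : ℝ) :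
    ∃ C : ℝ, ∀ s : ℂ, a ≤ s.re → s.re ≤ b → ‖P.Λ s‖ ≤ C := by
  refine ⟨∫ t in Set.Ioi (0 : ℝ),
    (‖(t : ℂ) ^ ((a : ℂ) - 1) • P.f t‖ + ‖(t : ℂ) ^ ((b : ℂ) - 1) • P.f t‖), fun s h1 h2 => ?_⟩
  rw [hP.Λ_eq]
  exact norm_mellin_le (hP.hasMellin a).1 (hP.hasMellin b).1 h1 h2

lemma exists_norm_Λ₀_le (P : WeakFEPair ℂ) (a b : ℝ) :
    ∃ C : ℝ, ∀ s : ℂ, a ≤ s.re → s.re ≤ b → ‖P.Λ₀ s‖ ≤ C := by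
  obtain ⟨C, hC⟩ := exists_norm_Λ_le P.isStrongFEPair_toStrongFEPair a b
  refine ⟨C, fun s h1 h2 => ?_⟩
  have := hC s h1 h2
  rw [P.isStrongFEPair_toStrongFEPair.Λ_eq] at this
  exact this

lemma norm_Gamma_le {s : ℂ} (hs : 0 < s.re) : ‖Complex.Gamma s‖ ≤ Real.Gamma s.re := by
  rw [Complex.Gamma_eq_integral hs, Real.Gamma_eq_integral hs, Complex.GammaIntegral]
  refine norm_integral_le_of_norm_le (Real.GammaIntegral_convergent hs) ?_
  filter_upwards [ae_restrict_mem measurableSet_Ioi] with t ht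
  have ht0 : 0 < t := ht
  rw [norm_mul, norm_cpow_eq_rpow_re_of_pos ht0, norm_real, Real.norm_of_nonneg (Real.exp_pos _).le]
  simp

lemma exists_norm_Gamma_le {a b : ℝ} (ha : 0 < a) :
    ∃ C : ℝ, 0 ≤ C ∧ ∀ s : ℂ, a ≤ s.re → s.re ≤ b → ‖Complex.Gamma s‖ ≤ C := by
  have hc : ContinuousOn Real.Gamma (Set.Icc a b) := fun x hx =>
    (Real.differentiableAt_Gamma fun m => by
      have := hx.1
      have : (0 : ℝ) ≤ m := by positivity
      linarith [hx.1]).continuousAt.continuousWithinAt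
  obtain ⟨C, hC⟩ := isCompact_Icc.exists_bound_of_continuousOn hc
  refine ⟨max C 0, le_max_right _ _, fun s h1 h2 => (norm_Gamma_le (by linarith)).trans ?_⟩
  exact (le_abs_self _).trans ((hC s.re ⟨h1, h2⟩).trans (le_max_left _ _))

lemma norm_sin_le (z : ℂ) : ‖Complex.sin z‖ ≤ Real.exp |z.im| := by
  rw [Complex.sin, norm_div, norm_mul, norm_I, mul_one, Complex.norm_two]
  have h := norm_sub_le (Complex.exp (-z * I)) (Complex.exp (z * I))
  rw [Complex.norm_exp, Complex.norm_exp] at h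
  have h1 : Real.exp (-z * I).re ≤ Real.exp |z.im| :=
    Real.exp_le_exp.mpr (by simpa using le_abs_self _)
  have h2 : Real.exp (z * I).re ≤ Real.exp |z.im| :=
    Real.exp_le_exp.mpr (by simpa using neg_le_abs _)
  linarith

lemma exists_norm_inv_Gamma_le : ∃ C : ℝ, 0 ≤ C ∧ ∀ w : ℂ, -3 / 4 ≤ w.re → w.re ≤ 3 / 4 →
    ‖(Complex.Gamma w)⁻¹‖ ≤ C * Real.exp (π * |w.im|) := by
  obtain ⟨C, hC0, hC⟩ := exists_norm_Gamma_le (a := 1 / 4) (b := 7 / 4) (by norm_num)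
  refine ⟨C / π, by positivity, fun w h1 h2 => ?_⟩
  by_cases hw : Complex.Gamma w = 0
  · rw [hw, inv_zero, norm_zero]
    positivity
  have hs : Complex.sin (π * w) ≠ 0 := by
    intro h
    obtain ⟨k, hk⟩ := Complex.sin_eq_zero_iff.mp h
    have hwk : w = k := by
      have : (π : ℂ) ≠ 0 := by exact_mod_cast Real.pi_ne_zero
      exact mul_left_cancel₀ this (hk.trans (mul_comm _ _))
    have hk1 : (-1 : ℝ) < k := by
      have := congrArg re hwk
      simp only [intCast_re] at this
      linarith
    have hk2 : (k : ℝ) < 1 := by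
      have := congrArg re hwk
      simp only [intCast_re] at this
      linarith
    have hk0 : k = 0 := by
      have a1 : -1 < k := by exact_mod_cast hk1
      have a2 : k < 1 := by exact_mod_cast hk2
      omega
    rw [hwk, hk0] at hw
    simp at hw
  have hrefl := Complex.Gamma_mul_Gamma_one_sub w
  have hinv : (Complex.Gamma w)⁻¹ = Complex.Gamma (1 - w) * Complex.sin (π * w) / π := by
    have hpi : (π : ℂ) ≠ 0 := by exact_mod_cast Real.pi_ne_zero
    refine inv_eq_of_mul_eq_one_left ?_
    rw [div_mul_eq_mul_div, div_eq_one_iff_eq hpi]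
    calc _ = Complex.Gamma w * Complex.Gamma (1 - w) * Complex.sin (π * w) := by ring
      _ = _ := by rw [hrefl, div_mul_cancel₀ _ hs]
  rw [hinv, norm_div, norm_mul, norm_real, Real.norm_of_nonneg Real.pi_pos.le]
  have e1 := hC (1 - w) (by simp; linarith) (by simp; linarith)
  have e2 := norm_sin_le (π * w)
  rw [show ((π : ℂ) * w).im = π * w.im by simp, abs_mul, abs_of_pos Real.pi_pos] at e2
  rw [div_mul_eq_mul_div]
  gcongr

lemma exists_norm_inv_Gammaℝ_le : ∃ C : ℝ, 0 ≤ C ∧ ∀ s : ℂ, -3 / 2 ≤ s.re → s.re ≤ 3 / 2 →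
    ‖(Gammaℝ s)⁻¹‖ ≤ C * Real.exp (π * |s.im|) := by
  obtain ⟨C, hC0, hC⟩ := exists_norm_inv_Gamma_le
  refine ⟨π * C, by positivity, fun s h1 h2 => ?_⟩
  have e1 : (s / 2).re = s.re / 2 := by simp
  have e2 : (s / 2).im = s.im / 2 := by simp
  have e := hC (s / 2) (by rw [e1]; linarith) (by rw [e1]; linarith)
  rw [Gammaℝ_def, mul_inv, norm_mul, ← cpow_neg, norm_cpow_eq_rpow_re_of_pos Real.pi_pos,
    mul_assoc]
  refine mul_le_mul ?_ (e.trans ?_) (norm_nonneg _) Real.pi_pos.le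
  · calc π ^ (-(-s / 2)).re ≤ π ^ (1 : ℝ) :=
        Real.rpow_le_rpow_of_exponent_le (by linarith [Real.pi_gt_three]) (by
          rw [show -(-s / 2) = s / 2 by ring, e1]; linarith)
      _ = π := Real.rpow_one _
  · rw [e2, abs_div]
    have := abs_nonneg s.im
    gcongr
    norm_num

lemma exists_norm_inv_Gammaℝ_add_one_le : ∃ C : ℝ, 0 ≤ C ∧ ∀ s : ℂ, -1 / 2 ≤ s.re → s.re ≤ 3 / 2 →
    1 ≤ |s.im| → ‖(Gammaℝ (s + 1))⁻¹‖ ≤ C * Real.exp (π * |s.im|) := by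
  obtain ⟨C, hC0, hC⟩ := exists_norm_inv_Gammaℝ_le
  refine ⟨2 * π * C, by positivity, fun s h1 h2 h3 => ?_⟩
  have hs1 : 1 ≤ ‖s - 1‖ := h3.trans (by simpa using abs_im_le_norm (s - 1))
  have hs0 : s - 1 ≠ 0 := fun h => by rw [h, norm_zero] at hs1; linarith
  have e := hC (s - 1) (by simp; linarith) (by simp; linarith)
  rw [show s + 1 = (s - 1) + 2 by ring, Gammaℝ_add_two hs0]
  simp only [mul_inv, div_eq_mul_inv, inv_inv, norm_mul, norm_inv, Complex.norm_two, norm_real,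
    Real.norm_of_nonneg Real.pi_pos.le] at e ⊢
  have e' : (s - 1).im = s.im := by simp
  rw [e'] at e
  have : ‖s - 1‖⁻¹ ≤ 1 := inv_le_one_of_one_le₀ hs1
  calc ‖Gammaℝ (s - 1)‖⁻¹ * ‖s - 1‖⁻¹ * 2 * π
      ≤ (C * Real.exp (π * |s.im|)) * 1 * 2 * π := by gcongr
    _ = _ := by ring

lemma exists_norm_hurwitzZeta_le (a : UnitAddCircle) : ∃ C : ℝ, 0 ≤ C ∧ ∀ s : ℂ, -1 / 2 ≤ s.re →
    s.re ≤ 3 / 2 → 1 ≤ |s.im| → ‖hurwitzZeta a s‖ ≤ C * Real.exp (π * |s.im|) := by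
  obtain ⟨C₁, hC₁⟩ := exists_norm_Λ₀_le (hurwitzEvenFEPair a) (-1 / 4) (3 / 4)
  obtain ⟨C₂, hC₂⟩ := exists_norm_Λ_le (isStrong_hurwitzOddFEPair a) (1 / 4) (5 / 4)
  obtain ⟨C₃, hC₃0, hC₃⟩ := exists_norm_inv_Gammaℝ_le
  obtain ⟨C₄, hC₄0, hC₄⟩ := exists_norm_inv_Gammaℝ_add_one_le
  have hC₁0 : 0 ≤ C₁ := (norm_nonneg _).trans (hC₁ 0 (by norm_num) (by norm_num))
  have hC₂0 : 0 ≤ C₂ := (norm_nonneg _).trans (hC₂ 1 (by norm_num) (by norm_num))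
  refine ⟨(C₁ + 2) * C₃ + C₂ * C₄, by positivity, fun s h1 h2 h3 => ?_⟩
  have hs0 : s ≠ 0 := fun h => by rw [h] at h3; norm_num at h3
  have hns : 1 ≤ ‖s‖ := h3.trans (abs_im_le_norm s)
  have hns1 : 1 ≤ ‖1 - s‖ := h3.trans (by simpa using abs_im_le_norm (1 - s))
  rw [hurwitzZeta, add_mul]
  refine (norm_add_le _ _).trans (add_le_add ?_ ?_)
  · rw [hurwitzZetaEven_def_of_ne_or_ne (Or.inr hs0), div_eq_mul_inv, norm_mul, mul_assoc]
    refine mul_le_mul ?_ (hC₃ s (by linarith) (by linarith)) (norm_nonneg _) (by positivity)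
    rw [completedHurwitzZetaEven_eq]
    have a1 : ‖completedHurwitzZetaEven₀ a s‖ ≤ C₁ := by
      rw [completedHurwitzZetaEven₀, norm_div, Complex.norm_two]
      have := hC₁ (s / 2) (by simp; linarith) (by simp; linarith)
      linarith
    have a2 : ‖(if a = 0 then (1 : ℂ) else 0) / s‖ ≤ 1 := by
      rw [norm_div]
      refine (div_le_one (by linarith)).mpr (le_trans ?_ hns)
      split_ifs <;> simp
    have a3 : ‖1 / (1 - s)‖ ≤ 1 := by
      rw [norm_div, norm_one]
      exact (div_le_one (by linarith)).mpr hns1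
    have := norm_sub_le (completedHurwitzZetaEven₀ a s - (if a = 0 then (1 : ℂ) else 0) / s)
      (1 / (1 - s))
    have := norm_sub_le (completedHurwitzZetaEven₀ a s) ((if a = 0 then (1 : ℂ) else 0) / s)
    linarith
  · rw [hurwitzZetaOdd, div_eq_mul_inv, norm_mul, mul_assoc]
    refine mul_le_mul ?_ (hC₄ s h1 h2 h3) (norm_nonneg _) (by positivity)
    rw [completedHurwitzZetaOdd, norm_div, Complex.norm_two]
    have := hC₂ ((s + 1) / 2) (by simp; linarith) (by simp; linarith)
    linarith

variable {N : ℕ} [NeZero N]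

lemma exists_norm_LFunction_le (χ : DirichletCharacter ℂ N) : ∃ C : ℝ, 0 ≤ C ∧ ∀ s : ℂ,
    -1 / 2 ≤ s.re → s.re ≤ 3 / 2 → 1 ≤ |s.im| →
    ‖DirichletCharacter.LFunction χ s‖ ≤ C * Real.exp (π * |s.im|) := by
  choose C hC0 hC using fun j : ZMod N => exists_norm_hurwitzZeta_le (ZMod.toAddCircle j)
  have hN : (1 : ℝ) ≤ N := by exact_mod_cast Nat.one_le_iff_ne_zero.mpr (NeZero.ne N)
  refine ⟨(N : ℝ) * ∑ j, C j, mul_nonneg (by positivity) (sum_nonneg fun j _ => hC0 j),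
    fun s h1 h2 h3 => ?_⟩
  rw [DirichletCharacter.LFunction, ZMod.LFunction, norm_mul, mul_assoc, sum_mul]
  refine mul_le_mul ?_ ((norm_sum_le _ _).trans (sum_le_sum fun j _ => ?_)) (norm_nonneg _)
    (by positivity)
  · rw [norm_natCast_cpow_of_pos (by linarith [Nat.pos_of_ne_zero (NeZero.ne N)])]
    calc (N : ℝ) ^ (-s).re ≤ (N : ℝ) ^ (1 : ℝ) :=
        Real.rpow_le_rpow_of_exponent_le hN (by simp; linarith)
      _ = N := Real.rpow_one _
  · rw [norm_mul]
    calc ‖χ j‖ * ‖hurwitzZeta (ZMod.toAddCircle j) s‖ ≤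
        1 * ‖hurwitzZeta (ZMod.toAddCircle j) s‖ := by
          gcongr
          exact DirichletCharacter.norm_le_one χ j
      _ ≤ _ := by rw [one_mul]; exact hC j s h1 h2 h3

end

section

lemma exp_abs_le_two_mul_cosh (x : ℝ) : Real.exp |x| ≤ 2 * Real.cosh x := by
  rw [← Real.cosh_abs, Real.cosh_eq]
  linarith [Real.exp_pos (-|x|)]

lemma norm_Gamma_mul_exp_le {w : ℂ} (hw : w.re = 1 / 2) :
    ‖Complex.Gamma w‖ * Real.exp (π * |w.im| / 2) ≤ Real.sqrt (2 * π) := by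
  have hw' : w = 1 / 2 + w.im * I := by
    apply Complex.ext <;> simp [hw]
  have hconj : 1 - w = (starRingEnd ℂ) w := by
    apply Complex.ext
    · simp [hw]; norm_num
    · simp
  have hsin : Complex.sin (π * w) = Real.cosh (π * w.im) := by
    rw [show (π : ℂ) * w = π * w.im * I + π / 2 by rw [hw']; simp; ring, Complex.sin_add_pi_div_two,
      Complex.cos_mul_I, ofReal_cosh, ofReal_mul]
  have h := Complex.Gamma_mul_Gamma_one_sub w
  rw [hconj, Complex.Gamma_conj, hsin, Complex.mul_conj, Complex.normSq_eq_norm_sq] at h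
  have hre : ‖Complex.Gamma w‖ ^ 2 = π / Real.cosh (π * w.im) := by exact_mod_cast h
  have hcosh := Real.cosh_pos (π * w.im)
  refine Real.le_sqrt_of_sq_le ?_
  rw [mul_pow, hre, ← Real.exp_nat_mul, Nat.cast_two, mul_div_cancel₀ _ two_ne_zero,
    div_mul_eq_mul_div, div_le_iff₀ hcosh]
  have := exp_abs_le_two_mul_cosh (π * w.im)
  rw [abs_mul, abs_of_pos Real.pi_pos] at this
  nlinarith [Real.pi_pos]

lemma norm_le_two_mul_one_add_abs {z : ℂ} (h1 : -2 ≤ z.re) (h2 : z.re ≤ 2) :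
    ‖z‖ ≤ 2 * (1 + |z.im|) := by
  have := norm_le_abs_re_add_abs_im z
  have := abs_le.mpr ⟨h1, h2⟩
  have := abs_nonneg z.im
  linarith

lemma norm_Gamma_three_halves_mul_exp_le {w : ℂ} (hw : w.re = 3 / 2) :
    ‖Complex.Gamma w‖ * Real.exp (π * |w.im| / 2) ≤ 2 * Real.sqrt (2 * π) * (1 + |w.im|) := by
  have hre : (w - 1).re = 1 / 2 := by simp [hw]; norm_num
  have him : (w - 1).im = w.im := by simp
  have h0 : w - 1 ≠ 0 := fun h => by rw [h] at hre; norm_num at hre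
  have hG := Complex.Gamma_add_one (w - 1) h0
  rw [sub_add_cancel] at hG
  have e1 := norm_Gamma_mul_exp_le hre
  have e2 := norm_le_two_mul_one_add_abs (z := w - 1) (by linarith) (by linarith)
  rw [him] at e1 e2
  rw [hG, norm_mul, mul_assoc]
  calc ‖w - 1‖ * (‖Complex.Gamma (w - 1)‖ * Real.exp (π * |w.im| / 2))
      ≤ (2 * (1 + |w.im|)) * Real.sqrt (2 * π) := by gcongr
    _ = _ := by ring

lemma norm_Gamma_five_halves_mul_exp_le {w : ℂ} (hw : w.re = 5 / 2) :
    ‖Complex.Gamma w‖ * Real.exp (π * |w.im| / 2) ≤ 4 * Real.sqrt (2 * π) * (1 + |w.im|) ^ 2 := by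
  have hre : (w - 1).re = 3 / 2 := by simp [hw]; norm_num
  have him : (w - 1).im = w.im := by simp
  have h0 : w - 1 ≠ 0 := fun h => by rw [h] at hre; norm_num at hre
  have hG := Complex.Gamma_add_one (w - 1) h0
  rw [sub_add_cancel] at hG
  have e1 := norm_Gamma_three_halves_mul_exp_le hre
  have e2 := norm_le_two_mul_one_add_abs (z := w - 1) (by linarith) (by linarith)
  rw [him] at e1 e2
  rw [hG, norm_mul, mul_assoc]
  calc ‖w - 1‖ * (‖Complex.Gamma (w - 1)‖ * Real.exp (π * |w.im| / 2))
      ≤ (2 * (1 + |w.im|)) * (2 * Real.sqrt (2 * π) * (1 + |w.im|)) := by gcongr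
    _ = _ := by ring

variable {N : ℕ} [NeZero N]

lemma LFunction_const_mul (c : ℂ) (Φ : ZMod N → ℂ) (s : ℂ) :
    ZMod.LFunction (fun j => c * Φ j) s = c * ZMod.LFunction Φ s := by
  simp only [ZMod.LFunction, mul_assoc, mul_sum, mul_left_comm c]

/-- The functional equation for primitive Dirichlet characters in asymmetric form. -/
lemma LFunction_primitive_one_sub {χ : DirichletCharacter ℂ N} (hχ : χ.IsPrimitive) {s : ℂ}
    (hs : 1 < s.re) : DirichletCharacter.LFunction χ (1 - s) =
      N ^ (s - 1) * (2 * π) ^ (-s) * Complex.Gamma s * gaussSum χ ZMod.stdAddChar *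
        (χ⁻¹ (-1) * Complex.exp (π * I * s / 2) + Complex.exp (-π * I * s / 2)) *
        DirichletCharacter.LFunction χ⁻¹ s := by
  have h1 : ∀ n : ℕ, s ≠ -n := fun n h => by
    rw [h] at hs
    simp at hs
    have : (0 : ℝ) ≤ n := by positivity
    linarith
  have h2 : s ≠ 1 := fun h => by simp [h] at hs
  have hε : χ (-1) * χ⁻¹ (-1) = 1 := by
    rw [← MulChar.mul_apply, mul_inv_cancel, MulChar.one_apply (isUnit_one.neg)]
  have f1 : ZMod.dft (χ : ZMod N → ℂ) =
      fun k => (gaussSum χ ZMod.stdAddChar * χ⁻¹ (-1)) * χ⁻¹ k := by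
    ext k
    rw [hχ.fourierTransform_eq_inv_mul_gaussSum, ← neg_one_mul k, map_mul]
    ring
  have f2 : ZMod.dft (fun x => χ (-x)) = fun k => gaussSum χ ZMod.stdAddChar * χ⁻¹ k := by
    have : (fun x : ZMod N => χ (-x)) = χ (-1) • (χ : ZMod N → ℂ) := by
      ext x
      rw [← neg_one_mul x, map_mul]
      rfl
    rw [this, map_smul, f1]
    ext k
    simp only [Pi.smul_apply, smul_eq_mul]
    linear_combination (gaussSum χ ZMod.stdAddChar * χ⁻¹ k) * hε
  rw [DirichletCharacter.LFunction, ZMod.LFunction_one_sub _ h1 (Or.inr h2), f1, f2,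
    LFunction_const_mul, LFunction_const_mul, DirichletCharacter.LFunction]
  ring

/-- The factor in the functional equation `(z - 1) L(z, χ) = Y(z) L(1 - z, χ⁻¹)`. -/
noncomputable def reflectionFactor (χ : DirichletCharacter ℂ N) (z : ℂ) : ℂ :=
  -((N : ℂ) ^ (-z) * (2 * π) ^ (z - 1) * Complex.Gamma (2 - z) * gaussSum χ ZMod.stdAddChar *
    (χ⁻¹ (-1) * Complex.exp (π * I * (1 - z) / 2) + Complex.exp (-π * I * (1 - z) / 2)))

lemma sub_one_mul_LFunction_eq {χ : DirichletCharacter ℂ N} (hχ : χ.IsPrimitive) {z : ℂ}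
    (hz : z.re < 0) : (z - 1) * DirichletCharacter.LFunction χ z =
      reflectionFactor χ z * DirichletCharacter.LFunction χ⁻¹ (1 - z) := by
  have h := LFunction_primitive_one_sub hχ (s := 1 - z) (by simp; linarith)
  have h0 : 1 - z ≠ 0 := fun h => by
    have := congrArg re h
    simp at this
    linarith
  have hG := Complex.Gamma_add_one (1 - z) h0
  rw [show 1 - z + 1 = 2 - z by ring] at hG
  rw [sub_sub_cancel] at h
  rw [h, reflectionFactor, hG, show 1 - z - 1 = -z by ring, show -(1 - z) = z - 1 by ring]
  ring

lemma differentiableOn_reflectionFactor (χ : DirichletCharacter ℂ N) :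
    DifferentiableOn ℂ (reflectionFactor χ) {z : ℂ | z.re < 2} := by
  intro z hz
  have hz' : z.re < 2 := hz
  have hN : (N : ℂ) ≠ 0 := by exact_mod_cast NeZero.ne N
  have hpi : (2 * π : ℂ) ≠ 0 := by
    simp [Real.pi_ne_zero]
  have hG : DifferentiableAt ℂ (fun z => Complex.Gamma (2 - z)) z := by
    refine DifferentiableAt.comp z (Complex.differentiableAt_Gamma _ fun m h => ?_) (by fun_prop)
    have := congrArg re h
    simp at this
    have : (0 : ℝ) ≤ m := by positivity
    linarith
  have h1 : DifferentiableAt ℂ (fun z : ℂ => (N : ℂ) ^ (-z)) z :=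
    DifferentiableAt.const_cpow (by fun_prop) (Or.inl hN)
  have h2 : DifferentiableAt ℂ (fun z : ℂ => (2 * π : ℂ) ^ (z - 1)) z :=
    DifferentiableAt.const_cpow (by fun_prop) (Or.inl hpi)
  exact ((((h1.mul h2).mul hG).mul (by fun_prop)).mul
    (by fun_prop)).neg.differentiableWithinAt

lemma exists_norm_reflectionFactor_le (χ : DirichletCharacter ℂ N) :
    ∃ C : ℝ, 0 ≤ C ∧ ∀ z : ℂ, -1 / 2 ≤ z.re → z.re ≤ 3 / 2 → ‖reflectionFactor χ z‖ ≤
      C * (‖Complex.Gamma (2 - z)‖ * Real.exp (π * |(2 - z).im| / 2)) := by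
  refine ⟨N * (2 * π) * ‖gaussSum χ ZMod.stdAddChar‖ * 2, by positivity, fun z h1 h2 => ?_⟩
  have hN : (1 : ℝ) ≤ N := by exact_mod_cast Nat.one_le_iff_ne_zero.mpr (NeZero.ne N)
  have hpi := Real.pi_gt_three
  have e1 : ‖(N : ℂ) ^ (-z)‖ ≤ N := by
    rw [norm_natCast_cpow_of_pos (Nat.pos_of_ne_zero (NeZero.ne N))]
    calc (N : ℝ) ^ (-z).re ≤ (N : ℝ) ^ (1 : ℝ) :=
        Real.rpow_le_rpow_of_exponent_le hN (by simp; linarith)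
      _ = N := Real.rpow_one _
  have e2 : ‖(2 * π : ℂ) ^ (z - 1)‖ ≤ 2 * π := by
    rw [show (2 * π : ℂ) = ((2 * π : ℝ) : ℂ) by push_cast; rfl,
      norm_cpow_eq_rpow_re_of_pos (by positivity)]
    calc (2 * π : ℝ) ^ (z - 1).re ≤ (2 * π : ℝ) ^ (1 : ℝ) :=
        Real.rpow_le_rpow_of_exponent_le (by linarith) (by simp; linarith)
      _ = _ := Real.rpow_one _
  have e3 : ‖χ⁻¹ (-1) * Complex.exp (π * I * (1 - z) / 2) + Complex.exp (-π * I * (1 - z) / 2)‖ ≤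
      2 * Real.exp (π * |(2 - z).im| / 2) := by
    have him : (2 - z).im = -z.im := by simp
    rw [him, abs_neg]
    have a1 : (π * I * (1 - z) / 2).re = π * z.im / 2 := by simp
    have a2 : (-π * I * (1 - z) / 2).re = -(π * z.im / 2) := by simp; ring
    have b1 : Real.exp (π * z.im / 2) ≤ Real.exp (π * |z.im| / 2) := by
      gcongr
      exact le_abs_self _
    have b2 : Real.exp (-(π * z.im / 2)) ≤ Real.exp (π * |z.im| / 2) := by
      apply Real.exp_le_exp.mpr
      have := mul_le_mul_of_nonneg_left (neg_le_abs z.im) Real.pi_pos.le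
      linarith
    have c := norm_add_le (χ⁻¹ (-1) * Complex.exp (π * I * (1 - z) / 2))
      (Complex.exp (-π * I * (1 - z) / 2))
    rw [norm_mul, Complex.norm_exp, Complex.norm_exp, a1, a2] at c
    have d := DirichletCharacter.norm_le_one χ⁻¹ (-1)
    have := mul_le_mul d b1 (Real.exp_pos _).le zero_le_one
    linarith
  rw [reflectionFactor, norm_neg, norm_mul, norm_mul, norm_mul, norm_mul]
  calc _ ≤ (N : ℝ) * (2 * π) * ‖Complex.Gamma (2 - z)‖ * ‖gaussSum χ ZMod.stdAddChar‖ *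
        (2 * Real.exp (π * |(2 - z).im| / 2)) := by gcongr
    _ = _ := by ring

/-- Analytic data for a single Dirichlet character: `G(z) = (z - 1) L(z, χ)` and a factor `Y`
with `G(z) = Y(z) L(1 - z, χ⁻¹)`, with their growth in vertical strips. -/
structure CharacterReflection (χ : DirichletCharacter ℂ N) (G Y : ℂ → ℂ) (C c : ℝ) : Prop where
  differentiable : Differentiable ℂ G
  differentiableOn : DifferentiableOn ℂ Y {z : ℂ | z.re < 2}
  norm_le_exp : ∀ z : ℂ, -1 / 2 ≤ z.re → z.re ≤ 3 / 2 → ‖G z‖ ≤ C * Real.exp (c * |z.im|)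
  norm_factor_le_exp : ∀ z : ℂ, -1 / 2 ≤ z.re → z.re ≤ 3 / 2 → ‖Y z‖ ≤ C * Real.exp (c * |z.im|)
  eq_of_ne : ∀ z : ℂ, z ≠ 1 → G z = (z - 1) * DirichletCharacter.LFunction χ z
  eq_left : ∀ z : ℂ, z.re = -1 / 2 → G z = Y z * DirichletCharacter.LFunction χ⁻¹ (1 - z)
  norm_right : ∀ z : ℂ, z.re = 3 / 2 → ‖Y z‖ ≤ C
  norm_middle : ∀ z : ℂ, z.re = 1 / 2 → ‖Y z‖ ≤ C * (1 + |z.im|)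
  norm_left : ∀ z : ℂ, z.re = -1 / 2 → ‖Y z‖ ≤ C * (1 + |z.im|) ^ 2

lemma exists_entire_eq (χ : DirichletCharacter ℂ N) : ∃ G : ℂ → ℂ, Differentiable ℂ G ∧
    ∀ z : ℂ, z ≠ 1 → G z = (z - 1) * DirichletCharacter.LFunction χ z := by
  by_cases hχ : χ = 1
  · refine ⟨_, DirichletCharacter.differentiable_LFunctionTrivChar₁ N, fun z hz => ?_⟩
    rw [DirichletCharacter.LFunctionTrivChar₁, Function.update_of_ne hz, hχ,
      DirichletCharacter.LFunctionTrivChar]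
  · exact ⟨_, Differentiable.mul (by fun_prop) (DirichletCharacter.differentiable_LFunction hχ),
      fun z _ => rfl⟩

lemma exists_norm_le_exp_of_eq {χ : DirichletCharacter ℂ N} {G : ℂ → ℂ} (hG : Differentiable ℂ G)
    (hG' : ∀ z : ℂ, z ≠ 1 → G z = (z - 1) * DirichletCharacter.LFunction χ z) :
    ∃ C : ℝ, 0 ≤ C ∧ ∀ z : ℂ, -1 / 2 ≤ z.re → z.re ≤ 3 / 2 →
      ‖G z‖ ≤ C * Real.exp ((π + 1) * |z.im|) := by
  obtain ⟨C₁, hC₁0, hC₁⟩ := exists_norm_LFunction_le χ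
  obtain ⟨C₂, hC₂⟩ := (isCompact_Icc.reProdIm isCompact_Icc :
    IsCompact (Set.Icc (-1 / 2 : ℝ) (3 / 2) ×ℂ Set.Icc (-1 : ℝ) 1)).exists_bound_of_continuousOn
      hG.continuous.continuousOn
  refine ⟨max (2 * C₁) C₂, le_max_of_le_left (by positivity), fun z h1 h2 => ?_⟩
  rcases le_total 1 |z.im| with h | h
  · have hz : z ≠ 1 := fun hz => by rw [hz] at h; norm_num at h
    rw [hG' z hz, norm_mul]
    have e1 := norm_le_two_mul_one_add_abs (z := z - 1) (by simp; linarith) (by simp; linarith)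
    rw [show (z - 1).im = z.im by simp] at e1
    have e2 := hC₁ z h1 h2 h
    have e3 := Real.add_one_le_exp |z.im|
    calc ‖z - 1‖ * ‖DirichletCharacter.LFunction χ z‖
        ≤ (2 * Real.exp |z.im|) * (C₁ * Real.exp (π * |z.im|)) := by
          gcongr
          linarith
      _ = 2 * C₁ * Real.exp ((π + 1) * |z.im|) := by
          rw [add_mul, one_mul, Real.exp_add]
          ring
      _ ≤ _ := by gcongr; exact le_max_left _ _
  · have hmem : z ∈ Set.Icc (-1 / 2 : ℝ) (3 / 2) ×ℂ Set.Icc (-1 : ℝ) 1 :=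
      ⟨⟨h1, h2⟩, abs_le.mp h⟩
    have e := hC₂ z hmem
    have : 1 ≤ Real.exp ((π + 1) * |z.im|) := Real.one_le_exp (by positivity)
    have hm : 0 ≤ max (2 * C₁) C₂ := le_max_of_le_left (by positivity)
    have := le_max_right (2 * C₁) C₂
    nlinarith

theorem exists_characterReflection {χ : DirichletCharacter ℂ N} (hχ : χ.IsPrimitive) :
    ∃ G Y C c, CharacterReflection χ G Y C c := by
  obtain ⟨G, hG, hG'⟩ := exists_entire_eq χ
  obtain ⟨C₁, hC₁0, hC₁⟩ := exists_norm_le_exp_of_eq hG hG'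
  obtain ⟨C₂, hC₂0, hC₂⟩ := exists_norm_reflectionFactor_le χ
  obtain ⟨C₃, hC₃0, hC₃⟩ := exists_norm_Gamma_le (a := 1 / 2) (b := 5 / 2) (by norm_num)
  have hπ := Real.pi_pos
  have hs := Real.sqrt_nonneg (2 * π)
  set C := C₁ + C₂ * C₃ + C₂ * (4 * Real.sqrt (2 * π)) with hC
  have hm : C₂ * (4 * Real.sqrt (2 * π)) ≤ C := by
    have : 0 ≤ C₂ * C₃ := by positivity
    linarith
  have hc1 : C₁ ≤ C := by
    have : 0 ≤ C₂ * C₃ := by positivity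
    have : 0 ≤ C₂ * (4 * Real.sqrt (2 * π)) := by positivity
    linarith
  have hc2 : C₂ * C₃ ≤ C := by
    have : 0 ≤ C₂ * (4 * Real.sqrt (2 * π)) := by positivity
    linarith
  have hre : ∀ z : ℂ, (2 - z).re = 2 - z.re := fun z => by simp
  have him : ∀ z : ℂ, |(2 - z).im| = |z.im| := fun z => by simp
  refine ⟨G, reflectionFactor χ, C, π + 1, hG, differentiableOn_reflectionFactor χ,
    fun z h1 h2 => (hC₁ z h1 h2).trans (by gcongr), fun z h1 h2 => ?_, hG', fun z hz => ?_,
    fun z hz => ?_, fun z hz => ?_, fun z hz => ?_⟩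
  · refine (hC₂ z h1 h2).trans ?_
    rw [him, ← mul_assoc]
    have e := hC₃ (2 - z) (by rw [hre]; linarith) (by rw [hre]; linarith)
    have := abs_nonneg z.im
    have e2 : π * |z.im| / 2 ≤ (π + 1) * |z.im| := by nlinarith
    calc _ ≤ C₂ * C₃ * Real.exp ((π + 1) * |z.im|) := by gcongr
      _ ≤ _ := by gcongr
  · have hz1 : z ≠ 1 := fun h => by rw [h] at hz; norm_num at hz
    rw [hG' z hz1, sub_one_mul_LFunction_eq hχ (by linarith)]
  · have e := norm_Gamma_mul_exp_le (w := 2 - z) (by rw [hre]; linarith)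
    refine (hC₂ z (by linarith) (by linarith)).trans (le_trans ?_ hm)
    exact mul_le_mul_of_nonneg_left (by linarith) hC₂0
  · have e := norm_Gamma_three_halves_mul_exp_le (w := 2 - z) (by rw [hre]; linarith)
    refine (hC₂ z (by linarith) (by linarith)).trans ?_
    rw [him] at e ⊢
    calc _ ≤ C₂ * (2 * Real.sqrt (2 * π) * (1 + |z.im|)) := by gcongr
      _ ≤ C₂ * (4 * Real.sqrt (2 * π)) * (1 + |z.im|) := by
        rw [← mul_assoc]
        gcongr
        norm_num
      _ ≤ _ := by gcongr
  · have e := norm_Gamma_five_halves_mul_exp_le (w := 2 - z) (by rw [hre]; linarith)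
    refine (hC₂ z (by linarith) (by linarith)).trans ?_
    rw [him] at e ⊢
    calc _ ≤ C₂ * (4 * Real.sqrt (2 * π) * (1 + |z.im|) ^ 2) := by gcongr
      _ = C₂ * (4 * Real.sqrt (2 * π)) * (1 + |z.im|) ^ 2 := by ring
      _ ≤ _ := by gcongr

end

section

/-- The coefficients of `L(s, χ₁) L(s, χ₂)`. -/
noncomputable def convCoeff {M N : ℕ} (χ₁ : DirichletCharacter ℂ M) (χ₂ : DirichletCharacter ℂ N) :
    ℕ → ℂ :=
  LSeries.convolution (fun n => χ₁ n) (fun n => χ₂ n)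

variable {M N : ℕ} [NeZero M] [NeZero N]

lemma LSeriesSummable_convCoeff (χ₁ : DirichletCharacter ℂ M) (χ₂ : DirichletCharacter ℂ N) {s : ℂ}
    (hs : 1 < s.re) : LSeriesSummable (convCoeff χ₁ χ₂) s :=
  (ZMod.LSeriesSummable_of_one_lt_re χ₁ hs).convolution (ZMod.LSeriesSummable_of_one_lt_re χ₂ hs)

lemma LFunction_mul_LFunction_eq (χ₁ : DirichletCharacter ℂ M) (χ₂ : DirichletCharacter ℂ N)
    {s : ℂ} (hs : 1 < s.re) :
    DirichletCharacter.LFunction χ₁ s * DirichletCharacter.LFunction χ₂ s =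
      LSeries (convCoeff χ₁ χ₂) s := by
  rw [DirichletCharacter.LFunction_eq_LSeries χ₁ hs, DirichletCharacter.LFunction_eq_LSeries χ₂ hs,
    convCoeff, LSeries_convolution' (ZMod.LSeriesSummable_of_one_lt_re χ₁ hs)
      (ZMod.LSeriesSummable_of_one_lt_re χ₂ hs)]

namespace CharacterReflection

variable {χ₁ : DirichletCharacter ℂ M} {χ₂ : DirichletCharacter ℂ N} {G₁ G₂ Y₁ Y₂ : ℂ → ℂ}
  {C₁ C₂ c₁ c₂ : ℝ}

lemma nonneg (h : CharacterReflection χ₁ G₁ Y₁ C₁ c₁) : 0 ≤ C₁ := by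
  have := (norm_nonneg _).trans (h.norm_le_exp 0 (by norm_num) (by norm_num))
  simpa using this

lemma reflectionData (h₁ : CharacterReflection χ₁ G₁ Y₁ C₁ c₁)
    (h₂ : CharacterReflection χ₂ G₂ Y₂ C₂ c₂) :
    ReflectionData (fun z => G₁ z * G₂ z) (fun z => Y₁ z * Y₂ z) (convCoeff χ₁ χ₂)
      (convCoeff χ₁⁻¹ χ₂⁻¹) (C₁ * C₂) (c₁ + c₂) := by
  have hC₁ := h₁.nonneg
  have hC₂ := h₂.nonneg
  have hexp : ∀ x : ℝ, C₁ * C₂ * Real.exp ((c₁ + c₂) * x) =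
      (C₁ * Real.exp (c₁ * x)) * (C₂ * Real.exp (c₂ * x)) := fun x => by
    rw [add_mul, Real.exp_add]
    ring
  refine ⟨h₁.differentiable.mul h₂.differentiable, h₁.differentiableOn.mul h₂.differentiableOn,
    fun z a b => ?_, fun z a b => ?_, fun z hz => ?_, fun z hz => ?_, fun z hz => ?_,
        fun z hz => ?_,
    fun z hz => ?_, LSeriesSummable_convCoeff _ _ (by norm_num),
    LSeriesSummable_convCoeff _ _ (by norm_num)⟩
  · rw [norm_mul, hexp]
    exact mul_le_mul (h₁.norm_le_exp z a b) (h₂.norm_le_exp z a b) (norm_nonneg _) (by positivity)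
  · rw [norm_mul, hexp]
    exact mul_le_mul (h₁.norm_factor_le_exp z a b) (h₂.norm_factor_le_exp z a b) (norm_nonneg _)
      (by positivity)
  · have hz1 : z ≠ 1 := fun h => by rw [h] at hz; norm_num at hz
    rw [h₁.eq_of_ne z hz1, h₂.eq_of_ne z hz1,
      ← LFunction_mul_LFunction_eq _ _ (by rw [hz]; norm_num)]
    ring
  · rw [h₁.eq_left z hz, h₂.eq_left z hz, ← LFunction_mul_LFunction_eq _ _
      (by rw [sub_re, hz]; norm_num)]
    ring
  · rw [norm_mul]
    exact mul_le_mul (h₁.norm_right z hz) (h₂.norm_right z hz) (norm_nonneg _) hC₁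
  · rw [norm_mul, show C₁ * C₂ * (1 + |z.im|) ^ 2 =
      (C₁ * (1 + |z.im|)) * (C₂ * (1 + |z.im|)) by ring]
    exact mul_le_mul (h₁.norm_middle z hz) (h₂.norm_middle z hz) (norm_nonneg _) (by positivity)
  · rw [norm_mul, show C₁ * C₂ * (1 + |z.im|) ^ 4 =
      (C₁ * (1 + |z.im|) ^ 2) * (C₂ * (1 + |z.im|) ^ 2) by ring]
    exact mul_le_mul (h₁.norm_left z hz) (h₂.norm_left z hz) (norm_nonneg _) (by positivity)

end CharacterReflection

lemma continuous_LFunction_half_line (χ : DirichletCharacter ℂ N) :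
    Continuous fun t : ℝ => DirichletCharacter.LFunction χ (1 / 2 + t * I) := by
  refine continuous_iff_continuousAt.mpr fun t => ?_
  have hne : (1 / 2 + t * I : ℂ) ≠ 1 := fun h => by
    have := congrArg re h
    norm_num at this
  have h := (DirichletCharacter.differentiableAt_LFunction χ _ (Or.inl hne)).continuousAt
  exact ContinuousAt.comp (f := fun t : ℝ => (1 / 2 + t * I : ℂ)) h
    (Continuous.continuousAt (by fun_prop))

theorem integral_normSq_LFunction_mul_le {χ₁ : DirichletCharacter ℂ M}
    {χ₂ : DirichletCharacter ℂ N} (h₁ : χ₁.IsPrimitive) (h₂ : χ₂.IsPrimitive) :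
    ∃ K : ℝ, ∀ T V W : ℝ, 2 ≤ T → 0 ≤ V → 0 ≤ W → MeanSquareBound (convCoeff χ₁ χ₂) T V W →
      MeanSquareBound (convCoeff χ₁⁻¹ χ₂⁻¹) T V W →
      ∫ t in T..(2 * T), ‖DirichletCharacter.LFunction χ₁ (1 / 2 + t * I) *
        DirichletCharacter.LFunction χ₂ (1 / 2 + t * I)‖ ^ 2 ≤ K * T * (V + W) := by
  obtain ⟨G₁, Y₁, C₁, c₁, hG₁⟩ := exists_characterReflection h₁
  obtain ⟨G₂, Y₂, C₂, c₂, hG₂⟩ := exists_characterReflection h₂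
  have hdata := hG₁.reflectionData hG₂
  obtain ⟨K, hK⟩ := hdata.integral_normSq_le
  refine ⟨K, fun T V W hT hV hW hf hg => ?_⟩
  have h := hK T V W hT hV hW hf hg
  have hT0 : 0 < T := by linarith
  have hcont : Continuous fun t : ℝ => G₁ ((1 / 2 : ℝ) + t * I) * G₂ ((1 / 2 : ℝ) + t * I) :=
    hdata.differentiable.continuous.comp (by fun_prop)
  have hi1 : IntervalIntegrable (fun t : ℝ =>
      T ^ 4 * ‖DirichletCharacter.LFunction χ₁ (1 / 2 + t * I) *
        DirichletCharacter.LFunction χ₂ (1 / 2 + t * I)‖ ^ 2) volume T (2 * T) :=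
    (continuous_const.mul (((continuous_LFunction_half_line χ₁).mul
      (continuous_LFunction_half_line χ₂)).norm.pow 2)).intervalIntegrable _ _
  have hi2 : IntervalIntegrable (fun t : ℝ =>
      ‖G₁ ((1 / 2 : ℝ) + t * I) * G₂ ((1 / 2 : ℝ) + t * I)‖ ^ 2) volume T (2 * T) :=
    (hcont.norm.pow 2).intervalIntegrable _ _
  have hmono := intervalIntegral.integral_mono_on (by linarith) hi1 hi2 fun t ht => by
    have hne : ((1 / 2 : ℝ) + t * I : ℂ) ≠ 1 := fun h => by
      have := congrArg re h
      norm_num at this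
    have hnorm : T ≤ ‖((1 / 2 : ℝ) + t * I : ℂ) - 1‖ := by
      have := abs_im_le_norm (((1 / 2 : ℝ) + t * I : ℂ) - 1)
      simp at this
      have h2 := le_abs_self t
      have := ht.1
      simp
      linarith
    rw [hG₁.eq_of_ne _ hne, hG₂.eq_of_ne _ hne]
    simp only [norm_mul]
    push_cast at hnorm ⊢
    have := pow_le_pow_left₀ hT0.le hnorm 4
    calc _ ≤ ‖(1 / 2 + t * I : ℂ) - 1‖ ^ 4 * (‖DirichletCharacter.LFunction χ₁ (1 / 2 + t * I)‖ *
        ‖DirichletCharacter.LFunction χ₂ (1 / 2 + t * I)‖) ^ 2 := by gcongr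
      _ = _ := by ring
  rw [intervalIntegral.integral_const_mul] at hmono
  have hT4 : 0 < T ^ 4 := by positivity
  refine le_of_mul_le_mul_left (hmono.trans (h.trans (le_of_eq ?_))) hT4
  ring

end

section Convolution

lemma sum_convolution {R : Type*} [Semiring R] (f g : ℕ → R) (N : ℕ) :
    ∑ n ∈ Icc 1 N, ∑ p ∈ n.divisorsAntidiagonal, f p.1 * g p.2 =
      ∑ a ∈ Icc 1 N, f a * ∑ b ∈ Icc 1 (N / a), g b := by
  have h := ArithmeticFunction.sum_Ioc_mul_eq_sum_sum
    (toArithmeticFunction f) (toArithmeticFunction g) N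
  have hI : ∀ K : ℕ, Ioc 0 K = Icc 1 K := fun K => by ext; simp; omega
  have happ : ∀ (f : ℕ → R) (n : ℕ), toArithmeticFunction f n = if n = 0 then 0 else f n :=
    fun _ _ => rfl
  simp only [ArithmeticFunction.mul_apply, happ, hI] at h
  have e1 : ∀ (f : ℕ → R) (K : ℕ), ∑ b ∈ Icc 1 K, (if b = 0 then 0 else f b) = ∑ b ∈ Icc 1 K, f b :=
    fun f K => sum_congr rfl fun b hb => if_neg (by have := (mem_Icc.mp hb).1; omega)
  convert h using 1
  · refine sum_congr rfl fun n _ => sum_congr rfl fun p hp => ?_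
    have := Nat.ne_zero_of_mem_divisorsAntidiagonal hp
    rw [if_neg this.1, if_neg this.2]
  · refine sum_congr rfl fun n hn => ?_
    rw [e1, if_neg (by have := (mem_Icc.mp hn).1; omega)]

lemma sum_convolution_div (f g : ArithmeticFunction ℂ) (N : ℕ) :
    ∑ n ∈ Icc 1 N, (f * g) n / n =
      ∑ a ∈ Icc 1 N, f a / a * ∑ b ∈ Icc 1 (N / a), g b / b := by
  rw [← sum_convolution]
  refine sum_congr rfl fun n _ => ?_
  rw [ArithmeticFunction.mul_apply, sum_div]
  refine sum_congr rfl fun p hp => ?_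
  rw [← (Nat.mem_divisorsAntidiagonal.mp hp).1]
  push_cast
  rw [div_mul_div_comm]

/-- The sum `∑_{n ≤ N} |f(n)| / n`. -/
noncomputable def logSum (f : ArithmeticFunction ℂ) (N : ℕ) : ℝ := ∑ n ∈ Icc 1 N, ‖f n‖ / n

lemma logSum_nonneg (f : ArithmeticFunction ℂ) (N : ℕ) : 0 ≤ logSum f N :=
  sum_nonneg fun _ _ => by positivity

lemma logSum_mul_le (f g : ArithmeticFunction ℂ) (N : ℕ) :
    logSum (f * g) N ≤ logSum f N * logSum g N := by
  calc logSum (f * g) N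
      ≤ ∑ n ∈ Icc 1 N, ∑ p ∈ n.divisorsAntidiagonal, ‖f p.1‖ / p.1 * (‖g p.2‖ / p.2) := by
        refine sum_le_sum fun n _ => ?_
        rw [ArithmeticFunction.mul_apply]
        refine (div_le_div_of_nonneg_right (norm_sum_le _ _) (Nat.cast_nonneg n)).trans ?_
        rw [sum_div]
        refine sum_le_sum fun p hp => ?_
        rw [← (Nat.mem_divisorsAntidiagonal.mp hp).1, norm_mul, div_mul_div_comm]
        push_cast
        exact le_rfl
    _ = ∑ a ∈ Icc 1 N, ‖f a‖ / a * ∑ b ∈ Icc 1 (N / a), ‖g b‖ / b :=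
        sum_convolution (fun a => ‖f a‖ / a) (fun b => ‖g b‖ / b) N
    _ ≤ ∑ a ∈ Icc 1 N, ‖f a‖ / a * logSum g N := by
        refine sum_le_sum fun a _ => mul_le_mul_of_nonneg_left ?_ (by positivity)
        exact sum_le_sum_of_subset_of_nonneg (Icc_subset_Icc_right (Nat.div_le_self N a))
          fun _ _ _ => by positivity
    _ = logSum f N * logSum g N := (sum_mul _ _ _).symm

lemma sum_one_div_le (N : ℕ) : ∑ n ∈ Icc 1 N, 1 / (n : ℝ) ≤ 1 + Real.log N := by
  have := harmonic_le_one_add_log N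
  rw [harmonic_eq_sum_Icc] at this
  push_cast at this
  simpa [one_div] using this

lemma logSum_le_of_norm_le_one {f : ArithmeticFunction ℂ} (hf : ∀ n, ‖f n‖ ≤ 1) (N : ℕ) :
    logSum f N ≤ 1 + Real.log N := by
  refine (sum_le_sum fun n _ => ?_).trans (sum_one_div_le N)
  gcongr
  exact hf n

lemma card_divisors_sq_le (n : ℕ) :
    (#n.divisors : ℝ) ^ 2 ≤ ∑ p ∈ n.divisorsAntidiagonal, (#p.1.divisors : ℝ) * #p.2.divisors := by
  have h1 : ∑ p ∈ n.divisorsAntidiagonal, (#n.divisors : ℝ) = (#n.divisors : ℝ) ^ 2 := by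
    rw [sum_const, nsmul_eq_mul, ← Nat.map_div_right_divisors, card_map, sq]
  rw [← h1]
  refine sum_le_sum fun p hp => ?_
  rw [← (Nat.mem_divisorsAntidiagonal.mp hp).1, Nat.divisors_mul]
  exact_mod_cast Finset.card_mul_le

lemma one_le_one_add_log (N : ℕ) : 1 ≤ 1 + Real.log N := by
  have := Real.log_natCast_nonneg N
  linarith

lemma sum_card_divisors_div_le (N : ℕ) :
    ∑ n ∈ Icc 1 N, (#n.divisors : ℝ) / n ≤ (1 + Real.log N) ^ 2 := by
  have hH := one_le_one_add_log N
  have h := sum_convolution (fun n => 1 / (n : ℝ)) (fun n => 1 / (n : ℝ)) N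
  calc ∑ n ∈ Icc 1 N, (#n.divisors : ℝ) / n
      = ∑ n ∈ Icc 1 N, ∑ p ∈ n.divisorsAntidiagonal, 1 / (p.1 : ℝ) * (1 / (p.2 : ℝ)) := by
        refine sum_congr rfl fun n _ => ?_
        have : ∑ p ∈ n.divisorsAntidiagonal, 1 / (p.1 : ℝ) * (1 / (p.2 : ℝ)) =
            ∑ p ∈ n.divisorsAntidiagonal, 1 / (n : ℝ) := sum_congr rfl fun p hp => by
          rw [← (Nat.mem_divisorsAntidiagonal.mp hp).1]
          push_cast
          rw [div_mul_div_comm, one_mul]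
        rw [this, sum_const, nsmul_eq_mul, ← Nat.map_div_right_divisors, card_map, mul_one_div]
    _ = _ := h
    _ ≤ ∑ a ∈ Icc 1 N, 1 / (a : ℝ) * (1 + Real.log N) := by
        refine sum_le_sum fun a _ => mul_le_mul_of_nonneg_left ?_ (by positivity)
        refine (sum_le_sum_of_subset_of_nonneg (Icc_subset_Icc_right (Nat.div_le_self N a))
          fun _ _ _ => by positivity).trans (sum_one_div_le N)
    _ ≤ (1 + Real.log N) ^ 2 := by
        rw [← sum_mul, sq]
        exact mul_le_mul_of_nonneg_right (sum_one_div_le N) (by linarith)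

lemma sum_card_divisors_sq_div_le (N : ℕ) :
    ∑ n ∈ Icc 1 N, (#n.divisors : ℝ) ^ 2 / n ≤ (1 + Real.log N) ^ 4 := by
  have hH := one_le_one_add_log N
  have hd := sum_card_divisors_div_le N
  calc ∑ n ∈ Icc 1 N, (#n.divisors : ℝ) ^ 2 / n
      ≤ ∑ n ∈ Icc 1 N, ∑ p ∈ n.divisorsAntidiagonal,
          (#p.1.divisors : ℝ) / p.1 * ((#p.2.divisors : ℝ) / p.2) := by
        refine sum_le_sum fun n _ => ?_
        refine (div_le_div_of_nonneg_right (card_divisors_sq_le n) (Nat.cast_nonneg n)).trans_eq ?_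
        rw [sum_div]
        refine sum_congr rfl fun p hp => ?_
        rw [← (Nat.mem_divisorsAntidiagonal.mp hp).1]
        push_cast
        rw [div_mul_div_comm]
    _ = _ := sum_convolution (fun n => (#n.divisors : ℝ) / n) (fun n => (#n.divisors : ℝ) / n) N
    _ ≤ ∑ a ∈ Icc 1 N, (#a.divisors : ℝ) / a * (1 + Real.log N) ^ 2 := by
        refine sum_le_sum fun a _ => mul_le_mul_of_nonneg_left ?_ (by positivity)
        refine (sum_le_sum_of_subset_of_nonneg (Icc_subset_Icc_right (Nat.div_le_self N a))
          fun _ _ _ => by positivity).trans hd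
    _ ≤ (1 + Real.log N) ^ 4 := by
        rw [← sum_mul]
        exact (mul_le_mul_of_nonneg_right hd (by positivity)).trans_eq (by ring)

lemma sum_card_divisors_le (N : ℕ) :
    ∑ n ∈ Icc 1 N, (#n.divisors : ℝ) ≤ N * (1 + Real.log N) := by
  calc ∑ n ∈ Icc 1 N, (#n.divisors : ℝ)
      = ∑ n ∈ Icc 1 N, ∑ p ∈ n.divisorsAntidiagonal, (1 : ℝ) * 1 := by
        refine sum_congr rfl fun n _ => ?_
        rw [mul_one, sum_const, nsmul_one, ← Nat.map_div_right_divisors, card_map]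
    _ = _ := sum_convolution (fun _ => (1 : ℝ)) (fun _ => (1 : ℝ)) N
    _ ≤ ∑ a ∈ Icc 1 N, N * (1 / (a : ℝ)) := by
        refine sum_le_sum fun a _ => ?_
        rw [one_mul, sum_const, nsmul_one, Nat.card_Icc, Nat.add_sub_cancel, mul_one_div]
        exact Nat.cast_div_le
    _ ≤ N * (1 + Real.log N) := by
        rw [← mul_sum]
        exact mul_le_mul_of_nonneg_left (sum_one_div_le N) (Nat.cast_nonneg N)

lemma sum_card_divisors_sq_le (N : ℕ) :
    ∑ n ∈ Icc 1 N, (#n.divisors : ℝ) ^ 2 ≤ N * (1 + Real.log N) ^ 3 := by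
  have hH := one_le_one_add_log N
  calc ∑ n ∈ Icc 1 N, (#n.divisors : ℝ) ^ 2
      ≤ ∑ n ∈ Icc 1 N, ∑ p ∈ n.divisorsAntidiagonal, (#p.1.divisors : ℝ) * #p.2.divisors :=
        sum_le_sum fun n _ => card_divisors_sq_le n
    _ = _ := sum_convolution (fun n => (#n.divisors : ℝ)) (fun n => (#n.divisors : ℝ)) N
    _ ≤ ∑ a ∈ Icc 1 N, N * (1 + Real.log N) * ((#a.divisors : ℝ) / a) := by
        refine sum_le_sum fun a ha => ?_
        have ha1 := (mem_Icc.mp ha)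
        have h1 : (1 + Real.log ((N / a : ℕ) : ℝ)) ≤ 1 + Real.log N := by
          have h2 : 1 ≤ N / a := (Nat.one_le_div_iff (by omega)).mpr ha1.2
          have h3 := Nat.div_le_self N a
          gcongr
        have h4 : ((N / a : ℕ) : ℝ) ≤ N / a := Nat.cast_div_le
        calc (#a.divisors : ℝ) * ∑ b ∈ Icc 1 (N / a), (#b.divisors : ℝ)
            ≤ #a.divisors * ((N / a) * (1 + Real.log N)) := by
              refine mul_le_mul_of_nonneg_left ((sum_card_divisors_le _).trans ?_) (by positivity)
              exact mul_le_mul h4 h1 (by linarith [one_le_one_add_log (N / a)]) (by positivity)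
          _ = _ := by ring
    _ ≤ N * (1 + Real.log N) ^ 3 := by
        rw [← mul_sum]
        exact (mul_le_mul_of_nonneg_left (sum_card_divisors_div_le N) (by positivity)).trans_eq
          (by ring)

lemma exists_sum_card_divisors_sq_tail_le : ∃ A : ℝ, 0 ≤ A ∧ ∀ N M : ℕ, 1 ≤ N →
    ∑ n ∈ Ioc N M, (#n.divisors : ℝ) ^ 2 / (n : ℝ) ^ 2 ≤ A * (1 + Real.log N) ^ 3 / N := by
  have hs : Summable fun j : ℕ => ((j : ℝ) + 2) ^ 3 * (1 / 2 : ℝ) ^ j := by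
    have h := fun k : ℕ => summable_pow_mul_geometric_of_norm_lt_one (R := ℝ) k (r := 1 / 2)
      (by norm_num)
    refine ((((h 3).add ((h 2).mul_left 6)).add ((h 1).mul_left 12)).add ((h 0).mul_left 8)).congr
      fun j => ?_
    ring
  refine ⟨2 * ∑' j : ℕ, ((j : ℝ) + 2) ^ 3 * (1 / 2 : ℝ) ^ j, by positivity, fun N M hN => ?_⟩
  have hN0 : (0 : ℝ) < N := by exact_mod_cast hN
  have hH := one_le_one_add_log N
  have key : ∀ J : ℕ, ∑ n ∈ Ioc N (2 ^ J * N), (#n.divisors : ℝ) ^ 2 / (n : ℝ) ^ 2 ≤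
      (2 * ∑ j ∈ range J, ((j : ℝ) + 2) ^ 3 * (1 / 2 : ℝ) ^ j) * (1 + Real.log N) ^ 3 / N := by
    intro J
    induction J with
    | zero => simp
    | succ J ih =>
      have h1 : N ≤ 2 ^ J * N := Nat.le_mul_of_pos_left _ (by positivity)
      have h2 : 2 ^ J * N ≤ 2 ^ (J + 1) * N :=
        Nat.mul_le_mul_right _ (Nat.pow_le_pow_right (by norm_num) (by omega))
      rw [← sum_Ioc_consecutive _ h1 h2, sum_range_succ]
      have hlog : 1 + Real.log ((2 ^ (J + 1) * N : ℕ) : ℝ) ≤ ((J : ℝ) + 2) * (1 + Real.log N) := by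
        push_cast
        rw [Real.log_mul (by positivity) hN0.ne', Real.log_pow]
        have := Real.log_two_lt_d9
        have hl := Real.log_natCast_nonneg N
        push_cast
        nlinarith [mul_nonneg (Nat.cast_nonneg (α := ℝ) J) hl]
      have hblock : ∑ n ∈ Ioc (2 ^ J * N) (2 ^ (J + 1) * N), (#n.divisors : ℝ) ^ 2 / (n : ℝ) ^ 2 ≤
          2 * (((J : ℝ) + 2) ^ 3 * (1 / 2 : ℝ) ^ J) * (1 + Real.log N) ^ 3 / N := by
        calc ∑ n ∈ Ioc (2 ^ J * N) (2 ^ (J + 1) * N), (#n.divisors : ℝ) ^ 2 / (n : ℝ) ^ 2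
            ≤ ∑ n ∈ Ioc (2 ^ J * N) (2 ^ (J + 1) * N),
                (#n.divisors : ℝ) ^ 2 / (2 ^ J * N : ℝ) ^ 2 := by
              refine sum_le_sum fun n hn => ?_
              have : ((2 ^ J * N : ℕ) : ℝ) ≤ n := by exact_mod_cast (mem_Ioc.mp hn).1.le
              push_cast at this
              gcongr
          _ = (∑ n ∈ Ioc (2 ^ J * N) (2 ^ (J + 1) * N), (#n.divisors : ℝ) ^ 2) /
              (2 ^ J * N : ℝ) ^ 2 :=
              (sum_div _ _ _).symm
          _ ≤ (2 ^ (J + 1) * N) * (((J : ℝ) + 2) * (1 + Real.log N)) ^ 3 / (2 ^ J * N : ℝ) ^ 2 := by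
              gcongr
              have h3 : Ioc (2 ^ J * N) (2 ^ (J + 1) * N) ⊆ Icc 1 (2 ^ (J + 1) * N) :=
                fun n hn => by
                rw [mem_Ioc] at hn
                exact mem_Icc.mpr ⟨by omega, hn.2⟩
              refine (sum_le_sum_of_subset_of_nonneg h3 fun _ _ _ => by positivity).trans
                ((sum_card_divisors_sq_le _).trans ?_)
              have h5 := one_le_one_add_log (2 ^ (J + 1) * N)
              push_cast at h5 hlog ⊢
              gcongr
          _ = _ := by
              rw [one_div, inv_pow, pow_succ]
              field_simp
      calc _ ≤ _ := add_le_add ih hblock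
        _ = _ := by ring
  have hM : M ≤ 2 ^ M * N := (Nat.lt_two_pow_self).le.trans (Nat.le_mul_of_pos_right _ hN)
  refine (sum_le_sum_of_subset_of_nonneg (Ioc_subset_Ioc_right hM) fun _ _ _ => by positivity).trans
    ((key M).trans ?_)
  gcongr
  exact hs.sum_le_tsum _ fun _ _ => by positivity

end Convolution

/-- Mean-square bounds for a function dominated by the divisor function. -/
lemma exists_meanSquareBound : ∃ A : ℝ, 0 ≤ A ∧ ∀ (f : ℕ → ℂ) (T W : ℝ), 2 ≤ T →
    (∀ n, ‖f n‖ ≤ #n.divisors) → ∑ n ∈ Icc 1 ⌊T⌋₊, ‖f n‖ ^ 2 / n ≤ W →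
    MeanSquareBound f T (A * (1 + Real.log T) ^ 3) W := by
  obtain ⟨A, hA, hA'⟩ := exists_sum_card_divisors_sq_tail_le
  refine ⟨1 + 2 * A, by positivity, fun f T W hT hf hW => ⟨?_, hW, fun M => ?_⟩⟩
  all_goals
    have hN1 : 1 ≤ ⌊T⌋₊ := Nat.le_floor (by push_cast; linarith)
    have hNT : (⌊T⌋₊ : ℝ) ≤ T := Nat.floor_le (by linarith)
    have hN0 : (0 : ℝ) < ⌊T⌋₊ := by exact_mod_cast hN1
    have hlog : 1 + Real.log ⌊T⌋₊ ≤ 1 + Real.log T := by gcongr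
    have hH := one_le_one_add_log ⌊T⌋₊
  · calc ∑ n ∈ Icc 1 ⌊T⌋₊, ‖f n‖ ^ 2 ≤ ∑ n ∈ Icc 1 ⌊T⌋₊, (#n.divisors : ℝ) ^ 2 :=
          sum_le_sum fun n _ => by have := hf n; gcongr
      _ ≤ ⌊T⌋₊ * (1 + Real.log ⌊T⌋₊) ^ 3 := sum_card_divisors_sq_le _
      _ ≤ T * (1 * (1 + Real.log T) ^ 3) := by rw [one_mul]; gcongr
      _ ≤ _ := by
          have : 0 ≤ 1 + Real.log T := by linarith
          gcongr T * (?_ * _)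
          linarith
  · calc ∑ n ∈ Ioc ⌊T⌋₊ M, ‖f n‖ ^ 2 / (n : ℝ) ^ 2
        ≤ ∑ n ∈ Ioc ⌊T⌋₊ M, (#n.divisors : ℝ) ^ 2 / (n : ℝ) ^ 2 :=
          sum_le_sum fun n _ => by have := hf n; gcongr
      _ ≤ A * (1 + Real.log ⌊T⌋₊) ^ 3 / ⌊T⌋₊ := hA' _ _ hN1
      _ ≤ A * (1 + Real.log T) ^ 3 / (T / 2) := by
          have : T / 2 ≤ ⌊T⌋₊ := by
            have := Nat.lt_floor_add_one T
            have : (1 : ℝ) ≤ ⌊T⌋₊ := by exact_mod_cast hN1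
            linarith
          have h0 : 0 ≤ 1 + Real.log T := by linarith
          have : 0 ≤ A * (1 + Real.log T) ^ 3 := by positivity
          gcongr
      _ = 2 * A * (1 + Real.log T) ^ 3 / T := by field_simp
      _ ≤ _ := by
          have : 0 ≤ 1 + Real.log T := by linarith
          gcongr ?_ * _ / _
          linarith

section Ramanujan

open scoped ComplexConjugate

/-- The factorizations `n = (g x) (y v)`. -/
def quadFactor (n : ℕ) : Finset ((_ : ℕ × ℕ) × ((ℕ × ℕ) × (ℕ × ℕ))) :=
  n.divisorsAntidiagonal.sigma fun p => p.1.divisorsAntidiagonal ×ˢ p.2.divisorsAntidiagonal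

lemma mem_quadFactor {n p₁ p₂ g x y v : ℕ} :
    (⟨(p₁, p₂), ((g, x), (y, v))⟩ : (_ : ℕ × ℕ) × ((ℕ × ℕ) × (ℕ × ℕ))) ∈ quadFactor n ↔
      p₁ = g * x ∧ p₂ = y * v ∧ g * x * (y * v) = n ∧ n ≠ 0 := by
  simp only [quadFactor, mem_sigma, mem_product, Nat.mem_divisorsAntidiagonal]
  constructor
  · rintro ⟨⟨h1, h2⟩, ⟨h3, h4⟩, h5, h6⟩
    exact ⟨h3.symm, h5.symm, by rw [h3, h5, h1], h2⟩
  · rintro ⟨rfl, rfl, h3, h4⟩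
    refine ⟨⟨h3, h4⟩, ⟨rfl, ?_⟩, rfl, ?_⟩ <;> rintro h <;> simp [h] at h3 <;> exact h4 h3.symm

/-- The weight attached to a factorization in `quadFactor n`. -/
noncomputable def quadWeight (a b : ℕ → ℂ) (z : (_ : ℕ × ℕ) × ((ℕ × ℕ) × (ℕ × ℕ))) : ℂ :=
  (a z.2.1.1 * conj (a z.2.1.1)) * (a z.2.1.2 * conj (b z.2.1.2)) *
    ((conj (a z.2.2.1) * b z.2.2.1) * (b z.2.2.2 * conj (b z.2.2.2)))

lemma exists_quad_of_mul_eq_mul {c d c' d' : ℕ} (h : c * d = c' * d') (hc : c ≠ 0) (hc' : c' ≠ 0) :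
    ∃ g x y v, g ≠ 0 ∧ Nat.Coprime x y ∧ c = g * x ∧ c' = g * y ∧ d = y * v ∧ d' = x * v := by
  obtain ⟨g, x, y, hg, hxy, rfl, rfl⟩ := Nat.exists_coprime' (m := c) (n := c')
    (Nat.gcd_pos_of_pos_left _ (Nat.pos_of_ne_zero hc))
  have hy : y ≠ 0 := by rintro rfl; simp at hc'
  have h1 : x * d = y * d' := by
    have : g * (x * d) = g * (y * d') := by linarith
    exact Nat.eq_of_mul_eq_mul_left hg this
  obtain ⟨v, rfl⟩ : y ∣ d := (Nat.Coprime.symm hxy).dvd_of_dvd_mul_left ⟨d', h1⟩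
  refine ⟨g, x, y, v, hg.ne', hxy, mul_comm _ _, mul_comm _ _, rfl, ?_⟩
  have : y * d' = y * (x * v) := by rw [← h1]; ring
  exact Nat.eq_of_mul_eq_mul_left (Nat.pos_of_ne_zero hy) this

lemma sum_quadWeight_gcd_eq {a b : ℕ → ℂ} (ha : ∀ m n, a (m * n) = a m * a n)
    (hb : ∀ m n, b (m * n) = b m * b n) (k m : ℕ) (hk : k ≠ 0) :
    ∑ z ∈ quadFactor (k ^ 2 * m) with Nat.gcd z.2.1.2 z.2.2.1 = k, quadWeight a b z =
      (‖a k‖ ^ 2 * ‖b k‖ ^ 2 * ‖∑ p ∈ m.divisorsAntidiagonal, a p.1 * b p.2‖ ^ 2 : ℝ) := by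
  have hR : ((‖a k‖ ^ 2 * ‖b k‖ ^ 2 * ‖∑ p ∈ m.divisorsAntidiagonal, a p.1 * b p.2‖ ^ 2 : ℝ) : ℂ) =
      ∑ w ∈ m.divisorsAntidiagonal ×ˢ m.divisorsAntidiagonal,
        (a k * conj (a k)) * (b k * conj (b k)) *
          ((a w.1.1 * b w.1.2) * conj (a w.2.1 * b w.2.2)) := by
    push_cast
    rw [← mul_sum, sum_product]
    dsimp only
    rw [← sum_mul_sum, ← map_sum, Complex.mul_conj', Complex.mul_conj',
      Complex.mul_conj']
  rw [hR]
  refine sum_bij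
    (fun z _ => ((z.2.1.1 * (z.2.1.2 / k), z.2.2.1 / k * z.2.2.2),
      (z.2.1.1 * (z.2.2.1 / k), z.2.1.2 / k * z.2.2.2))) ?_ ?_ ?_ ?_
  · rintro ⟨⟨p₁, p₂⟩, ⟨⟨g, x⟩, ⟨y, v⟩⟩⟩ hz
    obtain ⟨hz, hgcd⟩ := mem_filter.mp hz
    obtain ⟨rfl, rfl, hn, hn0⟩ := mem_quadFactor.mp hz
    dsimp only at hgcd ⊢
    obtain ⟨x, rfl⟩ : k ∣ x := hgcd ▸ Nat.gcd_dvd_left _ _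
    obtain ⟨y, rfl⟩ : k ∣ y := hgcd ▸ Nat.gcd_dvd_right _ _
    have hkp := Nat.pos_of_ne_zero hk
    rw [Nat.mul_div_cancel_left _ hkp, Nat.mul_div_cancel_left _ hkp]
    have hm : g * x * (y * v) = m := by
      have : k ^ 2 * (g * x * (y * v)) = k ^ 2 * m := by rw [← hn]; ring
      exact Nat.eq_of_mul_eq_mul_left (by positivity) this
    have hm0 : m ≠ 0 := by rintro rfl; simp at hn0
    simp only [mem_product, Nat.mem_divisorsAntidiagonal]
    exact ⟨⟨hm, hm0⟩, by rw [← hm]; ring, hm0⟩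
  · rintro ⟨⟨p₁, p₂⟩, ⟨⟨g, x⟩, ⟨y, v⟩⟩⟩ hz ⟨⟨p₃, p₄⟩, ⟨⟨g', x'⟩, ⟨y', v'⟩⟩⟩ hz' h
    obtain ⟨hz, hgcd⟩ := mem_filter.mp hz
    obtain ⟨rfl, rfl, hn, hn0⟩ := mem_quadFactor.mp hz
    obtain ⟨hz', hgcd'⟩ := mem_filter.mp hz'
    obtain ⟨rfl, rfl, hn', hn0'⟩ := mem_quadFactor.mp hz'
    dsimp only at hgcd hgcd' h
    obtain ⟨x, rfl⟩ : k ∣ x := hgcd ▸ Nat.gcd_dvd_left _ _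
    obtain ⟨y, rfl⟩ : k ∣ y := hgcd ▸ Nat.gcd_dvd_right _ _
    obtain ⟨x', rfl⟩ : k ∣ x' := hgcd' ▸ Nat.gcd_dvd_left _ _
    obtain ⟨y', rfl⟩ : k ∣ y' := hgcd' ▸ Nat.gcd_dvd_right _ _
    have hkp := Nat.pos_of_ne_zero hk
    simp only [Nat.mul_div_cancel_left _ hkp, Prod.mk.injEq] at h
    rw [Nat.gcd_mul_left, Nat.mul_eq_left hk] at hgcd hgcd'
    obtain ⟨⟨h1, h2⟩, h3, -⟩ := h
    have hg : g = g' := by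
      have := congrArg₂ Nat.gcd h1 h3
      rwa [Nat.gcd_mul_left, Nat.gcd_mul_left, hgcd, hgcd', mul_one, mul_one] at this
    subst hg
    have hne : g * (k * x) * (k * y * v) ≠ 0 := hn ▸ hn0
    simp only [mul_ne_zero_iff] at hne
    obtain rfl := Nat.eq_of_mul_eq_mul_left (Nat.pos_of_ne_zero hne.1.1) h1
    obtain rfl := Nat.eq_of_mul_eq_mul_left (Nat.pos_of_ne_zero hne.1.1) h3
    obtain rfl := Nat.eq_of_mul_eq_mul_left (Nat.pos_of_ne_zero hne.2.1.2) h2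
    rfl
  · rintro ⟨⟨c, d⟩, ⟨c', d'⟩⟩ hw
    simp only [mem_product, Nat.mem_divisorsAntidiagonal] at hw
    obtain ⟨⟨hcd, hm⟩, hcd', -⟩ := hw
    obtain ⟨g, x, y, v, hg, hxy, rfl, rfl, rfl, rfl⟩ := exists_quad_of_mul_eq_mul
      (hcd.trans hcd'.symm) (by rintro rfl; simp at hcd; exact hm hcd.symm)
      (by rintro rfl; simp at hcd'; exact hm hcd'.symm)
    have hkp := Nat.pos_of_ne_zero hk
    refine ⟨⟨(g * (k * x), k * y * v), ((g, k * x), (k * y, v))⟩,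
      mem_filter.mpr ⟨mem_quadFactor.mpr ⟨rfl, rfl, ?_, ?_⟩, ?_⟩, ?_⟩
    · rw [← hcd]; ring
    · positivity
    · simp [Nat.gcd_mul_left, Nat.Coprime.gcd_eq_one hxy]
    · simp only [Nat.mul_div_cancel_left _ hkp]
  · rintro ⟨⟨p₁, p₂⟩, ⟨⟨g, x⟩, ⟨y, v⟩⟩⟩ hz
    obtain ⟨hz, hgcd⟩ := mem_filter.mp hz
    dsimp only at hgcd ⊢
    obtain ⟨x, rfl⟩ : k ∣ x := hgcd ▸ Nat.gcd_dvd_left _ _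
    obtain ⟨y, rfl⟩ : k ∣ y := hgcd ▸ Nat.gcd_dvd_right _ _
    have hkp := Nat.pos_of_ne_zero hk
    simp only [Nat.mul_div_cancel_left _ hkp, quadWeight, ha, hb, map_mul]
    ring

/-- The inequality `|(a ⋆ b)(n)|² ≤ (|a|² ⋆ a b̄ ⋆ ā b ⋆ |b|²)(n)`. -/
lemma normSq_le_sum_quadWeight {a b : ℕ → ℂ} (ha : ∀ m n, a (m * n) = a m * a n)
    (hb : ∀ m n, b (m * n) = b m * b n) (ha1 : a 1 = 1) (hb1 : b 1 = 1) (n : ℕ) :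
    ‖∑ p ∈ n.divisorsAntidiagonal, a p.1 * b p.2‖ ^ 2 ≤
      (∑ z ∈ quadFactor n, quadWeight a b z).re := by
  have hmaps : ∀ z ∈ quadFactor n, Nat.gcd z.2.1.2 z.2.2.1 ∈ Icc 1 n := by
    rintro ⟨⟨p₁, p₂⟩, ⟨⟨g, x⟩, ⟨y, v⟩⟩⟩ hz
    obtain ⟨rfl, rfl, hn, hn0⟩ := mem_quadFactor.mp hz
    have hdvd : Nat.gcd x y ∣ n :=
      hn ▸ Dvd.dvd.mul_right ((Nat.gcd_dvd_left x y).mul_left g) _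
    exact mem_Icc.mpr ⟨Nat.pos_of_dvd_of_pos hdvd (Nat.pos_of_ne_zero hn0),
      Nat.le_of_dvd (Nat.pos_of_ne_zero hn0) hdvd⟩
  rw [← sum_fiberwise_of_maps_to hmaps, Complex.re_sum]
  rcases eq_or_ne n 0 with rfl | hn
  · simp
  have hone := sum_quadWeight_gcd_eq ha hb 1 n one_ne_zero
  rw [one_pow, one_mul, ha1, hb1, norm_one, one_pow, one_mul, one_mul] at hone
  have hnonneg : ∀ k ∈ Icc 1 n,
      0 ≤ (∑ z ∈ quadFactor n with Nat.gcd z.2.1.2 z.2.2.1 = k, quadWeight a b z).re := by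
    intro k hk
    by_cases hkn : k ^ 2 ∣ n
    · obtain ⟨m, rfl⟩ := hkn
      rw [sum_quadWeight_gcd_eq ha hb k m (by rintro rfl; simp at hk), Complex.ofReal_re]
      positivity
    · have : (quadFactor n).filter (fun z => Nat.gcd z.2.1.2 z.2.2.1 = k) = ∅ := by
        refine filter_eq_empty_iff.mpr ?_
        rintro ⟨⟨p₁, p₂⟩, ⟨⟨g, x⟩, ⟨y, v⟩⟩⟩ hz hgcd
        obtain ⟨rfl, rfl, hn, hn0⟩ := mem_quadFactor.mp hz
        refine hkn (hn ▸ ?_)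
        have h1 : k ∣ x := hgcd ▸ Nat.gcd_dvd_left _ _
        have h2 : k ∣ y := hgcd ▸ Nat.gcd_dvd_right _ _
        rw [sq]
        exact mul_dvd_mul (h1.mul_left g) (h2.mul_right v)
      rw [this, sum_empty, Complex.zero_re]
  have hle := single_le_sum hnonneg (mem_Icc.mpr ⟨le_rfl, Nat.pos_of_ne_zero hn⟩)
  rwa [hone, Complex.ofReal_re] at hle

end Ramanujan

section BoundedSums

lemma exists_norm_sum_div_le {P : ℕ → ℂ} {B : ℝ} (hP : ∀ N, ‖∑ n ∈ range N, P n‖ ≤ B) :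
    ∃ C, ∀ N, ‖∑ n ∈ Icc 1 N, P n / n‖ ≤ C := by
  have hanti : Antitone fun n : ℕ => 1 / ((n : ℝ) + 1) := fun m n h => by dsimp only; gcongr
  have hP' : ∀ N, ‖∑ n ∈ range N, P (n + 1)‖ ≤ B + B := fun N => by
    have h := sum_range_succ' P N
    have h0 := hP 1
    rw [sum_range_one] at h0
    rw [← sub_eq_iff_eq_add] at h
    rw [← h]
    exact (norm_sub_le _ _).trans (add_le_add (hP _) h0)
  have hc := hanti.cauchySeq_series_mul_of_tendsto_zero_of_bounded
    tendsto_one_div_add_atTop_nhds_zero_nat hP'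
  obtain ⟨R, -, hR⟩ := cauchySeq_bdd hc
  refine ⟨R, fun N => ?_⟩
  have h := (hR N 0).le
  rw [range_zero, sum_empty, dist_zero_right] at h
  refine le_of_eq_of_le (congrArg norm ?_) h
  rw [← Ico_add_one_right_eq_Icc, sum_Ico_eq_sum_range, Nat.add_sub_cancel]
  refine sum_congr rfl fun n _ => ?_
  rw [add_comm 1 n, Complex.real_smul]
  push_cast
  ring

variable {Q : ℕ} [NeZero Q]

lemma exists_norm_sum_char_div_le (ψ : DirichletCharacter ℂ Q) (hψ : ψ ≠ 1) :
    ∃ C, ∀ N, ‖∑ n ∈ Icc 1 N, ψ (n : ℕ) / (n : ℂ)‖ ≤ C := by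
  have hQ : 0 < Q := Nat.pos_of_neZero Q
  refine exists_norm_sum_div_le (P := fun n => ψ n) (B := Q) fun N => ?_
  induction N using Nat.strong_induction_on with
  | _ N ih =>
    rcases lt_or_ge N Q with h | h
    · refine (norm_sum_le_of_le _ fun n _ => DirichletCharacter.norm_le_one ψ _).trans ?_
      simpa using h.le
    · obtain ⟨K, rfl⟩ := Nat.exists_eq_add_of_le h
      rw [sum_range_add]
      have h1 : ∑ x ∈ range Q, ψ (x : ZMod Q) = 0 := by
        rw [← MulChar.sum_eq_zero_of_ne_one hψ]
        refine sum_nbij' (fun n => (n : ZMod Q)) ZMod.val (by simp) ?_ ?_ (by simp) (by simp)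
        · intro x _
          simpa using ZMod.val_lt x
        · intro n hn
          exact ZMod.val_cast_of_lt (mem_range.mp hn)
      rw [h1, zero_add]
      simpa using ih K (by omega)

end BoundedSums

section OffDiagonal

open scoped ComplexConjugate

lemma toArithmeticFunction_apply_of_ne_zero {R : Type*} [Zero R] (f : ℕ → R) {n : ℕ} (hn : n ≠ 0) :
    toArithmeticFunction f n = f n := if_neg hn

lemma norm_toArithmeticFunction_le {f : ℕ → ℂ} (hf : ∀ n, ‖f n‖ ≤ 1) (n : ℕ) :
    ‖toArithmeticFunction f n‖ ≤ 1 := by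
  rcases eq_or_ne n 0 with rfl | hn
  · simp
  · rw [toArithmeticFunction_apply_of_ne_zero f hn]
    exact hf n

lemma mul_mul_mul_apply (f₁ f₂ f₃ f₄ : ℕ → ℂ) (n : ℕ) :
    (toArithmeticFunction f₁ * toArithmeticFunction f₂ *
      (toArithmeticFunction f₃ * toArithmeticFunction f₄)) n =
      ∑ z ∈ quadFactor n, f₁ z.2.1.1 * f₂ z.2.1.2 * (f₃ z.2.2.1 * f₄ z.2.2.2) := by
  rw [ArithmeticFunction.mul_apply, quadFactor, sum_sigma]
  refine sum_congr rfl fun p _ => ?_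
  rw [ArithmeticFunction.mul_apply, ArithmeticFunction.mul_apply, sum_mul_sum, sum_product]
  refine sum_congr rfl fun u hu => sum_congr rfl fun w hw => ?_
  have hu' := Nat.ne_zero_of_mem_divisorsAntidiagonal hu
  have hw' := Nat.ne_zero_of_mem_divisorsAntidiagonal hw
  rw [toArithmeticFunction_apply_of_ne_zero _ hu'.1, toArithmeticFunction_apply_of_ne_zero _ hu'.2,
    toArithmeticFunction_apply_of_ne_zero _ hw'.1, toArithmeticFunction_apply_of_ne_zero _ hw'.2]

lemma sum_normSq_convolution_div_le {a b : ℕ → ℂ} {C : ℝ} (ha : ∀ m n, a (m * n) = a m * a n)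
    (hb : ∀ m n, b (m * n) = b m * b n) (ha1 : a 1 = 1) (hb1 : b 1 = 1) (hna : ∀ n, ‖a n‖ ≤ 1)
    (hnb : ∀ n, ‖b n‖ ≤ 1) (hC : ∀ N, ‖∑ n ∈ Icc 1 N, a n * conj (b n) / n‖ ≤ C) (N : ℕ) :
    ∑ n ∈ Icc 1 N, ‖∑ p ∈ n.divisorsAntidiagonal, a p.1 * b p.2‖ ^ 2 / n ≤
      C * (1 + Real.log N) ^ 3 := by
  have hprod : ∀ {f g : ℕ → ℂ}, (∀ n, ‖f n‖ ≤ 1) → (∀ n, ‖g n‖ ≤ 1) →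
      ∀ n, ‖toArithmeticFunction (fun n => f n * g n) n‖ ≤ 1 := fun hf hg =>
    norm_toArithmeticFunction_le fun n => by
      rw [norm_mul]
      exact mul_le_one₀ (hf n) (norm_nonneg _) (hg n)
  have hna' : ∀ n, ‖conj (a n)‖ ≤ 1 := fun n => by rw [RCLike.norm_conj]; exact hna n
  have hnb' : ∀ n, ‖conj (b n)‖ ≤ 1 := fun n => by rw [RCLike.norm_conj]; exact hnb n
  set A := toArithmeticFunction fun n => a n * conj (a n) with hA
  set P := toArithmeticFunction fun n => a n * conj (b n) with hP
  set R := toArithmeticFunction fun n => conj (a n) * b n with hR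
  set B := toArithmeticFunction fun n => b n * conj (b n) with hB
  have hH := one_le_one_add_log N
  have hC0 : 0 ≤ C := (norm_nonneg _).trans (hC 0)
  have hlog : logSum (A * (R * B)) N ≤ (1 + Real.log N) ^ 3 := by
    refine (logSum_mul_le _ _ _).trans ?_
    rw [pow_succ', pow_two]
    have hA' := logSum_le_of_norm_le_one (hprod hna hna') N
    have hR' := logSum_le_of_norm_le_one (hprod hna' hnb) N
    have hB' := logSum_le_of_norm_le_one (hprod hnb hnb') N
    refine mul_le_mul hA' ((logSum_mul_le _ _ _).trans ?_) (logSum_nonneg _ _) (by linarith)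
    exact mul_le_mul hR' hB' (logSum_nonneg _ _) (by linarith)
  calc ∑ n ∈ Icc 1 N, ‖∑ p ∈ n.divisorsAntidiagonal, a p.1 * b p.2‖ ^ 2 / n
      ≤ ∑ n ∈ Icc 1 N, ((A * P * (R * B)) n / n).re := by
        refine sum_le_sum fun n _ => ?_
        rw [mul_mul_mul_apply, Complex.div_natCast_re]
        exact div_le_div_of_nonneg_right (normSq_le_sum_quadWeight ha hb ha1 hb1 n)
          (Nat.cast_nonneg n)
    _ = (∑ n ∈ Icc 1 N, (A * (R * B) * P) n / n).re := by
        rw [Complex.re_sum, mul_right_comm]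
    _ ≤ ‖∑ n ∈ Icc 1 N, (A * (R * B) * P) n / n‖ := Complex.re_le_norm _
    _ ≤ ∑ n ∈ Icc 1 N, ‖(A * (R * B)) n‖ / n * C := by
        rw [sum_convolution_div]
        refine norm_sum_le_of_le _ fun n _ => ?_
        rw [norm_mul, norm_div, Complex.norm_natCast]
        refine mul_le_mul_of_nonneg_left ?_ (by positivity)
        refine le_of_eq_of_le (congrArg norm (sum_congr rfl fun k hk => ?_)) (hC (N / n))
        rw [hP, toArithmeticFunction_apply_of_ne_zero _ (by have := (mem_Icc.mp hk).1; omega)]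
    _ = C * logSum (A * (R * B)) N := by rw [← sum_mul, mul_comm, logSum]
    _ ≤ _ := by gcongr

end OffDiagonal

section Characters

open scoped ComplexConjugate

variable {M N : ℕ}

lemma convCoeff_apply (χ₁ : DirichletCharacter ℂ M) (χ₂ : DirichletCharacter ℂ N) (n : ℕ) :
    convCoeff χ₁ χ₂ n = ∑ p ∈ n.divisorsAntidiagonal, χ₁ (p.1 : ℕ) * χ₂ (p.2 : ℕ) := by
  rw [convCoeff, LSeries.convolution_def]

lemma norm_convCoeff_le (χ₁ : DirichletCharacter ℂ M) (χ₂ : DirichletCharacter ℂ N) (n : ℕ) :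
    ‖convCoeff χ₁ χ₂ n‖ ≤ #n.divisors := by
  rw [convCoeff_apply, ← Nat.map_div_right_divisors, sum_map]
  refine (norm_sum_le_of_le _ fun d _ => ?_).trans_eq (by rw [sum_const, nsmul_one])
  rw [norm_mul]
  exact mul_le_one₀ (χ₁.norm_le_one _) (norm_nonneg _) (χ₂.norm_le_one _)

variable [NeZero M] [NeZero N]

lemma norm_convCoeff_inv (χ₁ : DirichletCharacter ℂ M) (χ₂ : DirichletCharacter ℂ N) (n : ℕ) :
    ‖convCoeff χ₁⁻¹ χ₂⁻¹ n‖ = ‖convCoeff χ₁ χ₂ n‖ := by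
  have h : ∀ {K : ℕ} [NeZero K] (χ : DirichletCharacter ℂ K) (x : ZMod K), χ⁻¹ x = conj (χ x) :=
    fun χ x => by rw [← MulChar.star_apply', starRingEnd_apply]
  rw [convCoeff_apply, convCoeff_apply, ← RCLike.norm_conj (∑ p ∈ n.divisorsAntidiagonal, _),
    map_sum]
  simp_rw [h, map_mul, Complex.conj_conj]

lemma MeanSquareBound.convCoeff_inv {χ₁ : DirichletCharacter ℂ M} {χ₂ : DirichletCharacter ℂ N}
    {T V W : ℝ} (h : MeanSquareBound (convCoeff χ₁ χ₂) T V W) :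
    MeanSquareBound (convCoeff χ₁⁻¹ χ₂⁻¹) T V W := by
  obtain ⟨h1, h2, h3⟩ := h
  refine ⟨?_, ?_, ?_⟩ <;> simpa only [norm_convCoeff_inv]

lemma one_add_log_floor_le {T : ℝ} (hT : 2 ≤ T) : 1 + Real.log ⌊T⌋₊ ≤ 1 + Real.log T := by
  have h1 : (⌊T⌋₊ : ℝ) ≤ T := Nat.floor_le (by linarith)
  have h2 : 0 < ⌊T⌋₊ := Nat.floor_pos.mpr (by linarith)
  gcongr

/-- The mean square of `L(1/2 + it, χ₁) L(1/2 + it, χ₂)`. -/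
lemma exists_integral_normSq_mul_le_of_sum_le {χ₁ : DirichletCharacter ℂ M}
    {χ₂ : DirichletCharacter ℂ N} (h₁ : χ₁.IsPrimitive) (h₂ : χ₂.IsPrimitive) {C : ℝ} {k : ℕ}
    (hk : 3 ≤ k) (hC : 0 ≤ C) (h : ∀ N : ℕ, ∑ n ∈ Icc 1 N, ‖convCoeff χ₁ χ₂ n‖ ^ 2 / n ≤
      C * (1 + Real.log N) ^ k) :
    ∃ K, 0 ≤ K ∧ ∀ T : ℝ, 2 ≤ T → ∫ t in T..(2*T), ‖DirichletCharacter.LFunction χ₁ (1/2 + t * I) *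
      DirichletCharacter.LFunction χ₂ (1/2 + t * I)‖ ^ 2 ≤ K * (T * (1 + Real.log T) ^ k) := by
  obtain ⟨K, hK⟩ := integral_normSq_LFunction_mul_le h₁ h₂
  obtain ⟨A, hA, hA'⟩ := exists_meanSquareBound
  refine ⟨|K| * (A + C), by positivity, fun T hT => ?_⟩
  have hlog : 1 ≤ 1 + Real.log T := by have := Real.log_nonneg (by linarith : 1 ≤ T); linarith
  have hB := hA' (convCoeff χ₁ χ₂) T (C * (1 + Real.log T) ^ k) hT (norm_convCoeff_le χ₁ χ₂)
    ((h _).trans (by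
      have := one_le_one_add_log ⌊T⌋₊
      have := one_add_log_floor_le hT
      gcongr))
  have hp : (1 + Real.log T) ^ 3 ≤ (1 + Real.log T) ^ k := pow_le_pow_right₀ hlog hk
  calc _ ≤ K * T * (A * (1 + Real.log T) ^ 3 + C * (1 + Real.log T) ^ k) :=
        hK T _ _ hT (by positivity) (by positivity) hB hB.convCoeff_inv
    _ ≤ |K| * T * (A * (1 + Real.log T) ^ k + C * (1 + Real.log T) ^ k) := by
        gcongr
        exact le_abs_self K
    _ = _ := by ring

lemma exists_integral_normSq_mul_le {χ₁ : DirichletCharacter ℂ M} {χ₂ : DirichletCharacter ℂ N}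
    (h₁ : χ₁.IsPrimitive) (h₂ : χ₂.IsPrimitive) :
    ∃ K, 0 ≤ K ∧ ∀ T : ℝ, 2 ≤ T → ∫ t in T..(2*T), ‖DirichletCharacter.LFunction χ₁ (1/2 + t * I) *
      DirichletCharacter.LFunction χ₂ (1/2 + t * I)‖ ^ 2 ≤ K * (T * (1 + Real.log T) ^ 4) := by
  refine exists_integral_normSq_mul_le_of_sum_le h₁ h₂ (C := 1) (by norm_num) zero_le_one
    fun N => ?_
  rw [one_mul]
  refine le_trans (sum_le_sum fun n _ => ?_) (sum_card_divisors_sq_div_le N)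
  have := norm_convCoeff_le χ₁ χ₂ n
  gcongr

lemma exists_integral_normSq_mul_le_of_ne {χ₁ : DirichletCharacter ℂ M}
    {χ₂ : DirichletCharacter ℂ N} (h₁ : χ₁.IsPrimitive) (h₂ : χ₂.IsPrimitive)
    (h : χ₁.changeLevel (Nat.dvd_mul_right M N) ≠ χ₂.changeLevel (Nat.dvd_mul_left N M)) :
    ∃ K, 0 ≤ K ∧ ∀ T : ℝ, 2 ≤ T → ∫ t in T..(2*T), ‖DirichletCharacter.LFunction χ₁ (1/2 + t * I) *
      DirichletCharacter.LFunction χ₂ (1/2 + t * I)‖ ^ 2 ≤ K * (T * (1 + Real.log T) ^ 3) := by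
  set ψ := χ₁.changeLevel (Nat.dvd_mul_right M N) *
      (χ₂.changeLevel (Nat.dvd_mul_left N M))⁻¹ with hψ
  have hψ1 : ψ ≠ 1 := fun h' => h (mul_inv_eq_one.mp h')
  obtain ⟨C, hC⟩ := exists_norm_sum_char_div_le ψ hψ1
  have hval : ∀ n : ℕ, ψ (n : ZMod (M * N)) = χ₁ (n : ZMod M) * conj (χ₂ (n : ZMod N)) :=
    fun n => by
    have hinv : ∀ x, (χ₂.changeLevel (Nat.dvd_mul_left N M))⁻¹ x =
        conj (χ₂.changeLevel (Nat.dvd_mul_left N M) x) := fun x => by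
      rw [← MulChar.star_apply', starRingEnd_apply]
    rw [hψ, MulChar.mul_apply, hinv]
    by_cases hn : Nat.Coprime n (M * N)
    · have hc : IsCoprime (n : ℤ) ((M * N : ℕ) : ℤ) := Nat.isCoprime_iff_coprime.mpr hn
      have e1 := χ₁.changeLevel_eq_cast_of_dvd' (Nat.dvd_mul_right M N) hc
      have e2 := χ₂.changeLevel_eq_cast_of_dvd' (Nat.dvd_mul_left N M) hc
      simp only [Int.cast_natCast] at e1 e2
      rw [e1, e2]
    · rw [MulChar.map_nonunit _ (by rwa [ZMod.isUnit_iff_coprime]), zero_mul]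
      rw [Nat.coprime_mul_iff_right, not_and_or] at hn
      rcases hn with hn | hn
      · rw [MulChar.map_nonunit χ₁ (by rwa [ZMod.isUnit_iff_coprime]), zero_mul]
      · rw [MulChar.map_nonunit χ₂ (by rwa [ZMod.isUnit_iff_coprime]), map_zero, mul_zero]
  have hC0 : 0 ≤ C := (norm_nonneg _).trans (hC 0)
  refine exists_integral_normSq_mul_le_of_sum_le h₁ h₂ le_rfl hC0 fun K => ?_
  simp_rw [convCoeff_apply]
  refine sum_normSq_convolution_div_le (a := fun n => χ₁ (n : ℕ)) (b := fun n => χ₂ (n : ℕ))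
    (fun m n => by simp) (fun m n => by simp) (by simp) (by simp) (fun n => χ₁.norm_le_one _)
    (fun n => χ₂.norm_le_one _) (fun K => ?_) K
  simp_rw [← hval]
  exact hC K

end Characters

section Imprimitive

open DirichletCharacter

lemma norm_char_inv_eq_one {q a : ℕ} (h : Nat.Coprime a q) (χ : DirichletCharacter ℂ q) :
    ‖χ (a : ZMod q)⁻¹‖ = 1 := by
  have ha : IsUnit (a : ZMod q)⁻¹ := by
    obtain ⟨u, hu⟩ := (ZMod.isUnit_iff_coprime a q).mpr h
    rw [← hu, ZMod.inv_coe_unit]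
    exact u⁻¹.isUnit
  obtain ⟨u, hu⟩ := ha
  rw [← hu]
  exact χ.unit_norm_eq_one u

variable {q : ℕ} [NeZero q]

instance neZero_conductor (χ : DirichletCharacter ℂ q) : NeZero χ.conductor := ⟨χ.conductor_ne_zero⟩

lemma half_add_mul_I_ne_one (t : ℝ) : (1 / 2 + t * I : ℂ) ≠ 1 := fun h => by
  have := congrArg Complex.re h
  norm_num at this

lemma exists_norm_LFunction_le_primitiveCharacter (χ : DirichletCharacter ℂ q) :
    ∃ c : ℝ, 0 ≤ c ∧ ∀ t : ℝ, ‖LFunction χ (1/2 + t * I)‖ ≤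
      c * ‖LFunction χ.primitiveCharacter (1/2 + t * I)‖ := by
  refine ⟨2 ^ #q.primeFactors, by positivity, fun t => ?_⟩
  have h := LFunction_changeLevel χ.conductor_dvd_level χ.primitiveCharacter
    (.inr (half_add_mul_I_ne_one t))
  rw [changeLevel_primitiveCharacter] at h
  rw [h, norm_mul, mul_comm, norm_prod]
  refine mul_le_mul_of_nonneg_right ?_ (norm_nonneg _)
  rw [← prod_const]
  refine prod_le_prod (fun _ _ => norm_nonneg _) fun p hp => ?_
  have hp0 : 0 < p := (Nat.prime_of_mem_primeFactors hp).pos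
  have hp1 : (1 : ℝ) ≤ p := by exact_mod_cast hp0
  refine (norm_sub_le _ _).trans ?_
  rw [norm_one, norm_mul, Complex.norm_natCast_cpow_of_pos hp0]
  have h1 : (p : ℝ) ^ (-(1 / 2 + t * I : ℂ)).re ≤ 1 :=
    Real.rpow_le_one_of_one_le_of_nonpos hp1 (by norm_num)
  have h2 := mul_le_one₀ (χ.primitiveCharacter.norm_le_one (p : ZMod χ.conductor))
    (Real.rpow_nonneg (Nat.cast_nonneg p) _) h1
  linarith

lemma integral_normSq_mul_le_of_primitive (χ₁ χ₂ : DirichletCharacter ℂ q) {k : ℕ}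
    (h : ∃ K, 0 ≤ K ∧ ∀ T : ℝ, 2 ≤ T → ∫ t in T..(2*T),
      ‖LFunction χ₁.primitiveCharacter (1/2 + t * I) *
        LFunction χ₂.primitiveCharacter (1/2 + t * I)‖ ^ 2 ≤ K * (T * (1 + Real.log T) ^ k)) :
    ∃ K, 0 ≤ K ∧ ∀ T : ℝ, 2 ≤ T → ∫ t in T..(2*T),
      ‖LFunction χ₁ (1/2 + t * I) * LFunction χ₂ (1/2 + t * I)‖ ^ 2 ≤
        K * (T * (1 + Real.log T) ^ k) := by
  obtain ⟨K, hK0, hK⟩ := h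
  obtain ⟨c₁, hc₁, h₁⟩ := exists_norm_LFunction_le_primitiveCharacter χ₁
  obtain ⟨c₂, hc₂, h₂⟩ := exists_norm_LFunction_le_primitiveCharacter χ₂
  refine ⟨(c₁ * c₂) ^ 2 * K, by positivity, fun T hT => ?_⟩
  have hcont : ∀ {M N : ℕ} [NeZero M] [NeZero N] (χ : DirichletCharacter ℂ M)
      (ψ : DirichletCharacter ℂ N), IntervalIntegrable
        (fun t : ℝ => ‖LFunction χ (1/2 + t * I) *
            LFunction ψ (1/2 + t * I)‖ ^ 2) volume T (2 * T) :=
    fun χ ψ => (((continuous_LFunction_half_line χ).mul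
      (continuous_LFunction_half_line ψ)).norm.pow 2).intervalIntegrable _ _
  rw [mul_assoc]
  refine le_trans ?_ (mul_le_mul_of_nonneg_left (hK T hT) (by positivity))
  rw [← intervalIntegral.integral_const_mul]
  refine intervalIntegral.integral_mono (by linarith) (hcont _ _)
    ((hcont _ _).const_mul _) fun t => ?_
  dsimp only
  rw [← mul_pow, norm_mul, norm_mul]
  refine pow_le_pow_left₀ (by positivity) ?_ 2
  calc _ ≤ _ := mul_le_mul (h₁ t) (h₂ t) (norm_nonneg _) (by positivity)
    _ = _ := by ring

lemma exists_integral_norm_pow_four_le (χ : DirichletCharacter ℂ q) :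
    ∃ K, 0 ≤ K ∧ ∀ T : ℝ, 2 ≤ T → ∫ t in T..(2*T), ‖LFunction χ (1/2 + t * I)‖ ^ 4 ≤
      K * (T * (1 + Real.log T) ^ 4) := by
  convert integral_normSq_mul_le_of_primitive χ χ (exists_integral_normSq_mul_le
    χ.primitiveCharacter_isPrimitive χ.primitiveCharacter_isPrimitive) using 8
  rw [norm_mul]
  ring

lemma changeLevel_primitiveCharacter_ne {χ₁ χ₂ : DirichletCharacter ℂ q} (h : χ₁ ≠ χ₂) :
    changeLevel (Nat.dvd_mul_right χ₁.conductor χ₂.conductor) χ₁.primitiveCharacter ≠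
      changeLevel (Nat.dvd_mul_left χ₂.conductor χ₁.conductor) χ₂.primitiveCharacter := by
  intro h'
  refine h (changeLevel_injective (Nat.dvd_mul_right q (χ₁.conductor * χ₂.conductor)) ?_)
  have h'' := congrArg (changeLevel (Nat.dvd_mul_left (χ₁.conductor * χ₂.conductor) q)) h'
  rw [← changeLevel_trans, ← changeLevel_trans] at h''
  have e : ∀ (χ : DirichletCharacter ℂ q) {L : ℕ} (hL : q ∣ L), changeLevel hL χ =
      changeLevel (χ.conductor_dvd_level.trans hL) χ.primitiveCharacter := fun χ L hL => by
    rw [changeLevel_trans _ χ.conductor_dvd_level, changeLevel_primitiveCharacter]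
  rw [e, e]
  exact h''

lemma exists_integral_normSq_mul_le_of_char_ne {χ₁ χ₂ : DirichletCharacter ℂ q} (h : χ₁ ≠ χ₂) :
    ∃ K, 0 ≤ K ∧ ∀ T : ℝ, 2 ≤ T → ∫ t in T..(2*T),
      ‖LFunction χ₁ (1/2 + t * I) * LFunction χ₂ (1/2 + t * I)‖ ^ 2 ≤
        K * (T * (1 + Real.log T) ^ 3) :=
  integral_normSq_mul_le_of_primitive χ₁ χ₂ (exists_integral_normSq_mul_le_of_ne
    χ₁.primitiveCharacter_isPrimitive χ₂.primitiveCharacter_isPrimitive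
    (changeLevel_primitiveCharacter_ne h))

lemma totient_mul_hurwitzZeta_eq {a : ℕ} (h : Nat.Coprime a q) (s : ℂ) :
    (q.totient : ℂ) * hurwitzZeta (((a : ℝ) / (q : ℝ) : ℝ) : UnitAddCircle) s =
      (q : ℂ) ^ s * ∑ χ : DirichletCharacter ℂ q, χ (a : ZMod q)⁻¹ * LFunction χ s := by
  have hq : (q : ℂ) ≠ 0 := NeZero.ne _
  have ha : IsUnit (a : ZMod q) := (ZMod.isUnit_iff_coprime a q).mpr h
  have hL : ∀ χ : DirichletCharacter ℂ q, χ (a : ZMod q)⁻¹ * LFunction χ s =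
      (q : ℂ) ^ (-s) * ∑ j : ZMod q, χ (a : ZMod q)⁻¹ * χ j * hurwitzZeta (ZMod.toAddCircle j) s :=
    fun χ => by
      rw [DirichletCharacter.LFunction, ZMod.LFunction, mul_left_comm, mul_sum]
      simp_rw [mul_assoc]
  simp_rw [hL]
  rw [← mul_sum, sum_comm, ← mul_assoc, cpow_neg, mul_inv_cancel₀ (by simp [cpow_eq_zero_iff, hq]),
    one_mul]
  simp_rw [← sum_mul, sum_char_inv_mul_char_eq ℂ ha, ite_mul, zero_mul]
  rw [sum_ite_eq, if_pos (mem_univ _), ZMod.toAddCircle_natCast]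

lemma norm_hurwitzZeta_pow_four_eq {a : ℕ} (h : Nat.Coprime a q) (t : ℝ) :
    ‖hurwitzZeta (((a : ℝ) / (q : ℝ) : ℝ) : UnitAddCircle) (1/2 + t * I)‖ ^ 4 =
      (q : ℝ) ^ 2 / (q.totient : ℝ) ^ 4 *
        ‖∑ χ : DirichletCharacter ℂ q, χ (a : ZMod q)⁻¹ * LFunction χ (1/2 + t * I)‖ ^ 4 := by
  have hq : 0 < q := Nat.pos_of_neZero q
  have hφ : (0 : ℝ) < q.totient := by exact_mod_cast Nat.totient_pos.mpr hq
  have h1 := congrArg (fun z => ‖z‖ ^ 4) (totient_mul_hurwitzZeta_eq h (1/2 + t * I))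
  simp only [norm_mul, mul_pow, Complex.norm_natCast, Complex.norm_natCast_cpow_of_pos hq] at h1
  have h2 : ((q : ℝ) ^ (1 / 2 + t * I : ℂ).re) ^ 4 = (q : ℝ) ^ 2 := by
    rw [← Real.rpow_natCast, ← Real.rpow_mul (by positivity), ← Real.rpow_natCast]
    norm_num
  rw [h2] at h1
  rw [div_mul_eq_mul_div, eq_div_iff (by positivity), mul_comm, h1]

end Imprimitive

section Finish

lemma abs_norm_sum_pow_four_sub_le {ι : Type*} [Fintype ι] [DecidableEq ι] (x : ι → ℂ) {ε : ℝ}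
    (hε : 0 < ε) : |‖∑ i, x i‖ ^ 4 - ∑ i, ‖x i‖ ^ 4| ≤
      ε * Fintype.card ι * ∑ i, ‖x i‖ ^ 4 + (1 + (1 + 1 / ε) * #(univ : Finset ι).offDiag) *
        ∑ p ∈ (univ : Finset ι).offDiag, ‖x p.1 * x p.2‖ ^ 2 := by
  have hsplit : ∀ {R : Type} [AddCommMonoid R] (f : ι × ι → R), ∑ p, f p =
      ∑ i, f (i, i) + ∑ p ∈ (univ : Finset ι).offDiag, f p := fun f => by
    rw [← univ_product_univ, ← diag_union_offDiag, sum_union (disjoint_diag_offDiag _), sum_diag]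
  set A := ∑ i, ‖x i‖ ^ 2 with hA
  set S := ∑ i, ‖x i‖ ^ 4 with hS
  set Q := ∑ p ∈ (univ : Finset ι).offDiag, ‖x p.1 * x p.2‖ ^ 2 with hQ
  set O := ∑ p ∈ (univ : Finset ι).offDiag, ‖x p.1 * x p.2‖ with hO
  set m : ℝ := (#(univ : Finset ι).offDiag : ℝ)
  have hA2 : A ^ 2 = S + Q := by
    rw [hA, sq, sum_mul_sum, ← Fintype.sum_prod_type', hsplit]
    congr 1
    · exact sum_congr rfl fun i _ => by ring
    · exact sum_congr rfl fun p _ => by rw [norm_mul]; ring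
  have hAS : A ^ 2 ≤ Fintype.card ι * S := by
    have := sq_sum_le_card_mul_sum_sq (s := (univ : Finset ι)) (f := fun i => ‖x i‖ ^ 2)
    refine this.trans_eq ?_
    rw [card_univ, hS]
    congr 1
    exact sum_congr rfl fun i _ => by ring
  have hOQ : O ^ 2 ≤ m * Q := sq_sum_le_card_mul_sum_sq
  have hD : |‖∑ i, x i‖ ^ 2 - A| ≤ O := by
    have h1 : ((‖∑ i, x i‖ ^ 2 - A : ℝ) : ℂ) =
        ∑ p ∈ (univ : Finset ι).offDiag, x p.1 * (starRingEnd ℂ) (x p.2) := by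
      push_cast
      rw [← Complex.mul_conj', map_sum, sum_mul_sum, ← Fintype.sum_prod_type', hsplit, hA]
      push_cast
      simp_rw [Complex.mul_conj']
      ring
    rw [← Real.norm_eq_abs, ← Complex.norm_real, h1]
    refine norm_sum_le_of_le _ fun p _ => ?_
    rw [norm_mul, norm_mul, RCLike.norm_conj]
  set D := ‖∑ i, x i‖ ^ 2 - A with hDdef
  have hD2 : D ^ 2 ≤ m * Q := by
    rw [← sq_abs]
    exact (pow_le_pow_left₀ (abs_nonneg _) hD 2).trans hOQ
  have h4 : ‖∑ i, x i‖ ^ 4 - S = Q + 2 * A * D + D ^ 2 := by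
    have : ‖∑ i, x i‖ ^ 2 = A + D := by rw [hDdef]; ring
    calc ‖∑ i, x i‖ ^ 4 - S = (‖∑ i, x i‖ ^ 2) ^ 2 - S := by ring
      _ = _ := by rw [this]; linear_combination hA2
  have hQ0 : 0 ≤ Q := sum_nonneg fun _ _ => by positivity
  have hAD : |2 * A * D| ≤ ε * A ^ 2 + 1 / ε * D ^ 2 := by
    have h5 : ε * (ε * A ^ 2 + 1 / ε * D ^ 2 - |2 * A * D|) = (ε * |A| - |D|) ^ 2 := by
      rw [abs_mul, abs_mul, abs_two, ← sq_abs A, ← sq_abs D]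
      field_simp
      ring
    have h6 : 0 ≤ ε * A ^ 2 + 1 / ε * D ^ 2 - |2 * A * D| :=
      nonneg_of_mul_nonneg_right (h5 ▸ sq_nonneg _) hε
    linarith
  rw [h4]
  calc |Q + 2 * A * D + D ^ 2| ≤ |Q| + |2 * A * D| + |D ^ 2| := abs_add_three _ _ _
    _ ≤ Q + (ε * A ^ 2 + 1 / ε * D ^ 2) + D ^ 2 := by
        rw [abs_of_nonneg hQ0, abs_of_nonneg (sq_nonneg D)]
        linarith
    _ ≤ Q + (ε * (Fintype.card ι * S) + 1 / ε * (m * Q)) + m * Q := by gcongr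
    _ = _ := by ring

/-- A criterion for `E(T) = o(T (log T)⁴)`. -/
lemma tendsto_div_of_forall_le {E : ℝ → ℝ} {K : ℝ} (hK : 0 ≤ K)
    (h : ∀ ε > 0, ∃ C, 0 ≤ C ∧ ∀ T : ℝ, 2 ≤ T →
      |E T| ≤ ε * (K * (T * (1 + Real.log T) ^ 4)) + C * (T * (1 + Real.log T) ^ 3)) :
    Tendsto (fun T => E T / (T * Real.log T ^ 4)) atTop (nhds 0) := by
  rw [Metric.tendsto_atTop']
  intro δ hδ
  obtain ⟨C, hC, hE⟩ := h (δ / (2 * (16 * K + 1))) (by positivity)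
  have hlog : Tendsto Real.log atTop atTop := Real.tendsto_log_atTop
  obtain ⟨T₀, hT₀⟩ := (eventually_atTop.mp ((hlog.eventually_gt_atTop (1 + 16 * C / δ)).and
    (eventually_ge_atTop 2)))
  refine ⟨T₀, fun T hT => ?_⟩
  obtain ⟨hl, hT2⟩ := hT₀ T hT.le
  have hCδ : 0 ≤ 16 * C / δ := by positivity
  have hl1 : 1 ≤ Real.log T := by linarith
  have hT0 : 0 < T := by linarith
  have hl0 : 0 < Real.log T := by linarith
  rw [dist_zero_right, Real.norm_eq_abs, abs_div,
    abs_of_pos (by positivity : 0 < T * Real.log T ^ 4),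
    div_lt_iff₀ (by positivity)]
  have h2 : 1 + Real.log T ≤ 2 * Real.log T := by linarith
  have hCl : 8 * C < δ / 2 * Real.log T := by
    have : 16 * C / δ < Real.log T := by linarith
    rw [div_lt_iff₀ hδ] at this
    linarith
  calc |E T| ≤ _ := hE T hT2
    _ ≤ δ / (2 * (16 * K + 1)) * (K * (T * (2 * Real.log T) ^ 4)) +
        C * (T * (2 * Real.log T) ^ 3) := by
        have : 0 ≤ 1 + Real.log T := by linarith
        gcongr
    _ = δ / 2 * (16 * K / (16 * K + 1)) * (T * Real.log T ^ 4) + 8 * C * (T * Real.log T ^ 3) := by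
        field_simp
        ring
    _ < δ / 2 * 1 * (T * Real.log T ^ 4) + (δ / 2 * Real.log T) * (T * Real.log T ^ 3) := by
        refine add_lt_add_of_le_of_lt ?_ (mul_lt_mul_of_pos_right hCl (by positivity))
        gcongr
        rw [div_le_one (by positivity)]
        linarith
    _ = _ := by ring

end Finish

section

open DirichletCharacter

variable {q : ℕ} [NeZero q]

lemma exists_sum_integral_norm_pow_four_le (q : ℕ) [NeZero q] :
    ∃ K, 0 ≤ K ∧ ∀ T : ℝ, 2 ≤ T → ∑ χ : DirichletCharacter ℂ q,
      ∫ t in T..(2*T), ‖LFunction χ (1/2 + t * I)‖ ^ 4 ≤ K * (T * (1 + Real.log T) ^ 4) := by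
  choose K hK0 hK using fun χ : DirichletCharacter ℂ q => exists_integral_norm_pow_four_le χ
  refine ⟨∑ χ, K χ, sum_nonneg fun χ _ => hK0 χ, fun T hT => ?_⟩
  rw [sum_mul]
  exact sum_le_sum fun χ _ => hK χ T hT

lemma exists_sum_offDiag_integral_le (q : ℕ) [NeZero q] :
    ∃ K, 0 ≤ K ∧ ∀ T : ℝ, 2 ≤ T → ∑ p ∈ (univ : Finset (DirichletCharacter ℂ q)).offDiag,
      ∫ t in T..(2*T), ‖LFunction p.1 (1/2 + t * I) * LFunction p.2 (1/2 + t * I)‖ ^ 2 ≤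
        K * (T * (1 + Real.log T) ^ 3) := by
  choose K hK0 hK using fun
    p : {p : DirichletCharacter ℂ q × DirichletCharacter ℂ q // p.1 ≠ p.2} =>
    exists_integral_normSq_mul_le_of_char_ne p.2
  have hne : ∀ p : ((univ : Finset (DirichletCharacter ℂ q)).offDiag), p.1.1 ≠ p.1.2 :=
    fun p => (mem_offDiag.mp p.2).2.2
  refine ⟨∑ p ∈ (univ : Finset (DirichletCharacter ℂ q)).offDiag.attach, K ⟨p.1, hne p⟩,
    sum_nonneg fun p _ => hK0 _, fun T hT => ?_⟩
  rw [sum_mul, ← sum_attach]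
  exact sum_le_sum fun p _ => hK ⟨p.1, hne p⟩ T hT

lemma abs_integral_sub_le {w : DirichletCharacter ℂ q → ℂ} (hw : ∀ χ, ‖w χ‖ = 1) {ε : ℝ}
    (hε : 0 < ε) {T : ℝ} (hT : 0 ≤ T) :
    |(∫ t in T..(2*T), ‖∑ χ, w χ * LFunction χ (1/2 + t * I)‖ ^ 4) -
      ∑ χ : DirichletCharacter ℂ q, ∫ t in T..(2*T), ‖LFunction χ (1/2 + t * I)‖ ^ 4| ≤
      ε * Fintype.card (DirichletCharacter ℂ q) *
        (∑ χ : DirichletCharacter ℂ q, ∫ t in T..(2*T), ‖LFunction χ (1/2 + t * I)‖ ^ 4) +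
      (1 + (1 + 1 / ε) * #(univ : Finset (DirichletCharacter ℂ q)).offDiag) *
        ∑ p ∈ (univ : Finset (DirichletCharacter ℂ q)).offDiag,
          ∫ t in T..(2*T), ‖LFunction p.1 (1/2 + t * I) * LFunction p.2 (1/2 + t * I)‖ ^ 2 := by
  have hc : ∀ χ : DirichletCharacter ℂ q, Continuous fun t : ℝ => LFunction χ (1/2 + t * I) :=
    continuous_LFunction_half_line
  have h4 : ∀ χ : DirichletCharacter ℂ q, Continuous fun t : ℝ => ‖LFunction χ (1/2 + t * I)‖ ^ 4 :=
    fun χ => (hc χ).norm.pow 4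
  have h2 : ∀ p : DirichletCharacter ℂ q × DirichletCharacter ℂ q, Continuous
      fun t : ℝ => ‖LFunction p.1 (1/2 + t * I) * LFunction p.2 (1/2 + t * I)‖ ^ 2 :=
    fun p => ((hc p.1).mul (hc p.2)).norm.pow 2
  have hs : Continuous fun t : ℝ => ‖∑ χ, w χ * LFunction χ (1/2 + t * I)‖ ^ 4 :=
    (continuous_finsetSum _ fun χ _ => continuous_const.mul (hc χ)).norm.pow 4
  have hs4 := continuous_finsetSum univ fun χ _ => h4 χ
  have hs2 := continuous_finsetSum (univ : Finset (DirichletCharacter ℂ q)).offDiag fun p _ => h2 p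
  rw [← intervalIntegral.integral_finsetSum fun χ _ => (h4 χ).intervalIntegrable _ _,
    ← intervalIntegral.integral_finsetSum fun p _ => (h2 p).intervalIntegrable _ _,
    ← intervalIntegral.integral_sub (hs.intervalIntegrable _ _) (hs4.intervalIntegrable _ _),
    ← intervalIntegral.integral_const_mul, ← intervalIntegral.integral_const_mul,
    ← intervalIntegral.integral_add ((hs4.const_mul _).intervalIntegrable _ _)
      ((hs2.const_mul _).intervalIntegrable _ _)]
  refine (intervalIntegral.abs_integral_le_integral_abs (by linarith)).trans
    (intervalIntegral.integral_mono (by linarith) ((hs.sub hs4).abs.intervalIntegrable _ _)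
      (((hs4.const_mul _).add (hs2.const_mul _)).intervalIntegrable _ _) fun t => ?_)
  have h := abs_norm_sum_pow_four_sub_le (fun χ => w χ * LFunction χ (1/2 + t * I)) hε
  simpa only [norm_mul, hw, one_mul] using h

end

end HurwitzFourthMoment

/-- Unconditionally, for `α = a/q` with `gcd(a,q) = 1`,
`∫_T^{2T} |ζ(1/2+it,α)|⁴ dt = (q²/φ(q)⁴) ∑_χ ∫_T^{2T} |L(1/2+it,χ)|⁴ dt + E(T)` with
`E(T) = o(T (log T)⁴)`. -/
theorem hurwitz_fourth_moment_decomposition (a q : ℕ) [NeZero q] (ha : 1 ≤ a) (haq : a ≤ q)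
    (hgcd : Nat.gcd a q = 1) :
    ∃ E : ℝ → ℝ,
      (∀ T : ℝ,
        (∫ t in T..(2*T),
            ‖hurwitzZeta (((a : ℝ) / (q : ℝ) : ℝ) : UnitAddCircle) (1/2 + t * Complex.I)‖ ^ 4)
          = ((q : ℝ) ^ 2 / (q.totient : ℝ) ^ 4) *
              (∑ χ : DirichletCharacter ℂ q,
                ∫ t in T..(2*T), ‖DirichletCharacter.LFunction χ (1/2 + t * Complex.I)‖ ^ 4)
            + E T) ∧
      Tendsto (fun T : ℝ => E T / (T * Real.log T ^ 4)) atTop (nhds 0) := by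
  refine ⟨fun T => (q : ℝ) ^ 2 / (q.totient : ℝ) ^ 4 * ((∫ t in T..(2*T),
      ‖∑ χ : DirichletCharacter ℂ q,
        χ (a : ZMod q)⁻¹ * DirichletCharacter.LFunction χ (1/2 + t * Complex.I)‖ ^ 4) -
      ∑ χ : DirichletCharacter ℂ q,
        ∫ t in T..(2*T), ‖DirichletCharacter.LFunction χ (1/2 + t * Complex.I)‖ ^ 4),
    fun T => ?_, ?_⟩
  · simp_rw [HurwitzFourthMoment.norm_hurwitzZeta_pow_four_eq hgcd]
    rw [intervalIntegral.integral_const_mul]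
    ring
  · obtain ⟨K₁, hK₁, h₁⟩ := HurwitzFourthMoment.exists_sum_integral_norm_pow_four_le q
    obtain ⟨K₂, hK₂, h₂⟩ := HurwitzFourthMoment.exists_sum_offDiag_integral_le q
    set κ := (q : ℝ) ^ 2 / (q.totient : ℝ) ^ 4
    have hκ : 0 ≤ κ := by positivity
    refine HurwitzFourthMoment.tendsto_div_of_forall_le
      (K := κ * Fintype.card (DirichletCharacter ℂ q) * K₁) (by positivity) fun ε hε =>
      ⟨κ * ((1 + (1 + 1 / ε) * #(univ : Finset (DirichletCharacter ℂ q)).offDiag) * K₂),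
        by positivity, fun T hT => ?_⟩
    rw [abs_mul, abs_of_nonneg hκ]
    calc _ ≤ κ * (ε * Fintype.card (DirichletCharacter ℂ q) * (K₁ * (T * (1 + Real.log T) ^ 4)) +
          (1 + (1 + 1 / ε) * #(univ : Finset (DirichletCharacter ℂ q)).offDiag) *
            (K₂ * (T * (1 + Real.log T) ^ 3))) := by
          refine mul_le_mul_of_nonneg_left ((HurwitzFourthMoment.abs_integral_sub_le
            (HurwitzFourthMoment.norm_char_inv_eq_one hgcd) hε (by linarith)).trans ?_) hκ
          gcongr
          · exact h₁ T hT
          · exact h₂ T hT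
      _ = _ := by ring
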